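/- Let (a_n)_{n≥1} be a sequence of distinct positive real numbers such that inf_{1≤m≠n≤N} |a_m − a_n| ≥ 1 for all N ∈ ℕ. Then for almost all α ∈ [0,1], the inequality min_{1≤m≠n≤N} ‖α·⌊a_m − a_n⌋‖ ≤ 4·log₂ B̃_N / (H_N · log(N/9) · log₂(N/9)) holds for infinitely many N, where B̃_N = max_{1≤m≠n≤N} |⌊a_m − a_n⌋|. -/

import Mathlib

open MeasureTheory Filter

/-- Distance from a real number to the nearest integer. -/
noncomputable def nint (x : ℝ) : ℝ := |x - round x|

/-- `Hcard a N` is the number of distinct floored positive differences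
`#{ ⌊|a_m − a_n|⌋ : 1 ≤ m ≠ n ≤ N }`. -/
noncomputable def Hcard (a : ℕ → ℝ) (N : ℕ) : ℕ :=
  Set.ncard {k : ℤ | ∃ m n : ℕ, 1 ≤ m ∧ m ≤ N ∧ 1 ≤ n ∧ n ≤ N ∧ m ≠ n ∧
    k = ⌊|a m - a n|⌋}

/-- `min { ‖α ⌊a_m − a_n⌋‖ : 1 ≤ m ≠ n ≤ N }`, with the floor of the
signed difference. -/
noncomputable def signedFloorDeltaMin (a : ℕ → ℝ) (α : ℝ) (N : ℕ) : ℝ :=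
  sInf {d : ℝ | ∃ m n : ℕ, 1 ≤ m ∧ m ≤ N ∧ 1 ≤ n ∧ n ≤ N ∧ m ≠ n ∧
    d = nint (α * (⌊a m - a n⌋ : ℝ))}

/-- `Log x = max (1, log x)`. -/
noncomputable def Log (x : ℝ) : ℝ := max 1 (Real.log x)

/-- Iterated logarithm `log₂ x = Log (Log x)`. -/
noncomputable def Log2 (x : ℝ) : ℝ := Log (Log x)

lemma exists_fourth_root {x : ℝ} (hx : 0 ≤ x) :
    ∃ b : ℝ, 0 ≤ b ∧ x = b ^ 4 ∧ x ^ (3 / 4 : ℝ) = b ^ 3 := by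
  refine ⟨x ^ (1 / 4 : ℝ), by positivity, ?_, ?_⟩
  · rw [← Real.rpow_natCast, ← Real.rpow_mul hx]; norm_num
  · rw [← Real.rpow_natCast, ← Real.rpow_mul hx]; norm_num

lemma sum_rpow_mul_le {ι : Type*} (s : Finset ι) (A B : ι → ℝ) {R : ℝ} (hA : ∀ i ∈ s, 0 ≤ A i)
    (hB : ∀ i ∈ s, 0 ≤ B i) (hR : 0 ≤ R) (h : ∑ i ∈ s, B i ^ 4 ≤ R ^ 4) :
    ∑ i ∈ s, A i ^ (3 / 4 : ℝ) * B i ≤ (∑ i ∈ s, A i) ^ (3 / 4 : ℝ) * R := by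
  have hpq : Real.HolderConjugate (4 / 3 : ℝ) 4 := by
    rw [Real.holderConjugate_iff]; norm_num
  have := Real.inner_le_Lp_mul_Lq_of_nonneg hpq (s := s) (f := fun i => A i ^ (3 / 4 : ℝ)) (g := B)
    (fun i hi => Real.rpow_nonneg (hA i hi) _) hB
  refine this.trans ?_
  have e1 : ∑ i ∈ s, (A i ^ (3 / 4 : ℝ)) ^ (4 / 3 : ℝ) = ∑ i ∈ s, A i := by
    refine Finset.sum_congr rfl fun i hi => ?_
    rw [← Real.rpow_mul (hA i hi)]; norm_num
  rw [e1]
  have e2 : (1 : ℝ) / (4 / 3) = 3 / 4 := by norm_num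
  rw [e2]
  refine mul_le_mul_of_nonneg_left ?_ (Real.rpow_nonneg (Finset.sum_nonneg hA) _)
  calc (∑ i ∈ s, B i ^ (4 : ℝ)) ^ (1 / 4 : ℝ) ≤ (R ^ 4) ^ (1 / 4 : ℝ) := by
        refine Real.rpow_le_rpow (Finset.sum_nonneg fun i hi => Real.rpow_nonneg (hB i hi) _) ?_
          (by norm_num)
        refine le_trans (le_of_eq ?_) h
        refine Finset.sum_congr rfl fun i hi => ?_
        exact_mod_cast Real.rpow_natCast (B i) 4
    _ = R := by
        rw [← Real.rpow_natCast, ← Real.rpow_mul hR]; norm_num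

/-- Schur's test for the exponent `3 / 4`. -/
lemma sum_sum_rpow_mul_le {ι κ : Type*} (s : Finset ι) (t : Finset κ) (v : ι → ℝ) (w : κ → ℝ)
    (k : ι → κ → ℝ) {Λ : ℝ} (hv : ∀ i ∈ s, 0 ≤ v i) (hw : ∀ j ∈ t, 0 ≤ w j)
    (hk : ∀ i ∈ s, ∀ j ∈ t, 0 ≤ k i j) (hΛ : 0 ≤ Λ)
    (h1 : ∀ i ∈ s, ∑ j ∈ t, k i j ≤ Λ) (h2 : ∀ j ∈ t, ∑ i ∈ s, k i j ≤ Λ) :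
    ∑ i ∈ s, ∑ j ∈ t, (v i * w j) ^ (3 / 4 : ℝ) * k i j ≤
      Λ * ((∑ i ∈ s, v i) * ∑ j ∈ t, w j) ^ (3 / 4 : ℝ) := by
  set V := ∑ i ∈ s, v i
  set W := ∑ j ∈ t, w j
  have hV : 0 ≤ V := Finset.sum_nonneg hv
  have hW : 0 ≤ W := Finset.sum_nonneg hw
  have hstep : ∀ i ∈ s, ∀ j ∈ t, (v i * w j) ^ (3 / 4 : ℝ) * k i j ≤
      (V * W) ^ (1 / 4 : ℝ) * (√(v i * k i j) * √(w j * k i j)) := by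
    intro i hi j hj
    have hvw : 0 ≤ v i * w j := mul_nonneg (hv i hi) (hw j hj)
    have e : (v i * w j) ^ (3 / 4 : ℝ) = (v i * w j) ^ (1 / 4 : ℝ) * √(v i * w j) := by
      rw [Real.sqrt_eq_rpow, ← Real.rpow_add_of_nonneg hvw (by norm_num) (by norm_num)]
      norm_num
    have e2 : √(v i * k i j) * √(w j * k i j) = √(v i * w j) * k i j := by
      rw [← Real.sqrt_mul (mul_nonneg (hv i hi) (hk i hi j hj)),
        show v i * k i j * (w j * k i j) = (v i * w j) * (k i j) ^ 2 by ring,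
        Real.sqrt_mul hvw, Real.sqrt_sq (hk i hi j hj)]
    rw [e, e2, mul_assoc]
    refine mul_le_mul_of_nonneg_right ?_ (mul_nonneg (Real.sqrt_nonneg _) (hk i hi j hj))
    refine Real.rpow_le_rpow hvw ?_ (by norm_num)
    exact mul_le_mul (Finset.single_le_sum hv hi) (Finset.single_le_sum hw hj) (hw j hj) hV
  have hcs : ∑ i ∈ s, ∑ j ∈ t, √(v i * k i j) * √(w j * k i j) ≤ Λ * √(V * W) := by
    rw [← Finset.sum_product' (f := fun i j => √(v i * k i j) * √(w j * k i j))]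
    refine (Real.sum_mul_le_sqrt_mul_sqrt _ _ _).trans ?_
    have b1 : ∑ x ∈ s ×ˢ t, √(v x.1 * k x.1 x.2) ^ 2 ≤ Λ * V := by
      rw [Finset.sum_product' (f := fun i j => √(v i * k i j) ^ 2), Finset.mul_sum]
      refine Finset.sum_le_sum fun i hi => ?_
      calc ∑ j ∈ t, √(v i * k i j) ^ 2 = ∑ j ∈ t, v i * k i j :=
            Finset.sum_congr rfl fun j hj => Real.sq_sqrt (mul_nonneg (hv i hi) (hk i hi j hj))
        _ = (∑ j ∈ t, k i j) * v i := by rw [← Finset.mul_sum, mul_comm]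
        _ ≤ Λ * v i := mul_le_mul_of_nonneg_right (h1 i hi) (hv i hi)
    have b2 : ∑ x ∈ s ×ˢ t, √(w x.2 * k x.1 x.2) ^ 2 ≤ Λ * W := by
      rw [Finset.sum_product_right' (f := fun i j => √(w j * k i j) ^ 2), Finset.mul_sum]
      refine Finset.sum_le_sum fun j hj => ?_
      calc ∑ i ∈ s, √(w j * k i j) ^ 2 = ∑ i ∈ s, w j * k i j :=
            Finset.sum_congr rfl fun i hi => Real.sq_sqrt (mul_nonneg (hw j hj) (hk i hi j hj))
        _ = (∑ i ∈ s, k i j) * w j := by rw [← Finset.mul_sum, mul_comm]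
        _ ≤ Λ * w j := mul_le_mul_of_nonneg_right (h2 j hj) (hw j hj)
    calc _ ≤ √(Λ * V) * √(Λ * W) := by gcongr
      _ = Λ * √(V * W) := by
        rw [← Real.sqrt_mul (by positivity), show Λ * V * (Λ * W) = Λ ^ 2 * (V * W) by ring,
          Real.sqrt_mul (by positivity), Real.sqrt_sq hΛ]
  calc _ ≤ ∑ i ∈ s, ∑ j ∈ t, (V * W) ^ (1 / 4 : ℝ) * (√(v i * k i j) * √(w j * k i j)) :=
        Finset.sum_le_sum fun i hi => Finset.sum_le_sum fun j hj => hstep i hi j hj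
    _ = (V * W) ^ (1 / 4 : ℝ) * ∑ i ∈ s, ∑ j ∈ t, (√(v i * k i j) * √(w j * k i j)) := by
        simp_rw [Finset.mul_sum]
    _ ≤ (V * W) ^ (1 / 4 : ℝ) * (Λ * √(V * W)) := by gcongr
    _ = Λ * (V * W) ^ (3 / 4 : ℝ) := by
        rw [Real.sqrt_eq_rpow, mul_left_comm, ← Real.rpow_add_of_nonneg (by positivity) (by norm_num) (by norm_num)]
        norm_num

lemma sum_pow_le_of_pos {t : ℝ} (h0 : 0 ≤ t) (h1 : t < 1) (s : Finset ℕ) (hs : ∀ k ∈ s, 1 ≤ k) :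
    ∑ k ∈ s, t ^ k ≤ t / (1 - t) := by
  have hsum : Summable fun k : ℕ => t * t ^ k := (summable_geometric_of_lt_one h0 h1).mul_left t
  have hinj : Set.InjOn (fun k : ℕ => k - 1) s := by
    intro x hx y hy hxy
    have := hs x hx
    have := hs y hy
    simp only at hxy
    omega
  calc ∑ k ∈ s, t ^ k = ∑ k ∈ s.image (fun k => k - 1), t * t ^ k := by
        rw [Finset.sum_image hinj]
        refine Finset.sum_congr rfl fun k hk => ?_
        rw [← pow_succ', Nat.sub_add_cancel (hs k hk)]
    _ ≤ ∑' k : ℕ, t * t ^ k := hsum.sum_le_tsum _ fun k _ => by positivity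
    _ = t / (1 - t) := by
        rw [tsum_mul_left, tsum_geometric_of_lt_one h0 h1, div_eq_mul_inv]

lemma sum_pow_dist_le_of_gt {t : ℝ} (h0 : 0 ≤ t) (h1 : t < 1) (x : ℕ) (s : Finset ℕ)
    (hs : ∀ y ∈ s, x < y) : ∑ y ∈ s, t ^ Nat.dist x y ≤ t / (1 - t) := by
  have hinj : Set.InjOn (fun y : ℕ => y - x) s := by
    intro a ha b hb hab
    have := hs a ha
    have := hs b hb
    simp only at hab
    omega
  calc _ = ∑ k ∈ s.image (fun y => y - x), t ^ k := by
        rw [Finset.sum_image hinj]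
        exact Finset.sum_congr rfl fun k hk => by rw [Nat.dist_eq_sub_of_le (hs k hk).le]
    _ ≤ _ := sum_pow_le_of_pos h0 h1 _ fun k hk => by
        obtain ⟨y, hy, rfl⟩ := Finset.mem_image.1 hk
        have := hs y hy
        omega

lemma sum_pow_dist_le_of_lt {t : ℝ} (h0 : 0 ≤ t) (h1 : t < 1) (x : ℕ) (s : Finset ℕ)
    (hs : ∀ y ∈ s, y < x) : ∑ y ∈ s, t ^ Nat.dist x y ≤ t / (1 - t) := by
  have hinj : Set.InjOn (fun y : ℕ => x - y) s := by
    intro a ha b hb hab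
    have := hs a ha
    have := hs b hb
    simp only at hab
    omega
  calc _ = ∑ k ∈ s.image (fun y => x - y), t ^ k := by
        rw [Finset.sum_image hinj]
        exact Finset.sum_congr rfl fun k hk => by rw [Nat.dist_eq_sub_of_le_right (hs k hk).le]
    _ ≤ _ := sum_pow_le_of_pos h0 h1 _ fun k hk => by
        obtain ⟨y, hy, rfl⟩ := Finset.mem_image.1 hk
        have := hs y hy
        omega

lemma sum_pow_dist_le_of_ne {t : ℝ} (h0 : 0 ≤ t) (h1 : t < 1) (x : ℕ) (s : Finset ℕ)
    (hs : ∀ y ∈ s, y ≠ x) : ∑ y ∈ s, t ^ Nat.dist x y ≤ 2 * (t / (1 - t)) := by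
  rw [← Finset.sum_filter_add_sum_filter_not s (fun y => y < x), two_mul]
  refine add_le_add (sum_pow_dist_le_of_lt h0 h1 x _ fun y hy => (Finset.mem_filter.1 hy).2)
    (sum_pow_dist_le_of_gt h0 h1 x _ fun y hy => ?_)
  obtain ⟨h, h'⟩ := Finset.mem_filter.1 hy
  have := hs y h
  omega

lemma sum_pow_dist_le {t : ℝ} (h0 : 0 ≤ t) (h1 : t < 1) (x : ℕ) (s : Finset ℕ) :
    ∑ y ∈ s, t ^ Nat.dist x y ≤ 1 + 2 * (t / (1 - t)) := by
  have h := sum_pow_dist_le_of_ne h0 h1 x (s.erase x) fun y hy => (Finset.mem_erase.1 hy).1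
  by_cases hx : x ∈ s
  · rw [← Finset.add_sum_erase s _ hx, Nat.dist_self, pow_zero]
    gcongr
  · rw [Finset.erase_eq_of_notMem hx] at h
    linarith

lemma rpow_three_quarters_le {u : ℝ} (hu : u ≤ 1) : (1 - u) ^ (3 / 4 : ℝ) ≤ 1 - 3 / 4 * u := by
  have := rpow_one_add_le_one_add_mul_self (s := -u) (by linarith) (p := 3 / 4)
    (by norm_num) (by norm_num)
  rw [← sub_eq_add_neg] at this
  linarith

lemma four_mul_mul_cube_le (u b : ℝ) (hu : 0 ≤ u) (hb : 0 ≤ b) :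
    4 * (u * b ^ 3) ≤ 3 * b ^ 4 + u ^ 4 := by
  have : 0 ≤ (b - u) ^ 2 * (3 * b ^ 2 + 2 * u * b + u ^ 2) := by positivity
  nlinarith

/-- Sums over a square split off the cross through a point. -/
lemma sum_sum_eq_cross (s : Finset ℕ) (F : ℕ → ℕ → ℝ) {x₀ : ℕ} (hx : x₀ ∈ s) :
    ∑ x ∈ s, ∑ y ∈ s, F x y = F x₀ x₀ + ∑ y ∈ s.erase x₀, F x₀ y +
      ∑ x ∈ s.erase x₀, F x x₀ + ∑ x ∈ s.erase x₀, ∑ y ∈ s.erase x₀, F x y := by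
  rw [← Finset.add_sum_erase s _ hx, ← Finset.add_sum_erase s _ hx, add_assoc,
    add_assoc, add_assoc, add_left_cancel_iff, add_left_cancel_iff, ← Finset.sum_add_distrib]
  exact Finset.sum_congr rfl fun x _ => (Finset.add_sum_erase s _ hx).symm

lemma far_bound {κ b g tot : ℝ} (hκ : 0 ≤ κ) (hb : 0 ≤ b) (hg : 0 ≤ g) (hb1 : b ^ 4 ≤ 1 / 1100)
    (hg1 : g ^ 4 ≤ 1 / 1100) (hfar : 1119744 * κ ^ 4 ≤ b ^ 4 + g ^ 4)
    (h : tot ≤ (1 - 3 / 4 * b ^ 4) * (1 - 3 / 4 * g ^ 4) + 12 * κ * b ^ 3 + 12 * κ * g ^ 3 +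
      16 * (b ^ 3 * g ^ 3)) : tot ≤ 1 := by
  have y1 := four_mul_mul_cube_le (36 * κ) b (by positivity) hb
  have y2 := four_mul_mul_cube_le (36 * κ) g (by positivity) hg
  have key : ∀ z : ℝ, z ^ 4 ≤ 1 / 1100 → 8 * z ^ 6 + z ^ 8 ≤ 1 / 4 * z ^ 4 := by
    intro z hz
    have hz2 : z ^ 2 ≤ 1 / 33 := by
      by_contra hc
      push Not at hc
      nlinarith [sq_nonneg z]
    have e : 8 * z ^ 6 + z ^ 8 = (8 * z ^ 2 + z ^ 4) * z ^ 4 := by ring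
    rw [e]
    exact mul_le_mul_of_nonneg_right (by linarith) (by positivity)
  have k1 := key b hb1
  have k2 := key g hg1
  have m1 : 16 * (b ^ 3 * g ^ 3) ≤ 8 * b ^ 6 + 8 * g ^ 6 := by nlinarith [sq_nonneg (b ^ 3 - g ^ 3)]
  have m2 : (9 / 16) * (b ^ 4 * g ^ 4) ≤ b ^ 8 + g ^ 8 := by
    nlinarith [sq_nonneg (b ^ 4 - g ^ 4), sq_nonneg (b ^ 4), sq_nonneg (g ^ 4)]
  nlinarith

set_option maxHeartbeats 800000 in
lemma near_bound {κ c b₁ b₂ g₁ g₂ b g tot P : ℝ} (hκ : 0 ≤ κ) (hκ1 : κ ≤ 1 / 2) (hc : 1 ≤ c)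
    (hc8 : c ≤ 8) (hb₁ : 0 ≤ b₁) (hb₂ : 0 ≤ b₂) (hg₁ : 0 ≤ g₁) (hg₂ : 0 ≤ g₂)
    (hb : 0 ≤ b) (hg : 0 ≤ g) (hbn : b ≤ 33 * κ) (hgn : g ≤ 33 * κ)
    (hb1n : b₁ ≤ b) (hb2n : b₂ ≤ b) (hg1n : g₁ ≤ g) (hg2n : g₂ ≤ g)
    (hP : (b₁ = 0 ∧ g₁ = 0 ∧ P = 1) ∨ P = 1 - κ ^ 4 / 2)
    (h : tot ≤ (1 - 3 / 4 * b₁ ^ 4) * (1 - 3 / 4 * g₁ ^ 4) * P +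
      (c * (b₁ ^ 3 * (κ * (1 + κ ^ 4))) + (c - 1) * (b₂ ^ 3 * (κ * (1 + κ ^ 4)))) +
      (c * (g₁ ^ 3 * (κ * (1 + κ ^ 4))) + (c - 1) * (g₂ ^ 3 * (κ * (1 + κ ^ 4)))) +
      16 * (b ^ 3 * g ^ 3)) : tot ≤ 1 + 10 ^ 12 * (κ ^ 5 + (c - 1) * κ ^ 4) := by
  have hκ4 : κ ^ 4 ≤ 1 := pow_le_one₀ hκ (by linarith)
  have hκ6 : κ ^ 6 ≤ κ ^ 5 := pow_le_pow_of_le_one hκ (by linarith) (by norm_num)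
  have hκ8 : κ ^ 8 ≤ κ ^ 5 := pow_le_pow_of_le_one hκ (by linarith) (by norm_num)
  have hcube : ∀ z, 0 ≤ z → z ≤ 33 * κ → z ^ 3 ≤ 35937 * κ ^ 3 := by
    intro z hz hz'
    calc z ^ 3 ≤ (33 * κ) ^ 3 := pow_le_pow_left₀ hz hz' 3
      _ = _ := by ring
  have hfour : ∀ z, 0 ≤ z → z ≤ 33 * κ → z ^ 4 ≤ 1185921 * κ ^ 4 := by
    intro z hz hz'
    calc z ^ 4 ≤ (33 * κ) ^ 4 := pow_le_pow_left₀ hz hz' 4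
      _ = _ := by ring
  have hbg : b ^ 3 * g ^ 3 ≤ 1291467969 * κ ^ 6 := by
    calc b ^ 3 * g ^ 3 ≤ (35937 * κ ^ 3) * (35937 * κ ^ 3) :=
          mul_le_mul (hcube b hb hbn) (hcube g hg hgn) (by positivity) (by positivity)
      _ = _ := by ring
  have hR : κ * (1 + κ ^ 4) ≤ 2 * κ := by nlinarith
  have hext : ∀ z, 0 ≤ z → z ≤ 33 * κ →
      (c - 1) * (z ^ 3 * (κ * (1 + κ ^ 4))) ≤ 71874 * ((c - 1) * κ ^ 4) := by
    intro z hz hz'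
    have : z ^ 3 * (κ * (1 + κ ^ 4)) ≤ (35937 * κ ^ 3) * (2 * κ) :=
      mul_le_mul (hcube z hz hz') hR (by positivity) (by positivity)
    nlinarith [mul_le_mul_of_nonneg_left this (sub_nonneg.2 hc)]
  have e1 := hext b₂ hb₂ (hb2n.trans hbn)
  have e2 := hext g₂ hg₂ (hg2n.trans hgn)
  have hck : 0 ≤ (c - 1) * κ ^ 4 := mul_nonneg (by linarith) (by positivity)
  have hk5 : 0 ≤ κ ^ 5 := by positivity
  rcases hP with ⟨rfl, rfl, rfl⟩ | rfl
  · linarith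
  · have y1 := four_mul_mul_cube_le (c * (κ * (1 + κ ^ 4))) b₁ (by positivity) hb₁
    have y2 := four_mul_mul_cube_le (c * (κ * (1 + κ ^ 4))) g₁ (by positivity) hg₁
    have hc4 : c ^ 4 ≤ 1 + 585 * (c - 1) := by
      have : c ^ 4 - 1 = (c - 1) * (c ^ 3 + c ^ 2 + c + 1) := by ring
      have h3 : c ^ 3 ≤ 8 ^ 3 := pow_le_pow_left₀ (by linarith) hc8 3
      have h2 : c ^ 2 ≤ 8 ^ 2 := pow_le_pow_left₀ (by linarith) hc8 2
      nlinarith [mul_le_mul_of_nonneg_left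
        (show c ^ 3 + c ^ 2 + c + 1 ≤ 585 by linarith) (sub_nonneg.2 hc)]
    have hc4' : c ^ 4 ≤ 4096 := by
      calc c ^ 4 ≤ 8 ^ 4 := pow_le_pow_left₀ (by linarith) hc8 4
        _ = 4096 := by norm_num
    have ht4 : (1 + κ ^ 4) ^ 4 ≤ 1 + 15 * κ ^ 4 := by
      have hx : 0 ≤ κ ^ 4 := by positivity
      generalize κ ^ 4 = x at *
      have : x ^ 2 ≤ x := by nlinarith
      have : x ^ 3 ≤ x := by nlinarith [sq_nonneg x]
      have : x ^ 4 ≤ x := by nlinarith [sq_nonneg x, pow_nonneg hx 3]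
      have : (1 + x) ^ 4 = 1 + 4 * x + 6 * x ^ 2 + 4 * x ^ 3 + x ^ 4 := by ring
      linarith
    have hyr : (c * (κ * (1 + κ ^ 4))) ^ 4 ≤ κ ^ 4 + 585 * ((c - 1) * κ ^ 4) + 61440 * κ ^ 8 := by
      calc (c * (κ * (1 + κ ^ 4))) ^ 4 = κ ^ 4 * (c ^ 4 * (1 + κ ^ 4) ^ 4) := by ring
        _ ≤ κ ^ 4 * (c ^ 4 * (1 + 15 * κ ^ 4)) := by gcongr
        _ = κ ^ 4 * (c ^ 4 + 15 * c ^ 4 * κ ^ 4) := by ring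
        _ ≤ κ ^ 4 * (1 + 585 * (c - 1) + 15 * 4096 * κ ^ 4) := by gcongr
        _ = _ := by ring
    have f1 := hfour b₁ hb₁ (hb1n.trans hbn)
    have f2 := hfour g₁ hg₁ (hg1n.trans hgn)
    have q1 : b₁ ^ 4 * g₁ ^ 4 ≤ 1185921 ^ 2 * κ ^ 8 := by
      calc _ ≤ (1185921 * κ ^ 4) * (1185921 * κ ^ 4) :=
            mul_le_mul f1 f2 (by positivity) (by positivity)
        _ = _ := by ring
    have q2 : κ ^ 4 * b₁ ^ 4 ≤ 1185921 * κ ^ 8 := by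
      calc _ ≤ κ ^ 4 * (1185921 * κ ^ 4) := mul_le_mul_of_nonneg_left f1 (pow_nonneg hκ 4)
        _ = _ := by ring
    have q3 : κ ^ 4 * g₁ ^ 4 ≤ 1185921 * κ ^ 8 := by
      calc _ ≤ κ ^ 4 * (1185921 * κ ^ 4) := mul_le_mul_of_nonneg_left f2 (pow_nonneg hκ 4)
        _ = _ := by ring
    have q4 : 0 ≤ κ ^ 4 * (b₁ ^ 4 * g₁ ^ 4) := by positivity
    linarith

lemma local_crude {n : ℕ} {κ c : ℝ} (hκ : 0 ≤ κ) (hκ1 : κ ≤ 17 / 20) (hc8 : c ≤ 8)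
    (v w : ℕ → ℝ) (s : ℕ → ℕ → ℝ) (hv : ∀ x, 0 ≤ v x) (hw : ∀ x, 0 ≤ w x)
    (hs : ∀ x y, 0 ≤ s x y) (hV : ∑ x ∈ Finset.range n, v x = 1)
    (hW : ∑ x ∈ Finset.range n, w x = 1)
    (h1 : ∀ x y, s x y ≤ (v x * w y) ^ (3 / 4 : ℝ) * κ ^ Nat.dist x y) :
    ∑ x ∈ Finset.range n, ∑ y ∈ Finset.range n, s x y * (if x = y then 1 else c) ≤ 104 := by
  have hS := sum_sum_rpow_mul_le (Finset.range n) (Finset.range n) v w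
    (fun x y => κ ^ Nat.dist x y) (Λ := 1 + 2 * (κ / (1 - κ))) (fun i _ => hv i) (fun i _ => hw i)
    (fun i _ j _ => by positivity)
    (by have : 0 < 1 - κ := by linarith
        positivity)
    (fun i _ => sum_pow_dist_le hκ (by linarith) i _)
    (fun j _ => by
      simp_rw [Nat.dist_comm _ j]
      exact sum_pow_dist_le hκ (by linarith) j _)
  rw [hV, hW, mul_one, Real.one_rpow, mul_one] at hS
  have hL : κ / (1 - κ) ≤ 6 := by
    rw [div_le_iff₀ (by linarith)]
    linarith
  calc _ ≤ ∑ x ∈ Finset.range n, ∑ y ∈ Finset.range n,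
        8 * ((v x * w y) ^ (3 / 4 : ℝ) * κ ^ Nat.dist x y) := by
        refine Finset.sum_le_sum fun x _ => Finset.sum_le_sum fun y _ => ?_
        rw [mul_comm]
        refine mul_le_mul ?_ (h1 x y) (hs x y) (by norm_num)
        split_ifs <;> linarith
    _ = 8 * ∑ x ∈ Finset.range n, ∑ y ∈ Finset.range n,
        ((v x * w y) ^ (3 / 4 : ℝ) * κ ^ Nat.dist x y) := by
        simp_rw [Finset.mul_sum]
    _ ≤ _ := by linarith

lemma row_bound {κ R : ℝ} (hκ : 0 ≤ κ) (hR : 0 ≤ R) (S : Finset ℕ) (w f : ℕ → ℝ)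
    (hw : ∀ x, 0 ≤ w x) (x₀ : ℕ) (hf : ∀ y ∈ S, f y ≤ w y ^ (3 / 4 : ℝ) * κ ^ Nat.dist x₀ y)
    (h : ∑ y ∈ S, (κ ^ 4) ^ Nat.dist x₀ y ≤ R ^ 4) :
    ∑ y ∈ S, f y ≤ (∑ y ∈ S, w y) ^ (3 / 4 : ℝ) * R := by
  refine (Finset.sum_le_sum hf).trans ?_
  refine sum_rpow_mul_le S w _ (fun i _ => hw i) (fun i _ => by positivity) hR ?_
  refine le_trans (le_of_eq (Finset.sum_congr rfl fun y _ => ?_)) h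
  rw [← pow_mul, ← pow_mul, mul_comm]

lemma local_spread {n : ℕ} {κ c : ℝ} (hκ : 0 ≤ κ) (hκ1 : κ ≤ 1 / 10 ^ 6)
    (hc8 : c ≤ 8)
    (v w : ℕ → ℝ) (s : ℕ → ℕ → ℝ) (hv : ∀ x, 0 ≤ v x) (hw : ∀ x, 0 ≤ w x)
    (hs : ∀ x y, 0 ≤ s x y) (hV : ∑ x ∈ Finset.range n, v x = 1)
    (hW : ∑ x ∈ Finset.range n, w x = 1)
    (h1 : ∀ x y, s x y ≤ (v x * w y) ^ (3 / 4 : ℝ) * κ ^ Nat.dist x y)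
    (hB : ∀ x ∈ Finset.range n, v x * w x ≤ 1 - 1 / 1100) :
    ∑ x ∈ Finset.range n, ∑ y ∈ Finset.range n, s x y * (if x = y then 1 else c) ≤ 1 := by
  have hS := sum_sum_rpow_mul_le (Finset.range n) (Finset.range n) v w
    (fun x y => if x = y then 0 else κ ^ Nat.dist x y) (Λ := 2 * (κ / (1 - κ)))
    (fun i _ => hv i) (fun i _ => hw i)
    (fun i _ j _ => by positivity)
    (by have : 0 < 1 - κ := by linarith
        positivity)
    (fun i _ => by
      have e : ∑ j ∈ Finset.range n, (if i = j then 0 else κ ^ Nat.dist i j) =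
          ∑ j ∈ Finset.range n with ¬ i = j, κ ^ Nat.dist i j := by
        simp only [Finset.sum_filter, ite_not]
      rw [e]
      refine sum_pow_dist_le_of_ne hκ (by linarith) i _ fun y hy => ?_
      exact fun h => (Finset.mem_filter.1 hy).2 h.symm)
    (fun j _ => by
      have e : ∑ i ∈ Finset.range n, (if i = j then 0 else κ ^ Nat.dist i j) =
          ∑ i ∈ Finset.range n with ¬ i = j, κ ^ Nat.dist j i := by
        simp only [Finset.sum_filter, ite_not, Nat.dist_comm]
      rw [e]
      refine sum_pow_dist_le_of_ne hκ (by linarith) j _ fun y hy => ?_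
      exact fun h => (Finset.mem_filter.1 hy).2 h)
  rw [hV, hW, mul_one, Real.one_rpow, mul_one] at hS
  have hL : κ / (1 - κ) ≤ 2 * κ := by
    rw [div_le_iff₀ (by linarith)]
    nlinarith
  have hdiag : ∑ x ∈ Finset.range n, (v x * w x) ^ (3 / 4 : ℝ) ≤ 1 - 1 / 4400 := by
    have hcs : ∑ x ∈ Finset.range n, √(v x) * √(w x) ≤ 1 := by
      refine (Real.sum_mul_le_sqrt_mul_sqrt _ _ _).trans ?_
      simp_rw [Real.sq_sqrt (hv _), Real.sq_sqrt (hw _), hV, hW]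
      norm_num
    have hq : (1 - 1 / 1100 : ℝ) ^ (1 / 4 : ℝ) ≤ 1 - 1 / 4400 := by
      have := rpow_one_add_le_one_add_mul_self (s := -(1 / 1100)) (by norm_num) (p := 1 / 4)
        (by norm_num) (by norm_num)
      rw [← sub_eq_add_neg] at this
      linarith
    calc _ ≤ ∑ x ∈ Finset.range n, (1 - 1 / 4400) * (√(v x) * √(w x)) := by
          refine Finset.sum_le_sum fun x hx => ?_
          have hvw : 0 ≤ v x * w x := mul_nonneg (hv x) (hw x)
          have e : (v x * w x) ^ (3 / 4 : ℝ) = (v x * w x) ^ (1 / 4 : ℝ) * √(v x * w x) := by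
            rw [Real.sqrt_eq_rpow, ← Real.rpow_add_of_nonneg hvw (by norm_num) (by norm_num)]
            norm_num
          rw [e, Real.sqrt_mul (hv x)]
          refine mul_le_mul_of_nonneg_right ?_ (by positivity)
          exact (Real.rpow_le_rpow hvw (hB x hx) (by norm_num)).trans hq
      _ ≤ 1 - 1 / 4400 := by
          rw [← Finset.mul_sum]
          linarith
  calc _ ≤ ∑ x ∈ Finset.range n, ∑ y ∈ Finset.range n,
        ((if x = y then (v x * w x) ^ (3 / 4 : ℝ) else 0) +
          8 * ((v x * w y) ^ (3 / 4 : ℝ) * if x = y then 0 else κ ^ Nat.dist x y)) := by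
        refine Finset.sum_le_sum fun x _ => Finset.sum_le_sum fun y _ => ?_
        have := h1 x y
        split_ifs with h
        · subst h
          simpa [Nat.dist_self] using this
        · nlinarith [hs x y]
    _ = ∑ x ∈ Finset.range n, (v x * w x) ^ (3 / 4 : ℝ) +
        8 * ∑ x ∈ Finset.range n, ∑ y ∈ Finset.range n,
        ((v x * w y) ^ (3 / 4 : ℝ) * if x = y then 0 else κ ^ Nat.dist x y) := by
        simp_rw [Finset.sum_add_distrib, Finset.mul_sum]
        congr 1
        refine Finset.sum_congr rfl fun x hx => ?_
        rw [Finset.sum_ite_eq, if_pos hx]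
    _ ≤ _ := by linarith

set_option maxHeartbeats 2000000 in
lemma local_concentrated {n : ℕ} {κ c : ℝ} (hκ : 0 ≤ κ) (hκ1 : κ ≤ 1 / 10 ^ 6) (hc : 1 ≤ c)
    (hc8 : c ≤ 8)
    (v w : ℕ → ℝ) (s : ℕ → ℕ → ℝ) (hv : ∀ x, 0 ≤ v x) (hw : ∀ x, 0 ≤ w x)
    (hs : ∀ x y, 0 ≤ s x y) (hV : ∑ x ∈ Finset.range n, v x = 1)
    (hW : ∑ x ∈ Finset.range n, w x = 1)
    (h1 : ∀ x y, s x y ≤ (v x * w y) ^ (3 / 4 : ℝ) * κ ^ Nat.dist x y)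
    {x₀ : ℕ} (hx₀ : x₀ ∈ Finset.range n) (hB : 1 - 1 / 1100 < v x₀ * w x₀)
    (h2 : ∑ x ∈ Finset.range n, ∑ y ∈ Finset.range n, (if min x y = x₀ then s x y else 0) ≤
      ((∑ x ∈ Finset.range n with x₀ ≤ x, v x) *
        ∑ x ∈ Finset.range n with x₀ ≤ x, w x) ^ (3 / 4 : ℝ) *
        (if x₀ = 0 then 1 else 1 - κ ^ 4 / 2)) :
    ∑ x ∈ Finset.range n, ∑ y ∈ Finset.range n, s x y * (if x = y then 1 else c) ≤
      1 + 10 ^ 12 * (κ ^ 5 + (c - 1) * κ ^ 4) := by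
  set J := (Finset.range n).erase x₀ with hJ
  have hβ : v x₀ + ∑ x ∈ J, v x = 1 := by rw [hJ, Finset.add_sum_erase _ _ hx₀, hV]
  have hγ : w x₀ + ∑ x ∈ J, w x = 1 := by rw [hJ, Finset.add_sum_erase _ _ hx₀, hW]
  have hβ0 : 0 ≤ ∑ x ∈ J, v x := Finset.sum_nonneg fun x _ => hv x
  have hγ0 : 0 ≤ ∑ x ∈ J, w x := Finset.sum_nonneg fun x _ => hw x
  have hvx : v x₀ ≤ 1 := by linarith
  have hwx : w x₀ ≤ 1 := by linarith
  have hvx' : 1 - 1 / 1100 < v x₀ := by nlinarith [hv x₀]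
  have hwx' : 1 - 1 / 1100 < w x₀ := by nlinarith [hw x₀]
  have hsrow : ∀ y, s x₀ y ≤ w y ^ (3 / 4 : ℝ) * κ ^ Nat.dist x₀ y := fun y =>
    (h1 x₀ y).trans <| mul_le_mul_of_nonneg_right
      (Real.rpow_le_rpow (mul_nonneg (hv _) (hw _)) (by nlinarith [hw y]) (by norm_num))
      (by positivity)
  have hscol : ∀ x, s x x₀ ≤ v x ^ (3 / 4 : ℝ) * κ ^ Nat.dist x₀ x := fun x => by
    rw [Nat.dist_comm]
    exact (h1 x x₀).trans <| mul_le_mul_of_nonneg_right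
      (Real.rpow_le_rpow (mul_nonneg (hv _) (hw _)) (by nlinarith [hv x]) (by norm_num))
      (by positivity)
  have hrest : ∑ x ∈ J, ∑ y ∈ J, 8 * s x y ≤
      16 * ((∑ x ∈ J, v x) ^ (3 / 4 : ℝ) * (∑ x ∈ J, w x) ^ (3 / 4 : ℝ)) := by
    have hS := sum_sum_rpow_mul_le J J v w
      (fun x y => κ ^ Nat.dist x y) (Λ := 2) (fun i _ => hv i) (fun i _ => hw i)
      (fun i _ j _ => by positivity) (by norm_num)
      (fun i _ => (sum_pow_dist_le hκ (by linarith) i _).trans (by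
        have : κ / (1 - κ) ≤ 1 / 2 := by rw [div_le_iff₀ (by linarith)]; linarith
        linarith))
      (fun j _ => by
        simp_rw [Nat.dist_comm _ j]
        refine (sum_pow_dist_le hκ (by linarith) j _).trans ?_
        have : κ / (1 - κ) ≤ 1 / 2 := by rw [div_le_iff₀ (by linarith)]; linarith
        linarith)
    rw [← Real.mul_rpow hβ0 hγ0]
    calc _ ≤ ∑ x ∈ J, ∑ y ∈ J, 8 * ((v x * w y) ^ (3 / 4 : ℝ) * κ ^ Nat.dist x y) :=
          Finset.sum_le_sum fun x _ => Finset.sum_le_sum fun y _ => by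
            linarith [h1 x y]
      _ = 8 * ∑ x ∈ J, ∑ y ∈ J, ((v x * w y) ^ (3 / 4 : ℝ) * κ ^ Nat.dist x y) := by
          simp_rw [Finset.mul_sum]
      _ ≤ _ := by linarith
  have hκ4 : κ ^ 4 ≤ 1 / 10 ^ 6 := (pow_le_of_le_one hκ (by linarith) (by norm_num)).trans hκ1
  have hκ40 : 0 ≤ κ ^ 4 := by positivity
  obtain ⟨b, hb, hbe, hbe'⟩ := exists_fourth_root hβ0
  obtain ⟨g, hg, hge, hge'⟩ := exists_fourth_root hγ0
  have hprod : ∀ u u' : ℝ, u ≤ 1 → u' ≤ 1 → ((1 - u) * (1 - u')) ^ (3 / 4 : ℝ) ≤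
      (1 - 3 / 4 * u) * (1 - 3 / 4 * u') := by
    intro u u' hu hu'
    rw [Real.mul_rpow (by linarith) (by linarith)]
    exact mul_le_mul (rpow_three_quarters_le hu) (rpow_three_quarters_le hu')
      (Real.rpow_nonneg (by linarith) _) (by linarith)
  rw [hbe', hge'] at hrest
  have hJne : ∀ y ∈ J, y ≠ x₀ := fun y hy => (Finset.mem_erase.1 hy).1
  by_cases hfar : 1119744 * κ ^ 4 ≤ b ^ 4 + g ^ 4
  · have hcross : ∑ x ∈ Finset.range n, ∑ y ∈ Finset.range n, s x y * (if x = y then 1 else c) ≤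
        1 := by
      refine far_bound hκ hb hg (by linarith) (by linarith) hfar ?_
      have hR : ∑ y ∈ J, (κ ^ 4) ^ Nat.dist x₀ y ≤ (3 / 2 * κ) ^ 4 := by
        refine (sum_pow_dist_le_of_ne hκ40 (by linarith) x₀ J hJne).trans ?_
        have : κ ^ 4 / (1 - κ ^ 4) ≤ 2 * κ ^ 4 := by
          rw [div_le_iff₀ (by linarith)]; nlinarith
        nlinarith
      rw [sum_sum_eq_cross _ _ hx₀]
      have t0 : s x₀ x₀ * (if x₀ = x₀ then 1 else c) ≤
          (1 - 3 / 4 * b ^ 4) * (1 - 3 / 4 * g ^ 4) := by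
        have := h1 x₀ x₀
        rw [Nat.dist_self, pow_zero, mul_one] at this
        rw [if_pos rfl, mul_one, ← hbe, ← hge]
        refine this.trans (le_trans (le_of_eq ?_) (hprod _ _ (by linarith) (by linarith)))
        congr 1
        rw [show v x₀ = 1 - ∑ x ∈ J, v x by linarith, show w x₀ = 1 - ∑ x ∈ J, w x by linarith]
      have t1 : ∑ y ∈ J, s x₀ y * (if x₀ = y then 1 else c) ≤ 12 * κ * g ^ 3 := by
        have := row_bound hκ (by positivity) J w (s x₀) hw x₀ (fun y _ => hsrow y) hR
        rw [hge'] at this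
        calc _ ≤ ∑ y ∈ J, 8 * s x₀ y := Finset.sum_le_sum fun y hy => by
              rw [if_neg (hJne y hy).symm]; linarith [mul_le_mul_of_nonneg_right hc8 (hs x₀ y)]
          _ = 8 * ∑ y ∈ J, s x₀ y := by rw [Finset.mul_sum]
          _ ≤ _ := by linarith
      have t2 : ∑ x ∈ J, s x x₀ * (if x = x₀ then 1 else c) ≤ 12 * κ * b ^ 3 := by
        have := row_bound hκ (by positivity) J v (fun x => s x x₀) hv x₀ (fun y _ => hscol y) hR
        rw [hbe'] at this
        calc _ ≤ ∑ y ∈ J, 8 * s y x₀ := Finset.sum_le_sum fun y hy => by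
              rw [if_neg (hJne y hy)]; linarith [mul_le_mul_of_nonneg_right hc8 (hs y x₀)]
          _ = 8 * ∑ y ∈ J, s y x₀ := by rw [Finset.mul_sum]
          _ ≤ _ := by linarith
      have t3 : ∑ x ∈ J, ∑ y ∈ J, s x y * (if x = y then 1 else c) ≤ 16 * (b ^ 3 * g ^ 3) := by
        refine le_trans (Finset.sum_le_sum fun x _ => Finset.sum_le_sum fun y _ => ?_) hrest
        have := hs x y
        have := mul_le_mul_of_nonneg_right hc8 (hs x y)
        split_ifs <;> linarith
      linarith
    have : 0 ≤ (c - 1) * κ ^ 4 := mul_nonneg (by linarith) hκ40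
    have : 0 ≤ κ ^ 5 := by positivity
    linarith
  · push Not at hfar
    have hnear : ∀ z, 0 ≤ z → z ^ 4 < 1119744 * κ ^ 4 → z ≤ 33 * κ := by
      intro z hz h
      refine le_of_not_gt fun hc => ?_
      have : (33 * κ) ^ 4 ≤ z ^ 4 := pow_le_pow_left₀ (by positivity) hc.le 4
      nlinarith
    have hb33 := hnear b hb (by linarith [pow_nonneg hg 4])
    have hg33 := hnear g hg (by linarith [pow_nonneg hb 4])
    set J₁ := J.filter (· < x₀) with hJ₁
    set J₂ := J.filter (fun y => ¬ y < x₀) with hJ₂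
    have hsplit : ∀ f : ℕ → ℝ, ∑ x ∈ J, f x = ∑ x ∈ J₁, f x + ∑ x ∈ J₂, f x := fun f =>
      (Finset.sum_filter_add_sum_filter_not J (· < x₀) f).symm
    have n1 : ∀ f : ℕ → ℝ, (∀ x, 0 ≤ f x) → ∀ S : Finset ℕ, 0 ≤ ∑ x ∈ S, f x :=
      fun f hf S => Finset.sum_nonneg fun x _ => hf x
    obtain ⟨b₁, hb₁, hb₁e, hb₁e'⟩ := exists_fourth_root (n1 v hv J₁)
    obtain ⟨b₂, hb₂, hb₂e, hb₂e'⟩ := exists_fourth_root (n1 v hv J₂)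
    obtain ⟨g₁, hg₁, hg₁e, hg₁e'⟩ := exists_fourth_root (n1 w hw J₁)
    obtain ⟨g₂, hg₂, hg₂e, hg₂e'⟩ := exists_fourth_root (n1 w hw J₂)
    have hbs : b ^ 4 = b₁ ^ 4 + b₂ ^ 4 := by rw [← hbe, hsplit, hb₁e, hb₂e]
    have hgs : g ^ 4 = g₁ ^ 4 + g₂ ^ 4 := by rw [← hge, hsplit, hg₁e, hg₂e]
    have hle : ∀ z z' : ℝ, 0 ≤ z' → z ^ 4 ≤ z' ^ 4 → z ≤ z' := fun z z' hz' h =>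
      le_of_pow_le_pow_left₀ (by norm_num) hz' h
    have hge_split : ∀ f : ℕ → ℝ, ∑ x ∈ Finset.range n, f x = 1 →
        ∑ x ∈ Finset.range n with x₀ ≤ x, f x = 1 - ∑ x ∈ J₁, f x := by
      intro f hf
      rw [← hf, ← Finset.sum_filter_add_sum_filter_not (Finset.range n) (x₀ ≤ ·) f,
        eq_sub_iff_add_eq]
      congr 1
      refine Finset.sum_congr ?_ fun _ _ => rfl
      ext y
      simp only [hJ₁, hJ, Finset.mem_filter, Finset.mem_erase]
      constructor
      · rintro ⟨⟨_, h⟩, h'⟩; exact ⟨h, by omega⟩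
      · rintro ⟨h, h'⟩; exact ⟨⟨by omega, h⟩, by omega⟩
    rw [hge_split v hV, hge_split w hW] at h2
    have hRge : ∀ S : Finset ℕ, ∑ y ∈ S, (κ ^ 4) ^ Nat.dist x₀ y ≤ κ ^ 4 / (1 - κ ^ 4) →
        ∑ y ∈ S, (κ ^ 4) ^ Nat.dist x₀ y ≤ (κ * (1 + κ ^ 4)) ^ 4 := by
      intro S h
      refine h.trans ?_
      rw [div_le_iff₀ (by linarith), mul_pow, mul_assoc]
      refine le_mul_of_one_le_right hκ40 ?_
      generalize κ ^ 4 = x at *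
      have : 1 + 4 * x ≤ (1 + x) ^ 4 := by
        have : (1 + x) ^ 4 = 1 + 4 * x + 6 * x ^ 2 + 4 * x ^ 3 + x ^ 4 := by ring
        rw [this]
        have : 0 ≤ 6 * x ^ 2 + 4 * x ^ 3 + x ^ 4 := by positivity
        linarith
      nlinarith
    have hR1 := hRge J₁ (sum_pow_dist_le_of_lt hκ40 (by linarith) x₀ J₁ fun y hy =>
      (Finset.mem_filter.1 hy).2)
    have hR2 := hRge J₂ (sum_pow_dist_le_of_gt hκ40 (by linarith) x₀ J₂ fun y hy => by
      have h := (Finset.mem_filter.1 hy).2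
      have := hJne y (Finset.mem_filter.1 hy).1
      omega)
    refine near_bound (b₁ := b₁) (b₂ := b₂) (g₁ := g₁) (g₂ := g₂) (b := b) (g := g)
      (P := if x₀ = 0 then 1 else 1 - κ ^ 4 / 2) hκ (by linarith) hc hc8 hb₁ hb₂ hg₁ hg₂ hb hg
      hb33 hg33 (hle _ _ hb (by linarith [pow_nonneg hb₂ 4]))
      (hle _ _ hb (by linarith [pow_nonneg hb₁ 4])) (hle _ _ hg (by linarith [pow_nonneg hg₂ 4]))
      (hle _ _ hg (by linarith [pow_nonneg hg₁ 4])) ?_ ?_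
    · by_cases h0 : x₀ = 0
      · left
        have hJe : J₁ = ∅ := by
          rw [hJ₁, Finset.filter_eq_empty_iff]
          intro y _
          omega
        rw [hJe, Finset.sum_empty] at hb₁e hg₁e
        exact ⟨pow_eq_zero_iff (by norm_num) |>.1 hb₁e.symm,
          pow_eq_zero_iff (by norm_num) |>.1 hg₁e.symm, if_pos h0⟩
      · right
        exact if_neg h0
    · have hP0 : (0 : ℝ) ≤ if x₀ = 0 then 1 else 1 - κ ^ 4 / 2 := by
        split_ifs <;> linarith
      have hmain := h2.trans (mul_le_mul_of_nonneg_right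
        (hprod _ _ (by linarith [n1 v hv J₂, hsplit v]) (by linarith [n1 w hw J₂, hsplit w])) hP0)
      rw [hb₁e, hg₁e] at hmain
      set G : ℕ → ℕ → ℝ := fun x y =>
        s x y * ((if x = y then 1 else c) - if min x y = x₀ then 1 else 0) with hG
      have hdec : ∑ x ∈ Finset.range n, ∑ y ∈ Finset.range n, s x y * (if x = y then 1 else c) =
          ∑ x ∈ Finset.range n, ∑ y ∈ Finset.range n, (if min x y = x₀ then s x y else 0) +
          ∑ x ∈ Finset.range n, ∑ y ∈ Finset.range n, G x y := by
        rw [← Finset.sum_add_distrib]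
        refine Finset.sum_congr rfl fun x _ => ?_
        rw [← Finset.sum_add_distrib]
        refine Finset.sum_congr rfl fun y _ => ?_
        simp only [hG]
        split_ifs <;> ring
      rw [hdec, sum_sum_eq_cross _ G hx₀]
      have t0 : G x₀ x₀ = 0 := by simp [hG]
      have t1 : ∑ y ∈ J, G x₀ y ≤ c * (g₁ ^ 3 * (κ * (1 + κ ^ 4))) +
          (c - 1) * (g₂ ^ 3 * (κ * (1 + κ ^ 4))) := by
        have r1 := row_bound hκ (by positivity) J₁ w (s x₀) hw x₀ (fun y _ => hsrow y) hR1
        have r2 := row_bound hκ (by positivity) J₂ w (s x₀) hw x₀ (fun y _ => hsrow y) hR2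
        rw [hg₁e'] at r1
        rw [hg₂e'] at r2
        have a1 : ∑ y ∈ J₁, G x₀ y = c * ∑ y ∈ J₁, s x₀ y := by
          rw [Finset.mul_sum]
          refine Finset.sum_congr rfl fun y hy => ?_
          have := (Finset.mem_filter.1 hy).2
          simp only [hG]
          rw [if_neg (by omega), if_neg (by omega)]
          ring
        have a2 : ∑ y ∈ J₂, G x₀ y = (c - 1) * ∑ y ∈ J₂, s x₀ y := by
          rw [Finset.mul_sum]
          refine Finset.sum_congr rfl fun y hy => ?_
          have := (Finset.mem_filter.1 hy).2
          have := hJne y (Finset.mem_filter.1 hy).1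
          simp only [hG]
          rw [if_neg (by omega), if_pos (by omega)]
          ring
        rw [hsplit, a1, a2]
        exact add_le_add (mul_le_mul_of_nonneg_left r1 (by linarith))
          (mul_le_mul_of_nonneg_left r2 (by linarith))
      have t2 : ∑ x ∈ J, G x x₀ ≤ c * (b₁ ^ 3 * (κ * (1 + κ ^ 4))) +
          (c - 1) * (b₂ ^ 3 * (κ * (1 + κ ^ 4))) := by
        have r1 := row_bound hκ (by positivity) J₁ v (fun x => s x x₀) hv x₀
          (fun y _ => hscol y) hR1
        have r2 := row_bound hκ (by positivity) J₂ v (fun x => s x x₀) hv x₀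
          (fun y _ => hscol y) hR2
        rw [hb₁e'] at r1
        rw [hb₂e'] at r2
        have a1 : ∑ y ∈ J₁, G y x₀ = c * ∑ y ∈ J₁, s y x₀ := by
          rw [Finset.mul_sum]
          refine Finset.sum_congr rfl fun y hy => ?_
          have := (Finset.mem_filter.1 hy).2
          simp only [hG]
          rw [if_neg (by omega), if_neg (by omega)]
          ring
        have a2 : ∑ y ∈ J₂, G y x₀ = (c - 1) * ∑ y ∈ J₂, s y x₀ := by
          rw [Finset.mul_sum]
          refine Finset.sum_congr rfl fun y hy => ?_
          have := (Finset.mem_filter.1 hy).2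
          have := hJne y (Finset.mem_filter.1 hy).1
          simp only [hG]
          rw [if_neg (by omega), if_pos (by omega)]
          ring
        rw [hsplit, a1, a2]
        exact add_le_add (mul_le_mul_of_nonneg_left r1 (by linarith))
          (mul_le_mul_of_nonneg_left r2 (by linarith))
      have t3 : ∑ x ∈ J, ∑ y ∈ J, G x y ≤ 16 * (b ^ 3 * g ^ 3) := by
        refine le_trans (Finset.sum_le_sum fun x _ => Finset.sum_le_sum fun y _ => ?_) hrest
        have := hs x y
        have := mul_le_mul_of_nonneg_right hc8 (hs x y)
        have := mul_le_mul_of_nonneg_right hc (hs x y)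
        simp only [hG]
        split_ifs <;> linarith
      linarith

open Classical in
lemma edge_sum_sq_le (f : ℕ → ℝ) (hf : ∀ q, 0 ≤ f q) (E : ℕ → ℕ → Prop) {Ca Cb : ℝ}
    (hCa : 0 ≤ Ca) (hCb : 0 ≤ Cb) (k : ℕ) : ∀ V W : Finset ℕ, V.card + W.card = k →
    (∀ q ∈ V, 0 < q) → (∀ r ∈ W, 0 < r) →
    (∀ q ∈ V, ∀ R : ℕ, ∑ r ∈ W with E q r ∧ r ≤ R, f r ≤ Cb * R / q) →
    (∀ r ∈ W, ∀ Q : ℕ, ∑ q ∈ V with E q r ∧ q ≤ Q, f q ≤ Ca * Q / r) →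
    (∑ q ∈ V, ∑ r ∈ W, if E q r then f q * f r else 0) ^ 2 ≤
      4 * (Ca * Cb) * ((∑ q ∈ V, f q) * ∑ r ∈ W, f r) := by
  induction k using Nat.strong_induction_on with
  | _ k ih =>
  intro V W hk hV0 hW0 hb ha
  set S := ∑ q ∈ V, ∑ r ∈ W, if E q r then f q * f r else 0 with hS
  have hS0 : 0 ≤ S := Finset.sum_nonneg fun q _ => Finset.sum_nonneg fun r _ => by
    split_ifs
    · exact mul_nonneg (hf q) (hf r)
    · exact le_rfl
  have hFV : 0 ≤ ∑ q ∈ V, f q := Finset.sum_nonneg fun q _ => hf q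
  have hFW : 0 ≤ ∑ q ∈ W, f q := Finset.sum_nonneg fun q _ => hf q
  have hrhs : 0 ≤ 4 * (Ca * Cb) * ((∑ q ∈ V, f q) * ∑ r ∈ W, f r) := by positivity
  rcases hS0.eq_or_lt with h0 | hSpos
  · rw [← h0]; simpa using hrhs
  -- removing one vertex of small degree
  have remove : ∀ (F D x M : ℝ), 0 ≤ M → 0 ≤ x → x ≤ F → 2 * F * D < S →
      (S - x * D) ^ 2 ≤ M * (F - x) → S ^ 2 ≤ M * F := by
    intro F D x M hM hx hxF hD h
    have hF : 0 ≤ F := hx.trans hxF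
    rcases hxF.eq_or_lt with rfl | hlt
    · exfalso
      have : (S - x * D) ^ 2 ≤ 0 := by simpa using h
      have : S - x * D = 0 := by
        have := le_antisymm this (sq_nonneg _)
        exact pow_eq_zero_iff (by norm_num) |>.1 this
      nlinarith
    · have hF' : 0 < F := hx.trans_lt hlt
      have h2 : S ^ 2 * (F - x) ≤ F * (S - x * D) ^ 2 := by
        have : 0 ≤ S ^ 2 - 2 * (F * D) * S := by nlinarith
        nlinarith [sq_nonneg (x * D), mul_nonneg hx this]
      have h3 : S ^ 2 * (F - x) ≤ (M * F) * (F - x) := by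
        calc _ ≤ F * (S - x * D) ^ 2 := h2
          _ ≤ F * (M * (F - x)) := by gcongr
          _ = _ := by ring
      exact le_of_mul_le_mul_right h3 (by linarith)
  have hdegV : ∀ q ∈ V, ∑ r ∈ W, (if E q r then f q * f r else 0) =
      f q * ∑ r ∈ W with E q r, f r := by
    intro q _
    rw [Finset.sum_filter, Finset.mul_sum]
    exact Finset.sum_congr rfl fun r _ => by split_ifs <;> simp
  have hdegW : ∀ r ∈ W, ∑ q ∈ V, (if E q r then f q * f r else 0) =
      f r * ∑ q ∈ V with E q r, f q := by
    intro r _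
    rw [Finset.sum_filter, Finset.mul_sum]
    exact Finset.sum_congr rfl fun q _ => by split_ifs <;> simp [mul_comm]
  by_cases hsV : ∃ q ∈ V, 2 * (∑ q ∈ V, f q) * (∑ r ∈ W with E q r, f r) < S
  · obtain ⟨q, hq, hlt⟩ := hsV
    have := ih ((V.erase q).card + W.card) (by
      have := Finset.card_erase_lt_of_mem hq
      omega) (V.erase q) W rfl (fun x hx => hV0 x (Finset.mem_of_mem_erase hx)) hW0
      (fun x hx => hb x (Finset.mem_of_mem_erase hx))
      (fun r hr Q => (Finset.sum_le_sum_of_subset_of_nonneg (Finset.filter_subset_filter _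
        (Finset.erase_subset _ _)) fun x _ _ => hf x).trans (ha r hr Q))
    have e1 : ∑ x ∈ V.erase q, f x = ∑ x ∈ V, f x - f q := by
      rw [← Finset.add_sum_erase V f hq]; ring
    have e2 : ∑ x ∈ V.erase q, ∑ r ∈ W, (if E x r then f x * f r else 0) =
        S - f q * ∑ r ∈ W with E q r, f r := by
      rw [hS, ← Finset.add_sum_erase V _ hq, hdegV q hq]; ring
    rw [e1, e2] at this
    have := remove (∑ q ∈ V, f q) _ (f q) (4 * (Ca * Cb) * ∑ r ∈ W, f r) (by positivity) (hf q)
      (Finset.single_le_sum (fun x _ => hf x) hq) hlt (this.trans (le_of_eq (by ring)))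
    exact this.trans (le_of_eq (by ring))
  by_cases hsW : ∃ r ∈ W, 2 * (∑ r ∈ W, f r) * (∑ q ∈ V with E q r, f q) < S
  · obtain ⟨r, hr, hlt⟩ := hsW
    have := ih (V.card + (W.erase r).card) (by
      have := Finset.card_erase_lt_of_mem hr
      omega) V (W.erase r) rfl hV0 (fun x hx => hW0 x (Finset.mem_of_mem_erase hx))
      (fun q hq R => (Finset.sum_le_sum_of_subset_of_nonneg (Finset.filter_subset_filter _
        (Finset.erase_subset _ _)) fun x _ _ => hf x).trans (hb q hq R))
      (fun x hx => ha x (Finset.mem_of_mem_erase hx))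
    have e1 : ∑ x ∈ W.erase r, f x = ∑ x ∈ W, f x - f r := by
      rw [← Finset.add_sum_erase W f hr]; ring
    have e2 : ∑ q ∈ V, ∑ x ∈ W.erase r, (if E q x then f q * f x else 0) =
        S - f r * ∑ q ∈ V with E q r, f q := by
      rw [hS, Finset.sum_comm, Finset.sum_comm (s := V), ← Finset.add_sum_erase W _ hr,
        hdegW r hr]; ring
    rw [e1, e2] at this
    have := remove (∑ q ∈ W, f q) _ (f r) (4 * (Ca * Cb) * ∑ r ∈ V, f r) (by positivity) (hf r)
      (Finset.single_le_sum (fun x _ => hf x) hr) hlt (this.trans (le_of_eq (by ring)))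
    exact this.trans (le_of_eq (by ring))
  push Not at hsV hsW
  have hVne : V.Nonempty := by
    by_contra h
    rw [Finset.not_nonempty_iff_eq_empty] at h
    rw [hS, h, Finset.sum_empty] at hSpos
    exact lt_irrefl _ hSpos
  obtain ⟨qm, hqm, hqmax⟩ := V.exists_max_image id hVne
  have hq1 := hsV qm hqm
  have hΓ : (W.filter (E qm)).Nonempty := by
    by_contra h
    rw [Finset.not_nonempty_iff_eq_empty] at h
    rw [h, Finset.sum_empty] at hq1
    linarith
  obtain ⟨rm, hrm, hrmax⟩ := (W.filter (E qm)).exists_max_image id hΓ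
  obtain ⟨hrW, -⟩ := Finset.mem_filter.1 hrm
  have hr1 := hsW rm hrW
  have hb1 : ∑ r ∈ W with E qm r, f r ≤ Cb * rm / qm := by
    refine le_trans (le_of_eq (Finset.sum_congr ?_ fun _ _ => rfl)) (hb qm hqm rm)
    ext r
    simp only [Finset.mem_filter]
    exact ⟨fun h => ⟨h.1, h.2, hrmax r (Finset.mem_filter.2 h)⟩, fun h => ⟨h.1, h.2.1⟩⟩
  have ha1 : ∑ q ∈ V with E q rm, f q ≤ Ca * qm / rm := by
    refine le_trans (le_of_eq (Finset.sum_congr ?_ fun _ _ => rfl)) (ha rm hrW qm)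
    ext q
    simp only [Finset.mem_filter]
    exact ⟨fun h => ⟨h.1, h.2, hqmax q h.1⟩, fun h => ⟨h.1, h.2.1⟩⟩
  have hqm0 : (0 : ℝ) < qm := by exact_mod_cast hV0 qm hqm
  have hrm0 : (0 : ℝ) < rm := by exact_mod_cast hW0 rm hrW
  calc S ^ 2 = S * S := sq S
    _ ≤ (2 * (∑ q ∈ V, f q) * (Cb * rm / qm)) * (2 * (∑ q ∈ W, f q) * (Ca * qm / rm)) := by
        refine mul_le_mul (hq1.trans ?_) (hr1.trans ?_) hS0 (by positivity) <;> gcongr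
    _ = _ := by field_simp; ring

noncomputable def lossFactor (κ c : ℝ) : ℝ :=
  if κ ≤ 1 / 10 ^ 6 then 1 + 10 ^ 12 * (κ ^ 5 + (c - 1) * κ ^ 4) else 104

lemma lossFactor_nonneg {κ c : ℝ} (hκ : 0 ≤ κ) (hc : 1 ≤ c) : 0 ≤ lossFactor κ c := by
  have : 0 ≤ (c - 1) * κ ^ 4 := mul_nonneg (by linarith) (by positivity)
  unfold lossFactor
  split_ifs
  · positivity
  · norm_num

lemma local_bound {n : ℕ} {κ c : ℝ} (hκ : 0 ≤ κ) (hκ1 : κ ≤ 17 / 20) (hc : 1 ≤ c)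
    (hc8 : c ≤ 8)
    (v w : ℕ → ℝ) (s : ℕ → ℕ → ℝ) (hv : ∀ x, 0 ≤ v x) (hw : ∀ x, 0 ≤ w x)
    (hs : ∀ x y, 0 ≤ s x y) (hV : ∑ x ∈ Finset.range n, v x = 1)
    (hW : ∑ x ∈ Finset.range n, w x = 1)
    (h1 : ∀ x y, s x y ≤ (v x * w y) ^ (3 / 4 : ℝ) * κ ^ Nat.dist x y)
    (h2 : ∀ x₀, ∑ x ∈ Finset.range n, ∑ y ∈ Finset.range n,
      (if min x y = x₀ then s x y else 0) ≤
      ((∑ x ∈ Finset.range n with x₀ ≤ x, v x) *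
        ∑ x ∈ Finset.range n with x₀ ≤ x, w x) ^ (3 / 4 : ℝ) *
        (if x₀ = 0 then 1 else 1 - κ ^ 4 / 2)) :
    ∑ x ∈ Finset.range n, ∑ y ∈ Finset.range n, s x y * (if x = y then 1 else c) ≤
      lossFactor κ c := by
  unfold lossFactor
  split_ifs with hk
  · by_cases hB : ∃ x₀ ∈ Finset.range n, 1 - 1 / 1100 < v x₀ * w x₀
    · obtain ⟨x₀, hx₀, hB⟩ := hB
      exact local_concentrated hκ hk hc hc8 v w s hv hw hs hV hW h1 hx₀ hB (h2 x₀)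
    · push Not at hB
      have := local_spread hκ hk hc8 v w s hv hw hs hV hW h1 hB
      have : 0 ≤ (c - 1) * κ ^ 4 := mul_nonneg (by linarith) (by positivity)
      have : 0 ≤ κ ^ 5 := by positivity
      linarith
  · exact local_crude hκ hκ1 hc8 v w s hv hw hs hV hW h1

/-- `φ(n) / n` as a product over the primes dividing `n`. -/
noncomputable def fac (n : ℕ) : ℝ := ∏ p ∈ n.primeFactors, (1 - (p : ℝ)⁻¹)

lemma one_sub_inv_prime_mem {p : ℕ} (hp : p.Prime) :
    0 < 1 - (p : ℝ)⁻¹ ∧ 1 - (p : ℝ)⁻¹ ≤ 1 := by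
  have : (2 : ℝ) ≤ p := by exact_mod_cast hp.two_le
  have h : (p : ℝ)⁻¹ ≤ 2⁻¹ := inv_anti₀ (by norm_num) this
  have : (0 : ℝ) ≤ (p : ℝ)⁻¹ := by positivity
  constructor <;> linarith

lemma fac_pos (n : ℕ) : 0 < fac n :=
  Finset.prod_pos fun _ hp => (one_sub_inv_prime_mem (Nat.prime_of_mem_primeFactors hp)).1

lemma fac_le_one (n : ℕ) : fac n ≤ 1 :=
  Finset.prod_le_one (fun _ hp => (one_sub_inv_prime_mem (Nat.prime_of_mem_primeFactors hp)).1.le)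
    fun _ hp => (one_sub_inv_prime_mem (Nat.prime_of_mem_primeFactors hp)).2

lemma fac_le_of_dvd {b r : ℕ} (h : b ∣ r) (hr : r ≠ 0) : fac r ≤ fac b := by
  unfold fac
  rw [← Finset.prod_sdiff (Nat.primeFactors_mono h hr)]
  refine mul_le_of_le_one_left (fac_pos b).le ?_
  exact Finset.prod_le_one
    (fun _ hp => (one_sub_inv_prime_mem
      (Nat.prime_of_mem_primeFactors (Finset.mem_sdiff.1 hp).1)).1.le)
    fun _ hp => (one_sub_inv_prime_mem (Nat.prime_of_mem_primeFactors (Finset.mem_sdiff.1 hp).1)).2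

lemma fac_mul_of_coprime {a b : ℕ} (h : a.Coprime b) : fac (a * b) = fac a * fac b := by
  unfold fac
  rw [h.primeFactors_mul, Finset.prod_union h.disjoint_primeFactors]

lemma fac_prime_pow {p : ℕ} (hp : p.Prime) (x : ℕ) :
    fac (p ^ x) = if x = 0 then 1 else 1 - (p : ℝ)⁻¹ := by
  split_ifs with h
  · simp [h, fac]
  · rw [fac, Nat.primeFactors_prime_pow h hp, Finset.prod_singleton]

lemma totient_eq_mul_fac (n : ℕ) : (n.totient : ℝ) = n * fac n := by
  have := Nat.totient_eq_mul_prod_factors n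
  have h := congrArg (fun x : ℚ => (x : ℝ)) this
  push_cast at h
  rw [h]
  rfl

/-- The weight attached to a pair of common divisors. -/
noncomputable def mass (T : ℝ) (a b : ℕ) : ℝ :=
  T ^ 2 * fac a * fac b * (Nat.gcd a b : ℝ) ^ 2 / (a * b)

lemma mass_pos {T : ℝ} (hT : 0 < T) {a b : ℕ} (ha : a ≠ 0) (hb : b ≠ 0) : 0 < mass T a b := by
  have := fac_pos a
  have := fac_pos b
  have : (0 : ℝ) < Nat.gcd a b := by exact_mod_cast Nat.gcd_pos_of_pos_left b (Nat.pos_of_ne_zero ha)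
  have : (0 : ℝ) < a := by exact_mod_cast Nat.pos_of_ne_zero ha
  have : (0 : ℝ) < b := by exact_mod_cast Nat.pos_of_ne_zero hb
  unfold mass
  positivity

lemma gcd_mul_prime_pow {p : ℕ} (hp : p.Prime) {a b : ℕ} (ha : ¬ p ∣ a) (hb : ¬ p ∣ b) (x y : ℕ) :
    Nat.gcd (a * p ^ x) (b * p ^ y) = Nat.gcd a b * p ^ min x y := by
  have c1 : Nat.Coprime (p ^ x) b := Nat.Coprime.pow_left x ((Nat.Prime.coprime_iff_not_dvd hp).2 hb)
  have c2 : Nat.Coprime (p ^ y) a := Nat.Coprime.pow_left y ((Nat.Prime.coprime_iff_not_dvd hp).2 ha)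
  have c3 : Nat.Coprime b (p ^ y) := Nat.Coprime.pow_right y ((Nat.Prime.coprime_iff_not_dvd hp).2 hb).symm
  rw [c3.gcd_mul, Nat.gcd_comm (a * p ^ x) b, Nat.gcd_comm (a * p ^ x) (p ^ y),
    Nat.Coprime.gcd_mul_right_cancel_right a c1, Nat.Coprime.gcd_mul_left_cancel_right _ c2.symm,
    Nat.gcd_comm b a, Nat.gcd_comm (p ^ y)]
  congr 1
  rcases le_total x y with h | h
  · rw [min_eq_left h, Nat.gcd_eq_left (pow_dvd_pow p h)]
  · rw [min_eq_right h, Nat.gcd_eq_right (pow_dvd_pow p h)]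

lemma mass_mul_prime_pow {T : ℝ} {p : ℕ} (hp : p.Prime) {a b : ℕ} (ha : ¬ p ∣ a) (hb : ¬ p ∣ b)
    (x y : ℕ) : mass T (a * p ^ x) (b * p ^ y) = mass T a b *
      ((if x = 0 then 1 else 1 - (p : ℝ)⁻¹) * (if y = 0 then 1 else 1 - (p : ℝ)⁻¹) *
        ((p : ℝ)⁻¹) ^ Nat.dist x y) := by
  have c1 : Nat.Coprime a (p ^ x) := Nat.Coprime.pow_right x ((Nat.Prime.coprime_iff_not_dvd hp).2 ha).symm
  have c2 : Nat.Coprime b (p ^ y) := Nat.Coprime.pow_right y ((Nat.Prime.coprime_iff_not_dvd hp).2 hb).symm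
  have hp0 : (p : ℝ) ≠ 0 := by exact_mod_cast hp.ne_zero
  unfold mass
  rw [gcd_mul_prime_pow hp ha hb, fac_mul_of_coprime c1, fac_mul_of_coprime c2, fac_prime_pow hp,
    fac_prime_pow hp]
  have key : ((p : ℝ) ^ min x y) ^ 2 / (p ^ x * p ^ y) = ((p : ℝ)⁻¹) ^ Nat.dist x y := by
    rw [inv_pow, div_eq_iff (by positivity), ← pow_mul, ← pow_add, eq_comm,
      inv_mul_eq_iff_eq_mul₀ (by positivity), ← pow_add]
    congr 1
    unfold Nat.dist
    omega
  rw [← key]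
  push_cast
  rw [← mul_div_assoc, div_mul_div_comm]
  congr 1 <;> ring

lemma sum_fiber {V : Finset ℕ} {n : ℕ} (g : ℕ → ℕ) (hg : ∀ q ∈ V, g q ∈ Finset.range n)
    (φ f : ℕ → ℝ) :
    ∑ x ∈ Finset.range n, φ x * ∑ q ∈ V with g q = x, f q = ∑ q ∈ V, φ (g q) * f q := by
  rw [← Finset.sum_fiberwise_of_maps_to hg]
  refine Finset.sum_congr rfl fun x _ => ?_
  rw [Finset.mul_sum]
  refine Finset.sum_congr rfl fun q hq => ?_
  rw [(Finset.mem_filter.1 hq).2]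

lemma sum_sum_fiber {V W : Finset ℕ} {n : ℕ} (g : ℕ → ℕ) (hV : ∀ q ∈ V, g q ∈ Finset.range n)
    (hW : ∀ q ∈ W, g q ∈ Finset.range n) (φ f : ℕ → ℕ → ℝ) :
    ∑ x ∈ Finset.range n, ∑ y ∈ Finset.range n,
      φ x y * ∑ q ∈ V with g q = x, ∑ r ∈ W with g r = y, f q r =
    ∑ q ∈ V, ∑ r ∈ W, φ (g q) (g r) * f q r := by
  rw [← Finset.sum_fiberwise_of_maps_to hV]
  refine Finset.sum_congr rfl fun x _ => ?_
  have : ∀ q ∈ V.filter (g · = x), ∑ r ∈ W, φ (g q) (g r) * f q r =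
      ∑ y ∈ Finset.range n, φ x y * ∑ r ∈ W with g r = y, f q r := by
    intro q hq
    rw [sum_fiber g hW (φ x) (f q), (Finset.mem_filter.1 hq).2]
  rw [Finset.sum_congr rfl this, Finset.sum_comm]
  exact Finset.sum_congr rfl fun y _ => Finset.mul_sum _ _ _

lemma sum_le_of_dvd {W : Finset ℕ} {b : ℕ} (hb : b ≠ 0) (hW : ∀ r ∈ W, r ≠ 0 ∧ b ∣ r) (R : ℕ)
    (P : ℕ → Prop) [DecidablePred P] {f : ℕ → ℝ} {B : ℝ} (hB : 0 ≤ B)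
    (hf : ∀ r ∈ W, P r → f r ≤ B) :
    ∑ r ∈ W with P r ∧ r ≤ R, f r ≤ B * (R / b) := by
  have hcard : ((W.filter fun r => P r ∧ r ≤ R).card : ℝ) ≤ R / b := by
    refine le_trans ?_ (Nat.cast_div_le (m := R) (n := b))
    have : W.filter (fun r => P r ∧ r ≤ R) ⊆ (Finset.Icc 1 (R / b)).image (b * ·) := by
      intro r hr
      obtain ⟨hrW, -, hrR⟩ := Finset.mem_filter.1 hr
      obtain ⟨hr0, k, rfl⟩ := hW r hrW
      refine Finset.mem_image.2 ⟨k, Finset.mem_Icc.2 ⟨?_, ?_⟩, rfl⟩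
      · exact Nat.pos_of_ne_zero fun h => hr0 (by simp [h])
      · rwa [Nat.le_div_iff_mul_le (Nat.pos_of_ne_zero hb), mul_comm]
    have := (Finset.card_le_card this).trans Finset.card_image_le
    rw [Nat.card_Icc, Nat.add_sub_cancel] at this
    exact_mod_cast this
  calc _ ≤ ∑ r ∈ W with P r ∧ r ≤ R, B := Finset.sum_le_sum fun r hr =>
        hf r (Finset.mem_filter.1 hr).1 (Finset.mem_filter.1 hr).2.1
    _ = B * (W.filter fun r => P r ∧ r ≤ R).card := by rw [Finset.sum_const, nsmul_eq_mul, mul_comm]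
    _ ≤ _ := mul_le_mul_of_nonneg_left hcard hB

open Classical in
lemma bilinear_base {ψ : ℕ → ℝ} (hψ : ∀ q, 0 ≤ ψ q) {T : ℝ} (hT : 0 < T) {a b : ℕ} (ha : a ≠ 0)
    (hb : b ≠ 0) {V W : Finset ℕ} (hV : ∀ q ∈ V, q ≠ 0 ∧ a ∣ q) (hW : ∀ r ∈ W, r ≠ 0 ∧ b ∣ r)
    (E : ℕ → ℕ → Prop) (hE : ∀ q ∈ V, ∀ r ∈ W, E q r → q * ψ r ≤ T * Nat.gcd q r ∧
      r * ψ q ≤ T * Nat.gcd q r ∧ ∀ p, p.Prime →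
        min (q.factorization p) (r.factorization p) = min (a.factorization p) (b.factorization p)) :
    ∑ q ∈ V, ∑ r ∈ W, (if E q r then (fac q * ψ q) * (fac r * ψ r) else 0) ≤
      √2 * ((∑ q ∈ V, fac q * ψ q) * ∑ r ∈ W, fac r * ψ r) ^ (3 / 4 : ℝ) *
        mass T a b ^ (1 / 4 : ℝ) := by
  set f : ℕ → ℝ := fun q => fac q * ψ q with hf
  have hf0 : ∀ q, 0 ≤ f q := fun q => mul_nonneg (fac_pos q).le (hψ q)
  have hgcd : ∀ q ∈ V, ∀ r ∈ W, E q r → Nat.gcd q r = Nat.gcd a b := by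
    intro q hq r hr h
    have h3 := (hE q hq r hr h).2.2
    refine Nat.eq_of_factorization_eq (Nat.gcd_ne_zero_left (hV q hq).1)
      (Nat.gcd_ne_zero_left ha) fun p => ?_
    rw [Nat.factorization_gcd (hV q hq).1 (hW r hr).1, Nat.factorization_gcd ha hb]
    by_cases hp : p.Prime
    · exact h3 p hp
    · simp [Nat.factorization_eq_zero_of_not_prime _ hp]
  have hqpos : ∀ q ∈ V, (0 : ℝ) < q := fun q hq => by
    exact_mod_cast Nat.pos_of_ne_zero (hV q hq).1
  have hrpos : ∀ r ∈ W, (0 : ℝ) < r := fun r hr => by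
    exact_mod_cast Nat.pos_of_ne_zero (hW r hr).1
  have ha' : (0 : ℝ) < a := by exact_mod_cast Nat.pos_of_ne_zero ha
  have hb' : (0 : ℝ) < b := by exact_mod_cast Nat.pos_of_ne_zero hb
  set g : ℝ := ((Nat.gcd a b : ℕ) : ℝ) with hg
  have hg0 : 0 ≤ g := Nat.cast_nonneg _
  have hfa := (fac_pos a).le
  have hfb := (fac_pos b).le
  have hsq := edge_sum_sq_le f hf0 E (Ca := fac a * T * g / a) (Cb := fac b * T * g / b)
    (by positivity) (by positivity) _ V W rfl (fun q hq => Nat.pos_of_ne_zero (hV q hq).1)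
    (fun r hr => Nat.pos_of_ne_zero (hW r hr).1)
    (fun q hq R => by
      have hq0 := hqpos q hq
      refine (sum_le_of_dvd hb hW R (E q) (B := fac b * (T * g / q)) (by positivity)
        fun r hr h => ?_).trans (le_of_eq (by field_simp))
      refine mul_le_mul (fac_le_of_dvd (hW r hr).2 (hW r hr).1) ?_ (hψ r) hfb
      have := (hE q hq r hr h).1
      rw [hgcd q hq r hr h] at this
      rw [le_div_iff₀ hq0]
      linarith)
    (fun r hr Q => by
      have hr0 := hrpos r hr
      refine (sum_le_of_dvd ha hV Q (E · r) (B := fac a * (T * g / r)) (by positivity)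
        fun q hq h => ?_).trans (le_of_eq (by field_simp))
      refine mul_le_mul (fac_le_of_dvd (hV q hq).2 (hV q hq).1) ?_ (hψ q) hfa
      have := (hE q hq r hr h).2.1
      rw [hgcd q hq r hr h] at this
      rw [le_div_iff₀ hr0]
      linarith)
  set S := ∑ q ∈ V, ∑ r ∈ W, if E q r then f q * f r else 0 with hS
  have hFV : 0 ≤ ∑ q ∈ V, f q := Finset.sum_nonneg fun q _ => hf0 q
  have hFW : 0 ≤ ∑ r ∈ W, f r := Finset.sum_nonneg fun q _ => hf0 q
  have hS0 : 0 ≤ S := Finset.sum_nonneg fun q _ => Finset.sum_nonneg fun r _ => by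
    split_ifs
    · exact mul_nonneg (hf0 q) (hf0 r)
    · exact le_rfl
  have hmass : fac a * T * g / a * (fac b * T * g / b) = mass T a b := by
    unfold mass
    rw [← hg]
    field_simp
  rw [hmass] at hsq
  have hM := (mass_pos hT ha hb).le
  set Y := (∑ q ∈ V, f q) * ∑ r ∈ W, f r with hY
  have hY0 : 0 ≤ Y := mul_nonneg hFV hFW
  have htriv : S ≤ Y := by
    rw [hS, hY, Finset.sum_mul_sum]
    refine Finset.sum_le_sum fun q _ => Finset.sum_le_sum fun r _ => ?_
    split_ifs
    · exact le_rfl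
    · exact mul_nonneg (hf0 q) (hf0 r)
  have h4 : S ^ 4 ≤ (√2 * Y ^ (3 / 4 : ℝ) * mass T a b ^ (1 / 4 : ℝ)) ^ 4 := by
    have e1 : (Y ^ (3 / 4 : ℝ)) ^ 4 = Y ^ 3 := by
      rw [← Real.rpow_natCast, ← Real.rpow_mul hY0]
      norm_num
    have e2 : (mass T a b ^ (1 / 4 : ℝ)) ^ 4 = mass T a b := by
      rw [← Real.rpow_natCast, ← Real.rpow_mul hM]
      norm_num
    have e3 : (√2 : ℝ) ^ 4 = 4 := by
      rw [show (4 : ℕ) = 2 * 2 by norm_num, pow_mul, Real.sq_sqrt (by norm_num)]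
      norm_num
    rw [mul_pow, mul_pow, e1, e2, e3]
    calc S ^ 4 = S ^ 2 * S ^ 2 := by ring
      _ ≤ Y ^ 2 * (4 * mass T a b * Y) :=
        mul_le_mul (pow_le_pow_left₀ hS0 htriv 2) hsq (sq_nonneg _) (by positivity)
      _ = _ := by ring
  exact le_of_pow_le_pow_left₀ (by norm_num) (by positivity) h4

open Classical in
theorem bilinear_bound {ψ : ℕ → ℝ} (hψ : ∀ q, 0 ≤ ψ q) {T : ℝ} (hT : 0 < T) {c : ℕ → ℝ}
    (hc : ∀ p, 1 ≤ c p) (hc8 : ∀ p, c p ≤ 8) {κ : ℕ → ℝ} (hκ : ∀ p, 0 ≤ κ p)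
    (hκp : ∀ p, p.Prime → κ p ^ 4 = (p : ℝ)⁻¹) (U : Finset ℕ) :
    (∀ p ∈ U, p.Prime) → ∀ a b : ℕ, a ≠ 0 → b ≠ 0 → (∀ p ∈ U, ¬ p ∣ a) → (∀ p ∈ U, ¬ p ∣ b) →
    ∀ V W : Finset ℕ, (∀ q ∈ V, q ≠ 0 ∧ a ∣ q) → (∀ r ∈ W, r ≠ 0 ∧ b ∣ r) →
    ∀ E : ℕ → ℕ → Prop, (∀ q ∈ V, ∀ r ∈ W, E q r → q * ψ r ≤ T * Nat.gcd q r ∧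
      r * ψ q ≤ T * Nat.gcd q r ∧ ∀ p, p.Prime → p ∉ U →
        min (q.factorization p) (r.factorization p) = min (a.factorization p) (b.factorization p)) →
    ∑ q ∈ V, ∑ r ∈ W, (if E q r then (fac q * ψ q) * (fac r * ψ r) *
        ∏ p ∈ U, (if q.factorization p = r.factorization p then 1 else c p) else 0) ≤
      (∏ p ∈ U, lossFactor (κ p) (c p)) * √2 *
        ((∑ q ∈ V, fac q * ψ q) * ∑ r ∈ W, fac r * ψ r) ^ (3 / 4 : ℝ) *
        mass T a b ^ (1 / 4 : ℝ) := by
  induction U using Finset.induction_on with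
  | empty =>
    intro _ a b ha hb _ _ V W hV hW E hE
    simp only [Finset.prod_empty, mul_one, one_mul]
    exact bilinear_base hψ hT ha hb hV hW E fun q hq r hr h =>
      ⟨(hE q hq r hr h).1, (hE q hq r hr h).2.1, fun p hp =>
        (hE q hq r hr h).2.2 p hp (Finset.notMem_empty p)⟩
  | insert p U hpU ih =>
    intro hU a b ha hb hUa hUb V W hV hW E hE
    have hp : p.Prime := hU p (Finset.mem_insert_self p U)
    have hUp : ∀ l ∈ U, l.Prime := fun l hl => hU l (Finset.mem_insert_of_mem hl)
    have hpa : ¬ p ∣ a := hUa p (Finset.mem_insert_self p U)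
    have hpb : ¬ p ∣ b := hUb p (Finset.mem_insert_self p U)
    set f : ℕ → ℝ := fun q => fac q * ψ q with hf
    have hf0 : ∀ q, 0 ≤ f q := fun q => mul_nonneg (fac_pos q).le (hψ q)
    set t : ℕ → ℕ → ℝ := fun q r => if E q r then f q * f r *
      ∏ l ∈ U, (if q.factorization l = r.factorization l then 1 else c l) else 0 with ht
    have hprod0 : ∀ q r : ℕ, 0 ≤ ∏ l ∈ U,
        (if q.factorization l = r.factorization l then 1 else c l) := fun q r =>
      Finset.prod_nonneg fun l _ => by
        split_ifs
        · norm_num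
        · linarith [hc l]
    have ht0 : ∀ q r, 0 ≤ t q r := fun q r => by
      simp only [ht]
      split_ifs
      · exact mul_nonneg (mul_nonneg (hf0 q) (hf0 r)) (hprod0 q r)
      · exact le_rfl
    set K := (∏ l ∈ U, lossFactor (κ l) (c l)) * √2 with hK
    have hL0 : ∀ l, 0 ≤ lossFactor (κ l) (c l) := fun l => lossFactor_nonneg (hκ l) (hc l)
    have hK0 : 0 ≤ K := mul_nonneg (Finset.prod_nonneg fun l _ => hL0 l) (Real.sqrt_nonneg _)
    set FV := ∑ q ∈ V, f q with hFV
    set FW := ∑ r ∈ W, f r with hFW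
    have hFV0 : 0 ≤ FV := Finset.sum_nonneg fun q _ => hf0 q
    have hFW0 : 0 ≤ FW := Finset.sum_nonneg fun q _ => hf0 q
    set g : ℕ → ℕ := fun q => q.factorization p with hg
    set n := (V ∪ W).sup g + 1 with hn
    have hVn : ∀ q ∈ V, g q ∈ Finset.range n := fun q hq =>
      Finset.mem_range.2 (Nat.lt_succ_of_le (Finset.le_sup (Finset.mem_union_left W hq)))
    have hWn : ∀ q ∈ W, g q ∈ Finset.range n := fun q hq =>
      Finset.mem_range.2 (Nat.lt_succ_of_le (Finset.le_sup (Finset.mem_union_right V hq)))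
    have hM := mass_pos hT ha hb
    have hM4 : 0 < mass T a b ^ (1 / 4 : ℝ) := Real.rpow_pos_of_pos hM _
    have hinv : κ p ^ 4 = (p : ℝ)⁻¹ := hκp p hp
    obtain ⟨hone, hone'⟩ := one_sub_inv_prime_mem hp
    -- the total rewritten through fibres
    have hLHS : ∑ q ∈ V, ∑ r ∈ W, (if E q r then f q * f r *
        ∏ l ∈ insert p U, (if q.factorization l = r.factorization l then 1 else c l) else 0) =
        ∑ x ∈ Finset.range n, ∑ y ∈ Finset.range n, (if x = y then 1 else c p) *
          ∑ q ∈ V with g q = x, ∑ r ∈ W with g r = y, t q r := by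
      rw [sum_sum_fiber g hVn hWn (fun x y => if x = y then 1 else c p) t]
      refine Finset.sum_congr rfl fun q _ => Finset.sum_congr rfl fun r _ => ?_
      rw [Finset.prod_insert hpU]
      simp only [ht, hg]
      by_cases hE' : E q r
      · rw [if_pos hE', if_pos hE']; ring
      · rw [if_neg hE', if_neg hE', mul_zero]
    rw [hLHS]
    -- the induction hypothesis for prescribed powers of `p`
    have hdvd : ∀ {m q : ℕ} (x : ℕ), ¬ p ∣ m → q ≠ 0 → m ∣ q → x ≤ g q → m * p ^ x ∣ q := by
      intro m q x hm hq hmq hx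
      refine Nat.Coprime.mul_dvd_of_dvd_of_dvd
        (Nat.Coprime.pow_right x ((Nat.Prime.coprime_iff_not_dvd hp).2 hm).symm) hmq ?_
      exact (hp.pow_dvd_iff_le_factorization hq).2 hx
    have hUm : ∀ {m : ℕ} (x : ℕ), (∀ l ∈ insert p U, ¬ l ∣ m) → ∀ l ∈ U, ¬ l ∣ m * p ^ x := by
      intro m x hm l hl h
      rcases (hUp l hl).dvd_mul.1 h with h | h
      · exact hm l (Finset.mem_insert_of_mem hl) h
      · have := (Nat.prime_dvd_prime_iff_eq (hUp l hl) hp).1 ((hUp l hl).dvd_of_dvd_pow h)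
        exact hpU (this ▸ hl)
    have hfactp : ∀ {m : ℕ} (x : ℕ), m ≠ 0 → ¬ p ∣ m → (m * p ^ x).factorization p = x := by
      intro m x hm hpm
      rw [Nat.factorization_mul hm (pow_ne_zero _ hp.ne_zero), Finsupp.add_apply,
        Nat.factorization_eq_zero_of_not_dvd hpm, hp.factorization_pow, Finsupp.single_eq_same,
        zero_add]
    have hfactl : ∀ {m l : ℕ} (x : ℕ), m ≠ 0 → l ≠ p →
        (m * p ^ x).factorization l = m.factorization l := by
      intro m l x hm hl
      rw [Nat.factorization_mul hm (pow_ne_zero _ hp.ne_zero), Finsupp.add_apply,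
        hp.factorization_pow, Finsupp.single_eq_of_ne hl, add_zero]
    have hIH : ∀ (x y : ℕ) (V' W' : Finset ℕ) (E' : ℕ → ℕ → Prop), V' ⊆ V → W' ⊆ W →
        (∀ q ∈ V', x ≤ g q) → (∀ r ∈ W', y ≤ g r) →
        (∀ q ∈ V', ∀ r ∈ W', E' q r → E q r ∧ min (g q) (g r) = min x y) →
        ∑ q ∈ V', ∑ r ∈ W', (if E' q r then f q * f r *
          ∏ l ∈ U, (if q.factorization l = r.factorization l then 1 else c l) else 0) ≤
        K * ((∑ q ∈ V', f q) * ∑ r ∈ W', f r) ^ (3 / 4 : ℝ) *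
          mass T (a * p ^ x) (b * p ^ y) ^ (1 / 4 : ℝ) := by
      intro x y V' W' E' hV' hW' hx hy hE'
      refine ih hUp _ _ (mul_ne_zero ha (pow_ne_zero _ hp.ne_zero))
        (mul_ne_zero hb (pow_ne_zero _ hp.ne_zero)) (hUm x hUa) (hUm y hUb) V' W'
        (fun q hq => ⟨(hV q (hV' hq)).1, hdvd x hpa (hV q (hV' hq)).1 (hV q (hV' hq)).2 (hx q hq)⟩)
        (fun q hq => ⟨(hW q (hW' hq)).1, hdvd y hpb (hW q (hW' hq)).1 (hW q (hW' hq)).2 (hy q hq)⟩)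
        E' fun q hq r hr h => ?_
      obtain ⟨h1, h2⟩ := hE' q hq r hr h
      obtain ⟨e1, e2, e3⟩ := hE q (hV' hq) r (hW' hr) h1
      refine ⟨e1, e2, fun l hl hlU => ?_⟩
      by_cases hlp : l = p
      · subst hlp
        rw [hfactp x ha hpa, hfactp y hb hpb]
        exact h2
      · rw [hfactl x ha hlp, hfactl y hb hlp]
        exact e3 l hl fun h => (Finset.mem_insert.1 h).elim hlp hlU
    by_cases hzero : FV = 0 ∨ FW = 0
    · have hz : ∀ x y, ∑ q ∈ V with g q = x, ∑ r ∈ W with g r = y, t q r = 0 := by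
        intro x y
        refine Finset.sum_eq_zero fun q hq => Finset.sum_eq_zero fun r hr => ?_
        have hq := (Finset.mem_filter.1 hq).1
        have hr := (Finset.mem_filter.1 hr).1
        have : f q * f r = 0 := by
          rcases hzero with h | h
          · rw [(Finset.sum_eq_zero_iff_of_nonneg fun q _ => hf0 q).1 h q hq, zero_mul]
          · rw [(Finset.sum_eq_zero_iff_of_nonneg fun q _ => hf0 q).1 h r hr, mul_zero]
        simp only [ht, this, zero_mul, ite_self]
      simp_rw [hz, mul_zero, Finset.sum_const_zero]
      have := hL0 p
      rw [Finset.prod_insert hpU]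
      have : 0 ≤ ∏ l ∈ U, lossFactor (κ l) (c l) := Finset.prod_nonneg fun l _ => hL0 l
      positivity
    push Not at hzero
    have hFVp : 0 < FV := lt_of_le_of_ne hFV0 hzero.1.symm
    have hFWp : 0 < FW := lt_of_le_of_ne hFW0 hzero.2.symm
    have hKp : 0 < K ∨ K = 0 := by
      rcases hK0.lt_or_eq with h | h
      · exact Or.inl h
      · exact Or.inr h.symm
    set D := (FV * FW) ^ (3 / 4 : ℝ) * mass T a b ^ (1 / 4 : ℝ) with hD
    have hDp : 0 < D := mul_pos (Real.rpow_pos_of_pos (mul_pos hFVp hFWp) _) hM4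
    set v : ℕ → ℝ := fun x => (∑ q ∈ V with g q = x, f q) / FV with hv
    set w : ℕ → ℝ := fun x => (∑ q ∈ W with g q = x, f q) / FW with hw
    have hrat : ∀ x y, mass T (a * p ^ x) (b * p ^ y) ^ (1 / 4 : ℝ) ≤
        mass T a b ^ (1 / 4 : ℝ) * κ p ^ Nat.dist x y := by
      intro x y
      rw [mass_mul_prime_pow hp hpa hpb]
      have hκd : κ p ^ Nat.dist x y = (((p : ℝ)⁻¹) ^ Nat.dist x y) ^ (1 / 4 : ℝ) := by
        rw [← hinv, ← pow_mul, mul_comm, pow_mul, ← Real.rpow_natCast (_ ^ Nat.dist x y) 4,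
          ← Real.rpow_mul (pow_nonneg (hκ p) _)]
        norm_num
      have hfle : ∀ z : ℕ, (if z = 0 then 1 else 1 - (p : ℝ)⁻¹) ≤ 1 ∧
          0 ≤ (if z = 0 then 1 else 1 - (p : ℝ)⁻¹) := fun z => by
        split_ifs
        · norm_num
        · exact ⟨hone', hone.le⟩
      rw [hκd, ← Real.mul_rpow hM.le (by positivity)]
      have h2 := hfle x
      have h3 := hfle y
      refine Real.rpow_le_rpow (mul_nonneg hM.le (mul_nonneg (mul_nonneg h2.2 h3.2)
        (by positivity))) ?_ (by norm_num)
      refine mul_le_mul_of_nonneg_left ?_ hM.le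
      exact mul_le_of_le_one_left (by positivity) (mul_le_one₀ h2.1 h3.2 h3.1)
    rcases hKp with hKp | hKz
    swap
    · have hz : ∀ x y, ∑ q ∈ V with g q = x, ∑ r ∈ W with g r = y, t q r = 0 := by
        intro x y
        refine le_antisymm ?_ (Finset.sum_nonneg fun q _ => Finset.sum_nonneg fun r _ => ht0 q r)
        have := hIH x y (V.filter (g · = x)) (W.filter (g · = y)) E (Finset.filter_subset _ _)
          (Finset.filter_subset _ _) (fun q hq => (Finset.mem_filter.1 hq).2.ge)
          (fun q hq => (Finset.mem_filter.1 hq).2.ge) (fun q hq r hr h => ⟨h, by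
            rw [(Finset.mem_filter.1 hq).2, (Finset.mem_filter.1 hr).2]⟩)
        rw [hKz, zero_mul, zero_mul] at this
        exact this
      simp_rw [hz, mul_zero, Finset.sum_const_zero]
      have := hL0 p
      rw [Finset.prod_insert hpU]
      have : 0 ≤ ∏ l ∈ U, lossFactor (κ l) (c l) := Finset.prod_nonneg fun l _ => hL0 l
      positivity
    set s : ℕ → ℕ → ℝ := fun x y =>
      (∑ q ∈ V with g q = x, ∑ r ∈ W with g r = y, t q r) / (K * D) with hs
    have hKD : 0 < K * D := mul_pos hKp hDp
    have hlocal := local_bound (n := n) (κ := κ p) (c := c p) (hκ p) (by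
        by_contra hcon
        push Not at hcon
        have h4 : (17 / 20 : ℝ) ^ 4 ≤ κ p ^ 4 := pow_le_pow_left₀ (by norm_num) hcon.le 4
        rw [hinv] at h4
        have : (p : ℝ)⁻¹ ≤ 2⁻¹ := inv_anti₀ (by norm_num) (by exact_mod_cast hp.two_le)
        norm_num at h4 this
        linarith) (hc p) (hc8 p) v w s
      (fun x => div_nonneg (Finset.sum_nonneg fun q _ => hf0 q) hFV0)
      (fun x => div_nonneg (Finset.sum_nonneg fun q _ => hf0 q) hFW0)
      (fun x y => div_nonneg (Finset.sum_nonneg fun q _ => Finset.sum_nonneg fun r _ => ht0 q r)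
        hKD.le)
      (by
        simp only [hv]
        rw [← Finset.sum_div, Finset.sum_fiberwise_of_maps_to hVn, div_self hFVp.ne'])
      (by
        simp only [hw]
        rw [← Finset.sum_div, Finset.sum_fiberwise_of_maps_to hWn, div_self hFWp.ne'])
      (by
        intro x y
        have := hIH x y (V.filter (g · = x)) (W.filter (g · = y)) E (Finset.filter_subset _ _)
          (Finset.filter_subset _ _) (fun q hq => (Finset.mem_filter.1 hq).2.ge)
          (fun q hq => (Finset.mem_filter.1 hq).2.ge) (fun q hq r hr h => ⟨h, by
            rw [(Finset.mem_filter.1 hq).2, (Finset.mem_filter.1 hr).2]⟩)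
        simp only [hs, hv, hw]
        rw [div_le_iff₀ hKD, div_mul_div_comm, Real.div_rpow
          (mul_nonneg (Finset.sum_nonneg fun q _ => hf0 q) (Finset.sum_nonneg fun q _ => hf0 q))
          (by positivity)]
        refine this.trans ?_
        have hpos : 0 < (FV * FW) ^ (3 / 4 : ℝ) := Real.rpow_pos_of_pos (mul_pos hFVp hFWp) _
        calc _ ≤ K * ((∑ q ∈ V with g q = x, f q) * ∑ r ∈ W with g r = y, f r) ^ (3 / 4 : ℝ) *
            (mass T a b ^ (1 / 4 : ℝ) * κ p ^ Nat.dist x y) := by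
              refine mul_le_mul_of_nonneg_left (hrat x y) (mul_nonneg hK0 ?_)
              exact Real.rpow_nonneg (mul_nonneg (Finset.sum_nonneg fun q _ => hf0 q)
                (Finset.sum_nonneg fun q _ => hf0 q)) _
          _ = _ := by
              rw [hD]
              field_simp)
      (by
        intro x₀
        have hIH' := hIH x₀ x₀ (V.filter (x₀ ≤ g ·)) (W.filter (x₀ ≤ g ·))
          (fun q r => E q r ∧ min (g q) (g r) = x₀) (Finset.filter_subset _ _)
          (Finset.filter_subset _ _) (fun q hq => (Finset.mem_filter.1 hq).2)
          (fun q hq => (Finset.mem_filter.1 hq).2) (fun q hq r hr h => ⟨h.1, by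
            rw [h.2, min_self]⟩)
        have hmassx : mass T (a * p ^ x₀) (b * p ^ x₀) ^ (1 / 4 : ℝ) ≤
            mass T a b ^ (1 / 4 : ℝ) * (if x₀ = 0 then 1 else 1 - κ p ^ 4 / 2) := by
          rw [mass_mul_prime_pow hp hpa hpb, Nat.dist_self, pow_zero, mul_one, hinv]
          split_ifs with h0
          · simp
          · rw [Real.mul_rpow hM.le (by positivity)]
            refine mul_le_mul_of_nonneg_left ?_ hM4.le
            rw [← sq, ← Real.rpow_natCast, ← Real.rpow_mul hone.le]
            have := rpow_one_add_le_one_add_mul_self (s := -(p : ℝ)⁻¹) (by linarith)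
              (p := 1 / 2) (by norm_num) (by norm_num)
            rw [← sub_eq_add_neg] at this
            norm_num at this ⊢
            linarith
        have hsum : ∀ (F : ℝ) (Z : Finset ℕ), (∀ q ∈ Z, g q ∈ Finset.range n) →
            ∑ x ∈ Finset.range n with x₀ ≤ x, (∑ q ∈ Z with g q = x, f q) / F =
            (∑ q ∈ Z with x₀ ≤ g q, f q) / F := by
          intro F Z hZ
          rw [← Finset.sum_div]
          congr 1
          have := sum_fiber g hZ (fun x => if x₀ ≤ x then 1 else 0) f
          simp only [ite_mul, one_mul, zero_mul] at this
          rw [Finset.sum_filter, Finset.sum_filter]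
          exact this
        have hsum2 : ∑ x ∈ Finset.range n, ∑ y ∈ Finset.range n,
            (if min x y = x₀ then s x y else 0) =
            (∑ q ∈ V with x₀ ≤ g q, ∑ r ∈ W with x₀ ≤ g r,
              (if E q r ∧ min (g q) (g r) = x₀ then f q * f r *
              ∏ l ∈ U, (if q.factorization l = r.factorization l then 1 else c l) else 0)) /
              (K * D) := by
          have h1 := sum_sum_fiber g hVn hWn (fun x y => if min x y = x₀ then 1 else 0) t
          have h2 : ∑ x ∈ Finset.range n, ∑ y ∈ Finset.range n,
            (if min x y = x₀ then s x y else 0) = (∑ x ∈ Finset.range n, ∑ y ∈ Finset.range n,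
            (if min x y = x₀ then 1 else 0) *
              ∑ q ∈ V with g q = x, ∑ r ∈ W with g r = y, t q r) / (K * D) := by
            rw [Finset.sum_div]
            refine Finset.sum_congr rfl fun x _ => ?_
            rw [Finset.sum_div]
            refine Finset.sum_congr rfl fun y _ => ?_
            simp only [hs]
            split_ifs <;> simp
          rw [h2, h1, Finset.sum_filter]
          congr 1
          refine Finset.sum_congr rfl fun q _ => ?_
          split_ifs with hq
          · rw [Finset.sum_filter]
            refine Finset.sum_congr rfl fun r _ => ?_
            simp only [ht]
            by_cases hm : min (g q) (g r) = x₀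
            · have hr : x₀ ≤ g r := hm ▸ min_le_right _ _
              rw [if_pos hm, if_pos hr, one_mul]
              simp only [hm, and_true]
            · rw [if_neg hm, zero_mul]
              simp only [hm, and_false, if_false, ite_self]
          · refine Finset.sum_eq_zero fun r _ => ?_
            rw [if_neg (by omega), zero_mul]
        rw [hsum2]
        simp only [hv, hw]
        rw [hsum FV V hVn, hsum FW W hWn, div_le_iff₀ hKD, div_mul_div_comm, Real.div_rpow
          (mul_nonneg (Finset.sum_nonneg fun q _ => hf0 q) (Finset.sum_nonneg fun q _ => hf0 q))
          (by positivity)]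
        refine (le_of_eq ?_).trans (hIH'.trans ?_)
        · refine Finset.sum_congr rfl fun q _ => Finset.sum_congr rfl fun r _ => ?_
          congr
        have hpos : 0 < (FV * FW) ^ (3 / 4 : ℝ) := Real.rpow_pos_of_pos (mul_pos hFVp hFWp) _
        calc _ ≤ K * ((∑ q ∈ V with x₀ ≤ g q, f q) * ∑ r ∈ W with x₀ ≤ g r, f r) ^ (3 / 4 : ℝ) *
            (mass T a b ^ (1 / 4 : ℝ) * (if x₀ = 0 then 1 else 1 - κ p ^ 4 / 2)) := by
              refine mul_le_mul_of_nonneg_left hmassx (mul_nonneg hK0 ?_)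
              exact Real.rpow_nonneg (mul_nonneg (Finset.sum_nonneg fun q _ => hf0 q)
                (Finset.sum_nonneg fun q _ => hf0 q)) _
          _ = _ := by
              rw [hD]
              generalize (if x₀ = 0 then 1 else 1 - κ p ^ 4 / 2) = P
              field_simp)
    have hfin : ∑ x ∈ Finset.range n, ∑ y ∈ Finset.range n, (if x = y then 1 else c p) *
        ∑ q ∈ V with g q = x, ∑ r ∈ W with g r = y, t q r =
        (∑ x ∈ Finset.range n, ∑ y ∈ Finset.range n, s x y * (if x = y then 1 else c p)) *
          (K * D) := by
      rw [Finset.sum_mul]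
      refine Finset.sum_congr rfl fun x _ => ?_
      rw [Finset.sum_mul]
      refine Finset.sum_congr rfl fun y _ => ?_
      simp only [hs]
      rw [mul_right_comm, div_mul_cancel₀ _ hKD.ne', mul_comm]
    rw [hfin, Finset.prod_insert hpU]
    calc _ ≤ lossFactor (κ p) (c p) * (K * D) := mul_le_mul_of_nonneg_right hlocal hKD.le
      _ = _ := by rw [hD, hK]; ring

/-- The weight of a prime at which two integers have different valuations. -/
noncomputable def primeWeight (T p : ℕ) : ℝ := if T < p then Real.exp (2 * T / p) else 1

lemma one_le_primeWeight (T p : ℕ) : 1 ≤ primeWeight T p := by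
  unfold primeWeight
  split_ifs
  · exact Real.one_le_exp (by positivity)
  · exact le_rfl

lemma exp_two_le_eight : Real.exp 2 ≤ 8 := by
  have h : Real.exp 2 = Real.exp 1 ^ 2 := by rw [← Real.exp_nat_mul]; norm_num
  have := Real.exp_one_lt_d9
  have := Real.exp_pos 1
  rw [h]
  nlinarith

lemma exp_sub_one_le_mul {x : ℝ} (hx : 0 ≤ x) (hx2 : x ≤ 2) : Real.exp x - 1 ≤ 8 * x := by
  have h1 : Real.exp x ≤ 8 := (Real.exp_le_exp.2 hx2).trans exp_two_le_eight
  have h2 := Real.add_one_le_exp (-x)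
  have h3 : Real.exp x * Real.exp (-x) = 1 := by rw [← Real.exp_add]; simp
  nlinarith [Real.exp_pos x]

lemma primeWeight_le_eight (T p : ℕ) : primeWeight T p ≤ 8 := by
  unfold primeWeight
  split_ifs with h
  · refine (Real.exp_le_exp.2 ?_).trans exp_two_le_eight
    have hp : (0 : ℝ) < p := by exact_mod_cast (Nat.zero_le T).trans_lt h
    rw [div_le_iff₀ hp]
    have : (T : ℝ) < p := by exact_mod_cast h
    linarith
  · norm_num

lemma primeWeight_sub_one_le (T p : ℕ) :
    (primeWeight T p - 1) * (p : ℝ)⁻¹ ≤ if T < p then 16 * T * ((p : ℝ) ^ 2)⁻¹ else 0 := by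
  unfold primeWeight
  split_ifs with h
  · have hp : (0 : ℝ) < p := by exact_mod_cast (Nat.zero_le T).trans_lt h
    have hT : (T : ℝ) < p := by exact_mod_cast h
    have := exp_sub_one_le_mul (x := 2 * T / p) (by positivity) (by
      rw [div_le_iff₀ hp]; linarith)
    calc _ ≤ 8 * (2 * T / p) * (p : ℝ)⁻¹ :=
          mul_le_mul_of_nonneg_right this (by positivity)
      _ = _ := by field_simp; ring
  · simp

lemma exists_prod_lossFactor_le : ∃ C : ℝ, 0 < C ∧ ∀ (T : ℕ) (U : Finset ℕ), (∀ p ∈ U, p.Prime) →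
    ∏ p ∈ U, lossFactor (((p : ℝ) ^ (1 / 4 : ℝ))⁻¹) (primeWeight T p) ≤ C := by
  obtain ⟨P, hP⟩ : ∃ P : ℕ, ∀ p : ℕ, P ≤ p → ((p : ℝ) ^ (1 / 4 : ℝ))⁻¹ ≤ 1 / 10 ^ 6 := by
    have h := (tendsto_rpow_atTop (y := (1 / 4 : ℝ)) (by norm_num)).comp
      (tendsto_natCast_atTop_atTop (R := ℝ))
    obtain ⟨P, hP⟩ := Filter.eventually_atTop.1 (h.eventually_ge_atTop (10 ^ 6 : ℝ))
    refine ⟨P, fun p hp => ?_⟩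
    refine (inv_anti₀ (by positivity) (hP p hp)).trans_eq (one_div _).symm
  have hsum : Summable fun n : ℕ => ((n : ℝ) ^ (5 / 4 : ℝ))⁻¹ :=
    Real.summable_nat_rpow_inv.2 (by norm_num)
  set S := ∑' n : ℕ, ((n : ℝ) ^ (5 / 4 : ℝ))⁻¹ with hS
  refine ⟨104 ^ P * Real.exp (10 ^ 12 * (S + 32)), by positivity, fun T U hU => ?_⟩
  set e : ℕ → ℝ := fun p => ((p : ℝ) ^ (5 / 4 : ℝ))⁻¹ +
    if T < p then 16 * T * ((p : ℝ) ^ 2)⁻¹ else 0 with he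
  have he0 : ∀ p, 0 ≤ e p := fun p => by
    simp only [he]
    split_ifs <;> positivity
  have hlocal : ∀ p ∈ U, lossFactor (((p : ℝ) ^ (1 / 4 : ℝ))⁻¹) (primeWeight T p) ≤
      (if p < P then 104 else 1) * Real.exp (10 ^ 12 * e p) := by
    intro p hp
    have hp0 : (0 : ℝ) < p := by exact_mod_cast (hU p hp).pos
    have hexp : 1 ≤ Real.exp (10 ^ 12 * e p) :=
      Real.one_le_exp (mul_nonneg (by norm_num) (he0 p))
    unfold lossFactor
    by_cases h1 : ((p : ℝ) ^ (1 / 4 : ℝ))⁻¹ ≤ 1 / 10 ^ 6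
    · rw [if_pos h1]
      have h5 : (((p : ℝ) ^ (1 / 4 : ℝ))⁻¹) ^ 5 = ((p : ℝ) ^ (5 / 4 : ℝ))⁻¹ := by
        rw [inv_pow, ← Real.rpow_natCast, ← Real.rpow_mul hp0.le]
        norm_num
      have h4 : (((p : ℝ) ^ (1 / 4 : ℝ))⁻¹) ^ 4 = (p : ℝ)⁻¹ := by
        rw [inv_pow, ← Real.rpow_natCast, ← Real.rpow_mul hp0.le]
        norm_num
      rw [h5, h4]
      have h6 := primeWeight_sub_one_le T p
      have h7 := Real.add_one_le_exp (10 ^ 12 * e p)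
      have h8 : Real.exp (10 ^ 12 * e p) ≤
          (if p < P then 104 else 1) * Real.exp (10 ^ 12 * e p) :=
        le_mul_of_one_le_left (by positivity) (by split_ifs <;> norm_num)
      refine le_trans ?_ h8
      refine le_trans ?_ h7
      simp only [he]
      linarith
    · rw [if_neg h1, if_pos (not_le.1 fun h => h1 (hP p h))]
      linarith
  calc _ ≤ ∏ p ∈ U, ((if p < P then 104 else 1) * Real.exp (10 ^ 12 * e p)) :=
        Finset.prod_le_prod (fun p _ => lossFactor_nonneg (by positivity) (one_le_primeWeight T p))
          hlocal
    _ = (∏ p ∈ U, if p < P then 104 else 1) * Real.exp (10 ^ 12 * ∑ p ∈ U, e p) := by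
        rw [Finset.prod_mul_distrib, ← Real.exp_sum, Finset.mul_sum]
    _ ≤ _ := by
        refine mul_le_mul ?_ (Real.exp_le_exp.2 (mul_le_mul_of_nonneg_left ?_ (by norm_num)))
          (by positivity) (by positivity)
        · rw [Finset.prod_ite, Finset.prod_const, Finset.prod_const_one, mul_one]
          refine pow_le_pow_right₀ (by norm_num) ?_
          calc _ ≤ (Finset.range P).card := Finset.card_le_card fun p hp =>
                Finset.mem_range.2 (Finset.mem_filter.1 hp).2
            _ = P := Finset.card_range P
        · simp only [he]
          rw [Finset.sum_add_distrib]
          refine add_le_add (hsum.sum_le_tsum _ fun p _ => by positivity) ?_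
          rw [← Finset.sum_filter, ← Finset.mul_sum]
          have h1 : U.filter (T < ·) ⊆ Finset.Ioo T (U.sup id + 1) := fun p hp => by
            obtain ⟨hpU, hpT⟩ := Finset.mem_filter.1 hp
            exact Finset.mem_Ioo.2 ⟨hpT, Nat.lt_succ_of_le (Finset.le_sup (f := id) hpU)⟩
          have h2 := (Finset.sum_le_sum_of_subset_of_nonneg h1 (f := fun p : ℕ => ((p : ℝ) ^ 2)⁻¹)
            fun p _ _ => by positivity).trans (sum_Ioo_inv_sq_le (α := ℝ) T (U.sup id + 1))
          calc _ ≤ 16 * (T : ℝ) * (2 / (T + 1)) := mul_le_mul_of_nonneg_left h2 (by positivity)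
            _ ≤ 32 := by
              rw [← mul_div_assoc, div_le_iff₀ (by positivity)]
              linarith

open Classical in
/-- The level-`T` bilinear estimate. -/
theorem exists_level_bound : ∃ C : ℝ, 0 < C ∧ ∀ (ψ : ℕ → ℝ), (∀ q, 0 ≤ ψ q) → ∀ (T : ℕ), 1 ≤ T →
    ∀ (Z U : Finset ℕ), (∀ p ∈ U, p.Prime) → (∀ q ∈ Z, q ≠ 0 ∧ q.primeFactors ⊆ U) →
    ∑ q ∈ Z, ∑ r ∈ Z, (if q * ψ r ≤ T * Nat.gcd q r ∧ r * ψ q ≤ T * Nat.gcd q r then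
      (fac q * ψ q) * (fac r * ψ r) * ∏ p ∈ U,
        (if q.factorization p = r.factorization p then 1 else primeWeight T p) else 0) ≤
      C * (√T * (∑ q ∈ Z, fac q * ψ q) ^ (3 / 2 : ℝ)) := by
  obtain ⟨C, hC, hCb⟩ := exists_prod_lossFactor_le
  refine ⟨C * √2, by positivity, fun ψ hψ T hT Z U hU hZ => ?_⟩
  have hT0 : (0 : ℝ) < T := by exact_mod_cast hT
  have hF : 0 ≤ ∑ q ∈ Z, fac q * ψ q :=
    Finset.sum_nonneg fun q _ => mul_nonneg (fac_pos q).le (hψ q)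
  have hvan : ∀ q ∈ Z, ∀ p, p ∉ U → q.factorization p = 0 := fun q hq p hp =>
    Finsupp.notMem_support_iff.1 fun h => hp ((hZ q hq).2 h)
  have h := bilinear_bound hψ hT0 (c := primeWeight T) (one_le_primeWeight T)
    (primeWeight_le_eight T) (κ := fun p => ((p : ℝ) ^ (1 / 4 : ℝ))⁻¹) (fun p => by positivity)
    (fun p hp => by
      rw [inv_pow, ← Real.rpow_natCast, ← Real.rpow_mul (Nat.cast_nonneg p)]
      norm_num) U hU 1 1 one_ne_zero one_ne_zero
    (fun p hp => (hU p hp).one_lt.ne' ∘ Nat.dvd_one.1)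
    (fun p hp => (hU p hp).one_lt.ne' ∘ Nat.dvd_one.1) Z Z
    (fun q hq => ⟨(hZ q hq).1, one_dvd q⟩) (fun q hq => ⟨(hZ q hq).1, one_dvd q⟩)
    (fun q r => q * ψ r ≤ T * Nat.gcd q r ∧ r * ψ q ≤ T * Nat.gcd q r)
    (fun q hq r hr h => ⟨h.1, h.2, fun p _ hp => by simp [hvan q hq p hp]⟩)
  have hm : mass T 1 1 ^ (1 / 4 : ℝ) = √T := by
    have : mass T 1 1 = (T : ℝ) ^ 2 := by simp [mass, fac]
    rw [this, ← Real.rpow_natCast, ← Real.rpow_mul hT0.le, Real.sqrt_eq_rpow]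
    norm_num
  have hF2 : ((∑ q ∈ Z, fac q * ψ q) * ∑ q ∈ Z, fac q * ψ q) ^ (3 / 4 : ℝ) =
      (∑ q ∈ Z, fac q * ψ q) ^ (3 / 2 : ℝ) := by
    rw [← sq, ← Real.rpow_natCast, ← Real.rpow_mul hF]
    norm_num
  rw [hm, hF2] at h
  refine (le_of_eq ?_).trans (h.trans ?_)
  · refine Finset.sum_congr rfl fun q _ => Finset.sum_congr rfl fun r _ => ?_
    congr
  · have := mul_le_mul_of_nonneg_right (hCb T U hU)
      (show 0 ≤ √2 * (∑ q ∈ Z, fac q * ψ q) ^ (3 / 2 : ℝ) * √T by positivity)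
    linarith

/-- The primes up to `n`. -/
def primesUpTo (n : ℕ) : Finset ℕ := (Finset.Ioc 0 n).filter Nat.Prime

lemma mem_primesUpTo {n p : ℕ} : p ∈ primesUpTo n ↔ p ≤ n ∧ p.Prime := by
  simp only [primesUpTo, Finset.mem_filter, Finset.mem_Ioc]
  exact ⟨fun h => ⟨h.1.2, h.2⟩, fun h => ⟨⟨h.2.pos, h.1⟩, h.2⟩⟩

lemma primesUpTo_succ (n : ℕ) : primesUpTo (n + 1) =
    if (n + 1).Prime then insert (n + 1) (primesUpTo n) else primesUpTo n := by
  unfold primesUpTo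
  rw [← Finset.insert_Ioc_right_eq_Ioc_add_one (Nat.zero_le n), Finset.filter_insert]

lemma sum_log_div_primesUpTo_le {n : ℕ} (hn : 1 ≤ n) :
    ∑ p ∈ primesUpTo n, Real.log p / p ≤ Real.log n + Real.log 4 := by
  have hn0 : (0 : ℝ) < n := by exact_mod_cast hn
  have hlog : ∀ p : ℕ, 0 ≤ Real.log p := fun p => Real.log_natCast_nonneg p
  have h1 : ∑ p ∈ primesUpTo n, Real.log p * ((n / p : ℕ) : ℝ) ≤ n * Real.log n := by
    calc _ = ∑ p ∈ primesUpTo n, ∑ k ∈ Finset.Ioc 0 n, if p ∣ k then Real.log p else 0 := by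
          refine Finset.sum_congr rfl fun p _ => ?_
          rw [← Finset.sum_filter, Finset.sum_const, Nat.Ioc_filter_dvd_card_eq_div, nsmul_eq_mul,
            mul_comm]
      _ = ∑ k ∈ Finset.Ioc 0 n, ∑ p ∈ primesUpTo n with p ∣ k, Real.log p := by
          rw [Finset.sum_comm]
          exact Finset.sum_congr rfl fun k _ => (Finset.sum_filter _ _).symm
      _ ≤ ∑ k ∈ Finset.Ioc 0 n, Real.log n := by
          refine Finset.sum_le_sum fun k hk => ?_
          obtain ⟨hk0, hkn⟩ := Finset.mem_Ioc.1 hk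
          calc _ ≤ ∑ p ∈ k.primeFactors, Real.log p :=
                Finset.sum_le_sum_of_subset_of_nonneg (fun p hp => by
                  obtain ⟨h1, h2⟩ := Finset.mem_filter.1 hp
                  exact Nat.mem_primeFactors.2 ⟨(mem_primesUpTo.1 h1).2, h2, hk0.ne'⟩)
                  fun p _ _ => hlog p
            _ = Real.log ((∏ p ∈ k.primeFactors, p : ℕ) : ℝ) := by
                rw [Nat.cast_prod, Real.log_prod]
                exact fun p hp => Nat.cast_ne_zero.2 (Nat.prime_of_mem_primeFactors hp).ne_zero
            _ ≤ Real.log n := by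
                refine Real.log_le_log (by
                  exact_mod_cast Finset.prod_pos fun p hp =>
                    (Nat.prime_of_mem_primeFactors hp).pos) ?_
                exact_mod_cast (Nat.le_of_dvd hk0 (Nat.prod_primeFactors_dvd k)).trans hkn
      _ = _ := by rw [Finset.sum_const, Nat.card_Ioc, Nat.sub_zero, nsmul_eq_mul]
  have h2 : ∑ p ∈ primesUpTo n, Real.log p ≤ Real.log 4 * n := by
    have := Chebyshev.theta_le_log4_mul_x (x := n) hn0.le
    simpa [Chebyshev.theta, primesUpTo] using this
  have h3 : n * ∑ p ∈ primesUpTo n, Real.log p / p ≤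
      ∑ p ∈ primesUpTo n, Real.log p * ((n / p : ℕ) : ℝ) + ∑ p ∈ primesUpTo n, Real.log p := by
    rw [Finset.mul_sum, ← Finset.sum_add_distrib]
    refine Finset.sum_le_sum fun p hp => ?_
    have hp0 : 0 < p := (mem_primesUpTo.1 hp).2.pos
    have h : (n : ℝ) / p ≤ ((n / p : ℕ) : ℝ) + 1 := by
      rw [div_le_iff₀ (by exact_mod_cast hp0)]
      exact_mod_cast (Nat.lt_div_mul_add (a := n) hp0).le.trans (by rw [add_mul, one_mul])
    calc _ = Real.log p * (n / p) := by ring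
      _ ≤ Real.log p * (((n / p : ℕ) : ℝ) + 1) := mul_le_mul_of_nonneg_left h (hlog p)
      _ = _ := by ring
  have h4 : n * ∑ p ∈ primesUpTo n, Real.log p / p ≤ n * (Real.log n + Real.log 4) := by
    linarith
  exact le_of_mul_le_mul_left h4 hn0

lemma sum_inv_primesUpTo_le : ∃ C : ℝ, ∀ n : ℕ, 2 ≤ n →
    ∑ p ∈ primesUpTo n, (p : ℝ)⁻¹ ≤ Real.log (Real.log n) + C := by
  set A : ℕ → ℝ := fun n => ∑ p ∈ primesUpTo n, Real.log p / p with hA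
  set R : ℕ → ℝ := fun n => ∑ p ∈ primesUpTo n, (p : ℝ)⁻¹ - A n / Real.log n -
    Real.log (Real.log n) + Real.log 4 / Real.log n with hR
  have hmono : ∀ n, 2 ≤ n → R n ≤ R 2 := by
    intro n hn
    induction n, hn using Nat.le_induction with
    | base => exact le_rfl
    | succ n hn ih =>
      refine le_trans ?_ ih
      have hn1 : (1 : ℝ) < n := by exact_mod_cast hn
      have hl : 0 < Real.log n := Real.log_pos hn1
      have hl' : 0 < Real.log ((n + 1 : ℕ) : ℝ) := Real.log_pos (by push_cast; linarith)
      have hll : Real.log n ≤ Real.log ((n + 1 : ℕ) : ℝ) :=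
        Real.log_le_log (by linarith) (by push_cast; linarith)
      have hAn : A n ≤ Real.log n + Real.log 4 := sum_log_div_primesUpTo_le (by omega)
      have hstep : ∑ p ∈ primesUpTo (n + 1), (p : ℝ)⁻¹ - A (n + 1) / Real.log ((n + 1 : ℕ) : ℝ) =
          ∑ p ∈ primesUpTo n, (p : ℝ)⁻¹ - A n / Real.log ((n + 1 : ℕ) : ℝ) := by
        simp only [hA]
        rw [primesUpTo_succ]
        split_ifs with hp
        · have hnm : n + 1 ∉ primesUpTo n := fun h => by
            have := (mem_primesUpTo.1 h).1
            omega
          rw [Finset.sum_insert hnm, Finset.sum_insert hnm]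
          field_simp
          ring
        · rfl
      have hquot := Real.one_sub_inv_le_log_of_pos (x := Real.log ((n + 1 : ℕ) : ℝ) / Real.log n)
        (by positivity)
      rw [inv_div, Real.log_div hl'.ne' hl.ne'] at hquot
      have hdiff : 0 ≤ (Real.log n)⁻¹ - (Real.log ((n + 1 : ℕ) : ℝ))⁻¹ := by
        rw [sub_nonneg]
        exact inv_anti₀ hl hll
      have hmul := mul_le_mul_of_nonneg_right hAn hdiff
      simp only [hR]
      rw [hstep]
      have e1 : Real.log n * ((Real.log n)⁻¹ - (Real.log ((n + 1 : ℕ) : ℝ))⁻¹) =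
          1 - Real.log n / Real.log ((n + 1 : ℕ) : ℝ) := by field_simp
      simp only [div_eq_mul_inv] at *
      nlinarith
  refine ⟨R 2 + 1 + Real.log 4 / Real.log 2, fun n hn => ?_⟩
  have h := hmono n hn
  have hn1 : (1 : ℝ) < n := by exact_mod_cast hn
  have hl : 0 < Real.log n := Real.log_pos hn1
  have hAn : A n / Real.log n ≤ 1 + Real.log 4 / Real.log n := by
    rw [div_le_iff₀ hl, add_mul, one_mul, div_mul_cancel₀ _ hl.ne']
    exact sum_log_div_primesUpTo_le (by omega)
  have h4 : 0 ≤ Real.log 4 / Real.log 2 := by positivity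
  simp only [hR] at h ⊢
  linarith

lemma inv_one_sub_inv_le_exp {p : ℕ} (hp : 2 ≤ p) :
    (1 - (p : ℝ)⁻¹)⁻¹ ≤ Real.exp ((p : ℝ)⁻¹ + 2 * ((p : ℝ) ^ 2)⁻¹) := by
  have hp2 : (2 : ℝ) ≤ p := by exact_mod_cast hp
  have h : (1 - (p : ℝ)⁻¹)⁻¹ ≤ (p : ℝ)⁻¹ + 2 * ((p : ℝ) ^ 2)⁻¹ + 1 := by
    have : 1 - (p : ℝ)⁻¹ = (p - 1) / p := by field_simp
    rw [this, inv_div, div_le_iff₀ (by linarith)]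
    field_simp
    nlinarith
  exact h.trans (Real.add_one_le_exp _)

lemma sum_inv_sq_le (s : Finset ℕ) (hs : ∀ p ∈ s, p ≠ 0) : ∑ p ∈ s, ((p : ℝ) ^ 2)⁻¹ ≤ 2 := by
  have h1 : s ⊆ Finset.Ioo 0 (s.sup id + 1) := fun p hp =>
    Finset.mem_Ioo.2 ⟨Nat.pos_of_ne_zero (hs p hp), Nat.lt_succ_of_le (Finset.le_sup (f := id) hp)⟩
  refine (Finset.sum_le_sum_of_subset_of_nonneg h1 fun p _ _ => by positivity).trans
    ((sum_Ioo_inv_sq_le (α := ℝ) 0 _).trans ?_)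
  norm_num

/-- Mertens' upper bound. -/
lemma exists_prod_primesUpTo_le : ∃ C : ℝ, 0 < C ∧ ∀ n : ℕ, 2 ≤ n →
    ∏ p ∈ primesUpTo n, (1 - (p : ℝ)⁻¹)⁻¹ ≤ C * Real.log n := by
  obtain ⟨C, hC⟩ := sum_inv_primesUpTo_le
  refine ⟨Real.exp (C + 4), Real.exp_pos _, fun n hn => ?_⟩
  have hl : 0 < Real.log n := Real.log_pos (by exact_mod_cast hn)
  calc _ ≤ ∏ p ∈ primesUpTo n, Real.exp ((p : ℝ)⁻¹ + 2 * ((p : ℝ) ^ 2)⁻¹) :=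
        Finset.prod_le_prod (fun p hp => inv_nonneg.2
          (one_sub_inv_prime_mem (mem_primesUpTo.1 hp).2).1.le)
          fun p hp => inv_one_sub_inv_le_exp (mem_primesUpTo.1 hp).2.two_le
    _ = Real.exp (∑ p ∈ primesUpTo n, (p : ℝ)⁻¹ + 2 * ∑ p ∈ primesUpTo n, ((p : ℝ) ^ 2)⁻¹) := by
        rw [← Real.exp_sum, Finset.sum_add_distrib, Finset.mul_sum]
    _ ≤ Real.exp (Real.log (Real.log n) + (C + 4)) := by
        have := sum_inv_sq_le (primesUpTo n) fun p hp => (mem_primesUpTo.1 hp).2.ne_zero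
        have := hC n hn
        exact Real.exp_le_exp.2 (by linarith)
    _ = _ := by rw [Real.exp_add, Real.exp_log hl, mul_comm]

lemma one_le_Log2 (x : ℝ) : 1 ≤ Log2 x := le_max_left _ _

lemma log_log_le_Log2 {x : ℝ} (hx : 1 < x) : Real.log (Real.log x) ≤ Log2 x := by
  unfold Log2 Log
  exact (Real.log_le_log (Real.log_pos hx) (le_max_right 1 _)).trans (le_max_right _ _)

lemma exists_fac_lower : ∃ c : ℝ, 0 < c ∧ ∀ n : ℕ, 1 ≤ n → c ≤ fac n * Log2 n := by
  obtain ⟨C, hC, hCb⟩ := exists_prod_primesUpTo_le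
  refine ⟨min (Real.exp (-Real.exp 1)) (C⁻¹ * Real.exp (-3)), by positivity, fun n hn => ?_⟩
  have hn0 : (0 : ℝ) < n := by exact_mod_cast hn
  rcases le_or_gt (Real.log n) (Real.exp 1) with h | h
  · refine (min_le_left _ _).trans ?_
    have h1 : (n : ℝ)⁻¹ ≤ fac n := by
      rw [inv_le_iff_one_le_mul₀ hn0, mul_comm, ← totient_eq_mul_fac]
      exact_mod_cast Nat.totient_pos.2 hn
    have h2 : Real.exp (-Real.exp 1) ≤ (n : ℝ)⁻¹ := by
      rw [Real.exp_neg]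
      refine inv_anti₀ hn0 ?_
      rw [← Real.exp_log hn0]
      exact Real.exp_le_exp.2 h
    exact (h2.trans h1).trans (le_mul_of_one_le_right (fac_pos n).le (one_le_Log2 _))
  · refine (min_le_right _ _).trans ?_
    set y := Real.log n with hy
    have hy2 : (2 : ℝ) < y := by
      have := Real.add_one_le_exp 1
      linarith
    have hy0 : 0 < y := by linarith
    have hly : 1 ≤ Real.log y := by
      rw [Real.le_log_iff_exp_le hy0]
      exact h.le
    have hn1 : (1 : ℝ) < n := by
      by_contra hcon
      have := Real.log_nonpos hn0.le (not_lt.1 hcon)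
      linarith
    set Y := ⌊y⌋₊ with hYdef
    have hY2 : 2 ≤ Y := Nat.le_floor (by exact_mod_cast hy2.le)
    have hYy : (Y : ℝ) ≤ y := Nat.floor_le hy0.le
    have hmem := fun {p : ℕ} (hp : p.Prime) => one_sub_inv_prime_mem hp
    have hsplit : fac n = (∏ p ∈ n.primeFactors with p ≤ Y, (1 - (p : ℝ)⁻¹)) *
        ∏ p ∈ n.primeFactors with ¬ p ≤ Y, (1 - (p : ℝ)⁻¹) :=
      (Finset.prod_filter_mul_prod_filter_not _ _ _).symm
    have hfirst : (C * Real.log y)⁻¹ ≤ ∏ p ∈ n.primeFactors with p ≤ Y, (1 - (p : ℝ)⁻¹) := by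
      have hPpos : 0 < ∏ p ∈ primesUpTo Y, (1 - (p : ℝ)⁻¹)⁻¹ :=
        Finset.prod_pos fun p hp => inv_pos.2 (hmem (mem_primesUpTo.1 hp).2).1
      have h1 : (C * Real.log y)⁻¹ ≤ (∏ p ∈ primesUpTo Y, (1 - (p : ℝ)⁻¹)⁻¹)⁻¹ := by
        refine inv_anti₀ hPpos ((hCb Y hY2).trans ?_)
        refine mul_le_mul_of_nonneg_left (Real.log_le_log ?_ hYy) hC.le
        exact_mod_cast (by omega : 0 < Y)
      rw [Finset.prod_inv_distrib, inv_inv] at h1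
      refine h1.trans ?_
      refine Finset.prod_le_prod_of_subset_of_le_one (fun p hp => ?_) (fun p hp => ?_)
        fun p hp _ => ?_
      · obtain ⟨h1, h2⟩ := Finset.mem_filter.1 hp
        exact mem_primesUpTo.2 ⟨h2, Nat.prime_of_mem_primeFactors h1⟩
      · exact (hmem (mem_primesUpTo.1 hp).2).1.le
      · exact (hmem (mem_primesUpTo.1 hp).2).2
    set S := n.primeFactors.filter fun p => ¬ p ≤ Y with hS
    have hSy : ∀ p ∈ S, y ≤ p := fun p hp => by
      have := (Finset.mem_filter.1 hp).2
      exact (Nat.lt_of_floor_lt (not_le.1 this)).le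
    have hk : (S.card : ℝ) ≤ y := by
      have h1 : y ^ S.card ≤ n := by
        calc y ^ S.card = ∏ p ∈ S, y := by rw [Finset.prod_const]
          _ ≤ ∏ p ∈ S, (p : ℝ) := Finset.prod_le_prod (fun _ _ => hy0.le) hSy
          _ = ((∏ p ∈ S, p : ℕ) : ℝ) := by push_cast; rfl
          _ ≤ n := by
            exact_mod_cast Nat.le_of_dvd hn ((Finset.prod_dvd_prod_of_subset _ _ _
              (Finset.filter_subset _ _)).trans (Nat.prod_primeFactors_dvd n))
      have h2 := Real.log_le_log (pow_pos hy0 _) h1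
      rw [Real.log_pow] at h2
      nlinarith [(Nat.cast_nonneg S.card : (0 : ℝ) ≤ S.card)]
    have hsecond : Real.exp (-3) ≤ ∏ p ∈ S, (1 - (p : ℝ)⁻¹) := by
      calc Real.exp (-3) ≤ Real.exp (S.card • (-3 / y)) := by
            refine Real.exp_le_exp.2 ?_
            rw [nsmul_eq_mul, ← mul_div_assoc, le_div_iff₀ hy0]
            linarith
        _ = ∏ p ∈ S, Real.exp (-3 / y) := by
            rw [Finset.prod_const, ← Real.exp_nat_mul, nsmul_eq_mul]
        _ ≤ _ := Finset.prod_le_prod (fun _ _ => (Real.exp_pos _).le) fun p hp => by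
            have hpp := Nat.prime_of_mem_primeFactors (Finset.mem_filter.1 hp).1
            have hp1 : (1 : ℝ) ≤ p := by exact_mod_cast hpp.one_le
            have h1 := inv_one_sub_inv_le_exp hpp.two_le
            have h2 := inv_anti₀ (inv_pos.2 (hmem hpp).1) h1
            rw [inv_inv, ← Real.exp_neg] at h2
            refine le_trans (Real.exp_le_exp.2 ?_) h2
            have h3 : ((p : ℝ) ^ 2)⁻¹ ≤ (p : ℝ)⁻¹ := by
              refine inv_anti₀ (by linarith) ?_
              nlinarith
            have h4 : (p : ℝ)⁻¹ ≤ y⁻¹ := inv_anti₀ hy0 (hSy p hp)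
            rw [div_eq_mul_inv]
            linarith
    rw [hsplit]
    have hL := log_log_le_Log2 hn1
    rw [← hy] at hL
    have hCl : 0 < C * Real.log y := by positivity
    calc C⁻¹ * Real.exp (-3) = (C * Real.log y)⁻¹ * Real.exp (-3) * Real.log y := by
          field_simp
      _ ≤ _ := mul_le_mul (mul_le_mul hfirst hsecond (Real.exp_pos _).le
          ((inv_pos.2 hCl).le.trans hfirst)) hL (by linarith) (mul_nonneg
            ((inv_pos.2 hCl).le.trans hfirst) ((Real.exp_pos _).le.trans hsecond))

/-- Integers coprime to `m`, weighted by `n / φ n`. -/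
noncomputable def sieveWeight (m c : ℕ) : ℝ := if c.Coprime m then (fac c)⁻¹ else 0

lemma sieveWeight_nonneg (m c : ℕ) : 0 ≤ sieveWeight m c := by
  unfold sieveWeight
  split_ifs
  · exact inv_nonneg.2 (fac_pos c).le
  · exact le_rfl

lemma sieveWeight_mul_of_coprime (m : ℕ) {a b : ℕ} (h : a.Coprime b) :
    sieveWeight m (a * b) = sieveWeight m a * sieveWeight m b := by
  unfold sieveWeight
  rw [fac_mul_of_coprime h, mul_inv]
  have hab : (a * b).Coprime m ↔ a.Coprime m ∧ b.Coprime m := Nat.coprime_mul_iff_left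
  by_cases ha : a.Coprime m
  · by_cases hb : b.Coprime m
    · rw [if_pos (hab.2 ⟨ha, hb⟩), if_pos ha, if_pos hb]
    · rw [if_neg fun h => hb (hab.1 h).2, if_neg hb, mul_zero]
  · rw [if_neg fun h => ha (hab.1 h).1, if_neg ha, zero_mul]

lemma sieveWeight_prime_pow {m p : ℕ} (hp : p.Prime) (k : ℕ) :
    sieveWeight m (p ^ k) = if k = 0 then 1 else if p ∣ m then 0 else (1 - (p : ℝ)⁻¹)⁻¹ := by
  unfold sieveWeight
  rw [fac_prime_pow hp]
  by_cases hk : k = 0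
  · simp [hk]
  · have h : (p ^ k).Coprime m ↔ ¬ p ∣ m := by
      rw [Nat.coprime_pow_left_iff (Nat.pos_of_ne_zero hk), hp.coprime_iff_not_dvd]
    rw [if_neg hk, if_neg hk]
    by_cases hpm : p ∣ m
    · rw [if_neg fun h' => h.1 h' hpm, if_pos hpm]
    · rw [if_pos (h.2 hpm), if_neg hpm]

lemma inv_fac_mul_le {d k : ℕ} (hd : IsPrimePow d) : (fac (d * k))⁻¹ ≤ 2 * (fac k)⁻¹ := by
  obtain ⟨p, j, hp, hj, rfl⟩ := hd
  have hp := hp.nat_prime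
  rcases eq_or_ne k 0 with rfl | hk
  · simp only [mul_zero]
    have := inv_pos.2 (fac_pos 0)
    linarith
  have h1 : fac k * (1 - (p : ℝ)⁻¹) ≤ fac (p ^ j * k) := by
    unfold fac
    rw [Nat.primeFactors_mul (pow_ne_zero _ hp.ne_zero) hk, Nat.primeFactors_prime_pow hj.ne' hp]
    by_cases h : p ∈ k.primeFactors
    · rw [Finset.union_eq_right.2 (Finset.singleton_subset_iff.2 h)]
      exact mul_le_of_le_one_right (fac_pos k).le (one_sub_inv_prime_mem hp).2
    · rw [Finset.prod_union (Finset.disjoint_singleton_left.2 h), Finset.prod_singleton, mul_comm]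
  have h2 : (2 : ℝ)⁻¹ ≤ 1 - (p : ℝ)⁻¹ := by
    have : (p : ℝ)⁻¹ ≤ 2⁻¹ := inv_anti₀ (by norm_num) (by exact_mod_cast hp.two_le)
    linarith
  have hk0 := fac_pos k
  calc _ ≤ (fac k * 2⁻¹)⁻¹ := inv_anti₀ (by positivity)
        ((mul_le_mul_of_nonneg_left h2 hk0.le).trans h1)
    _ = _ := by rw [mul_inv, inv_inv, mul_comm]

lemma sieveWeight_mul_vonMangoldt_le (m d k : ℕ) :
    ArithmeticFunction.vonMangoldt d * sieveWeight m (d * k) ≤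
      ArithmeticFunction.vonMangoldt d * (2 * sieveWeight m k) := by
  by_cases hd : IsPrimePow d
  · refine mul_le_mul_of_nonneg_left ?_ ArithmeticFunction.vonMangoldt_nonneg
    unfold sieveWeight
    by_cases h : (d * k).Coprime m
    · rw [if_pos h, if_pos (Nat.coprime_mul_iff_left.1 h).2]
      exact inv_fac_mul_le hd
    · rw [if_neg h]
      have := sieveWeight_nonneg m k
      unfold sieveWeight at this
      linarith
  · rw [ArithmeticFunction.vonMangoldt_eq_zero_iff.2 hd, zero_mul, zero_mul]

lemma log_mul_sum_sieveWeight_le (m : ℕ) {N : ℕ} (hN : 1 ≤ N) :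
    Real.log N * ∑ c ∈ Finset.Ioc 0 N, sieveWeight m c ≤
      13 * N * ∑ c ∈ Finset.Ioc 0 N, sieveWeight m c / c := by
  have hN0 : (0 : ℝ) < N := by exact_mod_cast hN
  have h1 : ∑ c ∈ Finset.Ioc 0 N, sieveWeight m c * Real.log (N / c) ≤
      N * ∑ c ∈ Finset.Ioc 0 N, sieveWeight m c / c := by
    rw [Finset.mul_sum]
    refine Finset.sum_le_sum fun c hc => ?_
    have hc0 : (0 : ℝ) < c := by exact_mod_cast (Finset.mem_Ioc.1 hc).1
    have : Real.log (N / c) ≤ N / c := (Real.log_le_self (by positivity))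
    calc _ ≤ sieveWeight m c * (N / c) := mul_le_mul_of_nonneg_left this (sieveWeight_nonneg m c)
      _ = _ := by ring
  have h2 : ∑ c ∈ Finset.Ioc 0 N, sieveWeight m c * Real.log c ≤
      12 * N * ∑ c ∈ Finset.Ioc 0 N, sieveWeight m c / c := by
    have hdiv : ∀ c ∈ Finset.Ioc 0 N, sieveWeight m c * Real.log c =
        ∑ x ∈ Finset.Ioc 0 N ×ˢ Finset.Ioc 0 N, if x.1 * x.2 = c then
          ArithmeticFunction.vonMangoldt x.1 * sieveWeight m (x.1 * x.2) else 0 := by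
      intro c hc
      obtain ⟨hc0, hcN⟩ := Finset.mem_Ioc.1 hc
      rw [← ArithmeticFunction.vonMangoldt_sum, Finset.mul_sum, ← Finset.sum_filter,
        ← Nat.divisorsAntidiagonal_eq_prod_filter_of_le hc0.ne' hcN,
        Nat.sum_divisorsAntidiagonal
          (fun a b => ArithmeticFunction.vonMangoldt a * sieveWeight m (a * b))]
      refine Finset.sum_congr rfl fun d hd => ?_
      rw [Nat.mul_div_cancel' (Nat.dvd_of_mem_divisors hd), mul_comm]
    rw [Finset.sum_congr rfl hdiv, Finset.sum_comm]
    calc _ ≤ ∑ x ∈ Finset.Ioc 0 N ×ˢ Finset.Ioc 0 N, if x.1 * x.2 ≤ N then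
          ArithmeticFunction.vonMangoldt x.1 * (2 * sieveWeight m x.2) else 0 := by
          refine Finset.sum_le_sum fun x hx => ?_
          obtain ⟨hx1, hx2⟩ := Finset.mem_product.1 hx
          rw [Finset.sum_ite_eq]
          have := Nat.mul_pos (Finset.mem_Ioc.1 hx1).1 (Finset.mem_Ioc.1 hx2).1
          by_cases h : x.1 * x.2 ≤ N
          · rw [if_pos (Finset.mem_Ioc.2 ⟨this, h⟩), if_pos h]
            exact sieveWeight_mul_vonMangoldt_le m x.1 x.2
          · rw [if_neg fun h' => h (Finset.mem_Ioc.1 h').2, if_neg h]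
      _ = ∑ k ∈ Finset.Ioc 0 N, 2 * sieveWeight m k * Chebyshev.psi (N / k) := by
          rw [Finset.sum_product_right]
          refine Finset.sum_congr rfl fun k hk => ?_
          obtain ⟨hk0, hkN⟩ := Finset.mem_Ioc.1 hk
          rw [← Finset.sum_filter, Chebyshev.psi, Nat.floor_div_natCast, Nat.floor_natCast,
            Finset.mul_sum]
          refine Finset.sum_congr ?_ fun d _ => by ring
          ext d
          simp only [Finset.mem_filter, Finset.mem_Ioc, Nat.le_div_iff_mul_le hk0]
          exact ⟨fun h => ⟨h.1.1, h.2⟩, fun h =>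
            ⟨⟨h.1, (Nat.le_mul_of_pos_right d hk0).trans h.2⟩, h.2⟩⟩
      _ ≤ _ := by
          rw [Finset.mul_sum]
          refine Finset.sum_le_sum fun k hk => ?_
          have hk0 : (0 : ℝ) < k := by exact_mod_cast (Finset.mem_Ioc.1 hk).1
          have hpsi := Chebyshev.psi_le_const_mul_self (x := N / k) (by positivity)
          have hlog4 : Real.log 4 ≤ 2 := by
            rw [show (4 : ℝ) = 2 ^ 2 by norm_num, Real.log_pow]
            have := Real.log_two_lt_d9
            push_cast
            linarith
          have hs := sieveWeight_nonneg m k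
          have hNk : (0 : ℝ) ≤ N / k := by positivity
          calc _ ≤ 2 * sieveWeight m k * ((2 + 4) * (N / k)) := by
                refine mul_le_mul_of_nonneg_left (hpsi.trans ?_) (by positivity)
                exact mul_le_mul_of_nonneg_right (by linarith) hNk
            _ = _ := by ring
  have h3 : Real.log N * ∑ c ∈ Finset.Ioc 0 N, sieveWeight m c =
      ∑ c ∈ Finset.Ioc 0 N, sieveWeight m c * Real.log c +
      ∑ c ∈ Finset.Ioc 0 N, sieveWeight m c * Real.log (N / c) := by
    rw [Finset.mul_sum, ← Finset.sum_add_distrib]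
    refine Finset.sum_congr rfl fun c hc => ?_
    have hc0 : (c : ℝ) ≠ 0 := by exact_mod_cast (Finset.mem_Ioc.1 hc).1.ne'
    rw [Real.log_div hN0.ne' hc0]
    ring
  linarith

lemma hasSum_sieveWeight_prime_pow {m p : ℕ} (hp : p.Prime) :
    HasSum (fun k : ℕ => sieveWeight m (p ^ k) / ((p ^ k : ℕ) : ℝ)) (if p ∣ m then 1 else
      (1 - (p : ℝ)⁻¹)⁻¹ * (1 - (p : ℝ)⁻¹)⁻¹ - ((1 - (p : ℝ)⁻¹)⁻¹ - 1)) := by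
  obtain ⟨h0, h1⟩ := one_sub_inv_prime_mem hp
  have hterm : ∀ k : ℕ, sieveWeight m (p ^ k) / ((p ^ k : ℕ) : ℝ) = if p ∣ m then
      (if k = 0 then 1 else 0) else (1 - (p : ℝ)⁻¹)⁻¹ * ((p : ℝ)⁻¹) ^ k -
        (if k = 0 then ((1 - (p : ℝ)⁻¹)⁻¹ - 1) else 0) := by
    intro k
    rw [sieveWeight_prime_pow hp]
    by_cases hk : k = 0
    · simp [hk]
    · simp only [hk, if_false]
      split_ifs
      · simp
      · rw [sub_zero, div_eq_mul_inv, Nat.cast_pow, inv_pow]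
  simp_rw [hterm]
  by_cases hpm : p ∣ m
  · simp only [hpm, if_true]
    exact hasSum_ite_eq 0 1
  · simp only [hpm, if_false]
    exact ((hasSum_geometric_of_lt_one (by positivity) (by linarith)).mul_left _).sub
      (hasSum_ite_eq 0 _)

lemma sum_sieveWeight_div_le (m N : ℕ) :
    ∑ c ∈ Finset.Ioc 0 N, sieveWeight m c / c ≤
      Real.exp 4 * ∏ p ∈ primesUpTo N, (if p ∣ m then 1 else (1 - (p : ℝ)⁻¹)⁻¹) := by
  obtain ⟨hs, hsum⟩ := EulerProduct.summable_and_hasSum_smoothNumbers_prod_primesBelow_tsum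
    (f := fun c : ℕ => sieveWeight m c / (c : ℝ)) (by simp [sieveWeight, fac])
    (fun {a b} h => by
      rw [sieveWeight_mul_of_coprime m h, Nat.cast_mul, mul_div_mul_comm])
    (fun {p} hp => (hasSum_sieveWeight_prime_pow hp).summable.norm) (N + 1)
  have hnn : ∀ c : ℕ, 0 ≤ sieveWeight m c / (c : ℝ) := fun c =>
    div_nonneg (sieveWeight_nonneg m c) (Nat.cast_nonneg c)
  have hset : N.succ.primesBelow = primesUpTo N := by
    ext p
    rw [Nat.mem_primesBelow, mem_primesUpTo, Nat.lt_succ_iff]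
  have h1 : ∑ c ∈ Finset.Ioc 0 N, sieveWeight m c / c ≤
      ∏ p ∈ primesUpTo N, ∑' k : ℕ, sieveWeight m (p ^ k) / ((p ^ k : ℕ) : ℝ) := by
    rw [← hset, ← Finset.sum_coe_sort (Finset.Ioc 0 N)]
    have hmem : ∀ c ∈ Finset.Ioc 0 N, c ∈ (N + 1).smoothNumbers := fun c hc => by
      obtain ⟨hc0, hcN⟩ := Finset.mem_Ioc.1 hc
      exact Nat.mem_smoothNumbers_of_lt hc0 (Nat.lt_succ_of_le hcN)
    let e : Finset.Ioc 0 N ↪ (N + 1).smoothNumbers :=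
      ⟨fun c => ⟨c.1, hmem c.1 c.2⟩, fun a b h => Subtype.ext
        (congrArg (fun z : (N + 1).smoothNumbers => (z : ℕ)) h)⟩
    have := sum_le_hasSum (Finset.univ.map e) (fun c _ => hnn c) hsum
    rwa [Finset.sum_map] at this
  refine h1.trans ?_
  calc _ ≤ ∏ p ∈ primesUpTo N, (Real.exp (2 * ((p : ℝ) ^ 2)⁻¹) *
        (if p ∣ m then 1 else (1 - (p : ℝ)⁻¹)⁻¹)) := by
        refine Finset.prod_le_prod (fun p _ => tsum_nonneg fun k => hnn (p ^ k)) fun p hp => ?_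
        have hp := (mem_primesUpTo.1 hp).2
        obtain ⟨h0, -⟩ := one_sub_inv_prime_mem hp
        rw [(hasSum_sieveWeight_prime_pow hp).tsum_eq]
        split_ifs
        · rw [mul_one]
          exact Real.one_le_exp (by positivity)
        · refine le_trans ?_ (mul_le_mul_of_nonneg_right
            (Real.add_one_le_exp (2 * ((p : ℝ) ^ 2)⁻¹)) (inv_pos.2 h0).le)
          have hp2 : (2 : ℝ) ≤ p := by exact_mod_cast hp.two_le
          have e1 : 1 - (p : ℝ)⁻¹ = (p - 1) / p := by field_simp
          have hp1 : (0 : ℝ) < p - 1 := by linarith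
          rw [e1, inv_div, ← sub_nonneg]
          have : (2 * ((p : ℝ) ^ 2)⁻¹ + 1) * (p / (p - 1)) -
              (p / (p - 1) * (p / (p - 1)) - (p / (p - 1) - 1)) =
              (p - 2) / (p * (p - 1) ^ 2) := by
            field_simp
            ring
          rw [this]
          exact div_nonneg (by linarith) (by positivity)
    _ = Real.exp (2 * ∑ p ∈ primesUpTo N, ((p : ℝ) ^ 2)⁻¹) *
        ∏ p ∈ primesUpTo N, (if p ∣ m then 1 else (1 - (p : ℝ)⁻¹)⁻¹) := by
        rw [Finset.prod_mul_distrib, ← Real.exp_sum, Finset.mul_sum]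
    _ ≤ _ := by
        refine mul_le_mul_of_nonneg_right (Real.exp_le_exp.2 ?_)
          (Finset.prod_nonneg fun p hp => ?_)
        · have := sum_inv_sq_le (primesUpTo N) fun p hp => (mem_primesUpTo.1 hp).2.ne_zero
          linarith
        · split_ifs
          · norm_num
          · exact (inv_pos.2 (one_sub_inv_prime_mem (mem_primesUpTo.1 hp).2).1).le

/-- An upper bound sieve with the multiplicative weight `c / φ c`. -/
theorem exists_sum_sieveWeight_le : ∃ C : ℝ, 0 < C ∧ ∀ m N : ℕ, 1 ≤ N →
    ∑ c ∈ Finset.Ioc 0 N, sieveWeight m c ≤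
      C * N * ∏ p ∈ primesUpTo N with p ∣ m, (1 - (p : ℝ)⁻¹) := by
  obtain ⟨C, hC, hCb⟩ := exists_prod_primesUpTo_le
  refine ⟨13 * Real.exp 4 * C + 1, by positivity, fun m N hN => ?_⟩
  rcases hN.eq_or_lt with rfl | hN2
  · have h1 : primesUpTo 1 = ∅ := Finset.eq_empty_of_forall_notMem fun p hp => by
      have := mem_primesUpTo.1 hp
      have := this.2.two_le
      omega
    have h2 : 0 < 13 * Real.exp 4 * C := by positivity
    simp [h1, sieveWeight, fac]
    positivity
  · have hl : 0 < Real.log N := Real.log_pos (by exact_mod_cast hN2)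
    have h1 := log_mul_sum_sieveWeight_le m hN
    have h2 := sum_sieveWeight_div_le m N
    have h3 := hCb N hN2
    set P := ∏ p ∈ primesUpTo N with p ∣ m, (1 - (p : ℝ)⁻¹) with hP
    have hP0 : 0 < P := Finset.prod_pos fun p hp =>
      (one_sub_inv_prime_mem (mem_primesUpTo.1 (Finset.mem_filter.1 hp).1).2).1
    have hsplit : ∏ p ∈ primesUpTo N, (if p ∣ m then 1 else (1 - (p : ℝ)⁻¹)⁻¹) =
        (∏ p ∈ primesUpTo N, (1 - (p : ℝ)⁻¹)⁻¹) * P := by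
      rw [hP, Finset.prod_filter, ← Finset.prod_mul_distrib]
      refine Finset.prod_congr rfl fun p hp => ?_
      have := (one_sub_inv_prime_mem (mem_primesUpTo.1 hp).2).1.ne'
      split_ifs
      · rw [inv_mul_cancel₀ this]
      · rw [mul_one]
    rw [hsplit] at h2
    have h4 : Real.log N * ∑ c ∈ Finset.Ioc 0 N, sieveWeight m c ≤
        Real.log N * (13 * Real.exp 4 * C * N * P) := by
      calc _ ≤ 13 * N * (Real.exp 4 * (C * Real.log N * P)) := by
            refine h1.trans (mul_le_mul_of_nonneg_left (h2.trans ?_) (by positivity))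
            exact mul_le_mul_of_nonneg_left (mul_le_mul_of_nonneg_right h3 hP0.le)
              (Real.exp_pos _).le
        _ = _ := by ring
    have h5 := le_of_mul_le_mul_left h4 hl
    have h6 : (0 : ℝ) ≤ N * P := by positivity
    linarith

open Classical in
lemma card_filter_primeFactors_le (G : ℕ → ℕ → Prop) (hG : ∀ p t, G p (t % p) ↔ G p t)
    (k : ℕ → ℝ) (hk : ∀ p, 0 ≤ k p) (n : ℕ) : n ≠ 0 →
    (∀ p ∈ n.primeFactors, (((Finset.range p).filter (G p)).card : ℝ) ≤ p * k p) →
    (((Finset.range n).filter fun t => ∀ p ∈ n.primeFactors, G p t).card : ℝ) ≤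
      n * ∏ p ∈ n.primeFactors, k p := by
  induction n using Nat.recOnPosPrimePosCoprime with
  | prime_pow p j hp hj =>
    intro _ h
    rw [Nat.primeFactors_prime_pow hj.ne' hp] at h ⊢
    simp only [Finset.mem_singleton, forall_eq, Finset.prod_singleton] at h ⊢
    obtain ⟨j, rfl⟩ : ∃ i, j = i + 1 := ⟨j - 1, by omega⟩
    have hcard : ((Finset.range (p ^ (j + 1))).filter (G p)).card ≤
        (((Finset.range p).filter (G p)) ×ˢ Finset.range (p ^ j)).card := by
      refine Finset.card_le_card_of_injOn (fun t => (t % p, t / p)) (fun t ht => ?_)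
        fun s _ t _ hst => ?_
      · obtain ⟨h1, h2⟩ := Finset.mem_filter.1 ht
        refine Finset.mem_coe.2 (Finset.mem_product.2 ⟨Finset.mem_filter.2
          ⟨Finset.mem_range.2 (Nat.mod_lt _ hp.pos), (hG p t).2 h2⟩, Finset.mem_range.2 ?_⟩)
        rw [Nat.div_lt_iff_lt_mul hp.pos, ← pow_succ]
        exact Finset.mem_range.1 h1
      · obtain ⟨h1, h2⟩ := Prod.mk.inj hst
        rw [← Nat.mod_add_div s p, ← Nat.mod_add_div t p, h1, h2]
    rw [Finset.card_product, Finset.card_range] at hcard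
    calc (((Finset.range (p ^ (j + 1))).filter (G p)).card : ℝ) ≤
          ((Finset.range p).filter (G p)).card * (p ^ j : ℕ) := by exact_mod_cast hcard
      _ ≤ p * k p * (p ^ j : ℕ) := mul_le_mul_of_nonneg_right h (Nat.cast_nonneg _)
      _ = _ := by push_cast; ring
  | zero => exact fun h => absurd rfl h
  | one => simp
  | coprime a b ha hb hab iha ihb =>
    intro _ h
    have ha0 : a ≠ 0 := by omega
    have hb0 : b ≠ 0 := by omega
    rw [hab.primeFactors_mul] at h ⊢
    have h1 := iha ha0 fun p hp => h p (Finset.mem_union_left _ hp)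
    have h2 := ihb hb0 fun p hp => h p (Finset.mem_union_right _ hp)
    have hper : ∀ n t p, p ∈ n.primeFactors → (G p (t % n) ↔ G p t) := fun n t p hp => by
      rw [← hG p (t % n), Nat.mod_mod_of_dvd _ (Nat.dvd_of_mem_primeFactors hp), hG]
    have hcard : ((Finset.range (a * b)).filter fun t =>
        ∀ p ∈ a.primeFactors ∪ b.primeFactors, G p t).card ≤
        (((Finset.range a).filter fun t => ∀ p ∈ a.primeFactors, G p t) ×ˢ
          ((Finset.range b).filter fun t => ∀ p ∈ b.primeFactors, G p t)).card := by
      refine Finset.card_le_card_of_injOn (fun t => (t % a, t % b)) (fun t ht => ?_)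
        fun s hs t ht hst => ?_
      · obtain ⟨-, h2⟩ := Finset.mem_filter.1 ht
        refine Finset.mem_coe.2 (Finset.mem_product.2 ⟨Finset.mem_filter.2
          ⟨Finset.mem_range.2 (Nat.mod_lt _ (by omega)), fun p hp => ?_⟩, Finset.mem_filter.2
          ⟨Finset.mem_range.2 (Nat.mod_lt _ (by omega)), fun p hp => ?_⟩⟩)
        · exact (hper a t p hp).2 (h2 p (Finset.mem_union_left _ hp))
        · exact (hper b t p hp).2 (h2 p (Finset.mem_union_right _ hp))
      · obtain ⟨h1, h2⟩ := Prod.mk.inj hst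
        have := (Nat.modEq_and_modEq_iff_modEq_mul hab).1 ⟨h1, h2⟩
        exact this.eq_of_lt_of_lt (Finset.mem_range.1 (Finset.mem_filter.1 hs).1)
          (Finset.mem_range.1 (Finset.mem_filter.1 ht).1)
    rw [Finset.card_product] at hcard
    rw [Finset.prod_union hab.disjoint_primeFactors]
    calc _ ≤ ((((Finset.range a).filter fun t => ∀ p ∈ a.primeFactors, G p t).card *
          ((Finset.range b).filter fun t => ∀ p ∈ b.primeFactors, G p t).card : ℕ) : ℝ) := by
          exact_mod_cast hcard
      _ ≤ (a * ∏ p ∈ a.primeFactors, k p) * (b * ∏ p ∈ b.primeFactors, k p) := by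
          rw [Nat.cast_mul]
          exact mul_le_mul h1 h2 (Nat.cast_nonneg _)
            (mul_nonneg (Nat.cast_nonneg _) (Finset.prod_nonneg fun p _ => hk p))
      _ = _ := by push_cast; ring

lemma exists_dvd_add_mul {p : ℕ} (hp : p.Prime) (a : ℤ) {u : ℕ} (hu : ¬ p ∣ u) :
    ∃ t ∈ Finset.range p, (p : ℤ) ∣ a + u * t := by
  have := Fact.mk hp
  have hu0 : (u : ZMod p) ≠ 0 := fun h => hu ((ZMod.natCast_eq_zero_iff u p).1 h)
  refine ⟨(-(a : ZMod p) / u).val, Finset.mem_range.2 (ZMod.val_lt _), ?_⟩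
  rw [← ZMod.intCast_zmod_eq_zero_iff_dvd]
  push_cast
  rw [ZMod.natCast_val, ZMod.cast_id', id_eq, mul_div_cancel₀ _ hu0, add_neg_cancel]

open Classical in
lemma card_local_le {p : ℕ} (hp : p.Prime) {u v : ℕ} (huv : u.Coprime v) (a b c : ℤ)
    (hc : (p : ℤ) ∣ a * v - b * u - c) :
    (((Finset.range p).filter fun t : ℕ => ¬ (p : ℤ) ∣ a + u * t ∧ ¬ (p : ℤ) ∣ b + v * t).card : ℝ) ≤
      p * ((1 - (p : ℝ)⁻¹) * if p ∣ u * v * c.natAbs then 1 else 1 - (p : ℝ)⁻¹) := by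
  have hp0 : (0 : ℝ) < p := by exact_mod_cast hp.pos
  set S := (Finset.range p).filter fun t : ℕ => ¬ (p : ℤ) ∣ a + u * t ∧ ¬ (p : ℤ) ∣ b + v * t
    with hS
  have hsub : ∀ B : Finset ℕ, B ⊆ Finset.range p →
      (∀ t ∈ B, (p : ℤ) ∣ a + u * t ∨ (p : ℤ) ∣ b + v * t) → (S.card : ℝ) ≤ p - B.card := by
    intro B hB hbad
    have h1 : S ⊆ Finset.range p \ B := fun t ht => by
      obtain ⟨h1, h2⟩ := Finset.mem_filter.1 ht
      refine Finset.mem_sdiff.2 ⟨h1, fun hB' => ?_⟩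
      rcases hbad t hB' with h | h
      · exact h2.1 h
      · exact h2.2 h
    have h2 := Finset.card_le_card h1
    have h3 := Finset.card_sdiff_add_card_eq_card hB
    rw [Finset.card_range] at h3
    rw [le_sub_iff_add_le]
    exact_mod_cast (by omega : S.card + B.card ≤ p)
  split_ifs with h
  · have : ∃ t ∈ Finset.range p, (p : ℤ) ∣ a + u * t ∨ (p : ℤ) ∣ b + v * t := by
      by_cases hu : p ∣ u
      · have hv : ¬ p ∣ v := fun hv => hp.one_lt.ne' (Nat.eq_one_of_dvd_coprimes huv hu hv)
        obtain ⟨t, ht, h⟩ := exists_dvd_add_mul hp b hv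
        exact ⟨t, ht, Or.inr h⟩
      · obtain ⟨t, ht, h⟩ := exists_dvd_add_mul hp a hu
        exact ⟨t, ht, Or.inl h⟩
    obtain ⟨t, ht, hbad⟩ := this
    have := hsub {t} (Finset.singleton_subset_iff.2 ht) fun s hs => by
      rwa [Finset.mem_singleton.1 hs]
    rw [Finset.card_singleton, Nat.cast_one] at this
    refine this.trans_eq ?_
    field_simp
  · have hu : ¬ p ∣ u := fun hu => h ((hu.mul_right v).mul_right _)
    have hv : ¬ p ∣ v := fun hv => h ((hv.mul_left u).mul_right _)
    have hcp : ¬ (p : ℤ) ∣ c := fun hc => h ((Int.natCast_dvd.1 hc).mul_left _)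
    obtain ⟨s, hs, hsa⟩ := exists_dvd_add_mul hp a hu
    obtain ⟨t, ht, htb⟩ := exists_dvd_add_mul hp b hv
    have hst : s ≠ t := by
      rintro rfl
      refine hcp ?_
      have e : c = (a + u * s) * v - (b + v * s) * u - (a * v - b * u - c) := by ring
      rw [e]
      exact dvd_sub (dvd_sub (hsa.mul_right _) (htb.mul_right _)) hc
    have := hsub {s, t} (Finset.insert_subset hs (Finset.singleton_subset_iff.2 ht)) fun x hx => by
      rcases Finset.mem_insert.1 hx with rfl | hx
      · exact Or.inl hsa
      · rw [Finset.mem_singleton.1 hx]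
        exact Or.inr htb
    rw [Finset.card_pair hst] at this
    refine this.trans ?_
    have : (p : ℝ) * ((1 - (p : ℝ)⁻¹) * (1 - (p : ℝ)⁻¹)) = p - 2 + (p : ℝ)⁻¹ := by
      field_simp
      ring
    rw [this]
    push_cast
    linarith [inv_pos.2 hp0]

/-- The reduced pairs `(a / q, b / r)`, `q = u * g`, `r = v * g`, whose difference is congruent to
`c / lcm q r` modulo one. -/
def reducedPairs (u v g : ℕ) (c : ℤ) : Finset (ℕ × ℕ) :=
  (Finset.range (u * g) ×ˢ Finset.range (v * g)).filter fun x =>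
    x.1.Coprime (u * g) ∧ x.2.Coprime (v * g) ∧
      ((u * v * g : ℕ) : ℤ) ∣ (x.1 : ℤ) * v - x.2 * u - c

lemma card_reducedPairs_le {u v g : ℕ} (huv : u.Coprime v) (hu : u ≠ 0) (hv : v ≠ 0) (hg : g ≠ 0)
    (c : ℤ) : ((reducedPairs u v g c).card : ℝ) ≤ g * ∏ p ∈ g.primeFactors,
      ((1 - (p : ℝ)⁻¹) * if p ∣ u * v * c.natAbs then 1 else 1 - (p : ℝ)⁻¹) := by
  classical
  have hk0 : ∀ p : ℕ, 0 ≤ (1 - (p : ℝ)⁻¹) * if p ∣ u * v * c.natAbs then 1 else 1 - (p : ℝ)⁻¹ := by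
    intro p
    have : 0 ≤ 1 - (p : ℝ)⁻¹ := by
      rw [sub_nonneg]
      rcases Nat.eq_zero_or_pos p with rfl | hp
      · simp
      · exact inv_le_one_of_one_le₀ (by exact_mod_cast hp)
    split_ifs <;> positivity
  rcases (reducedPairs u v g c).eq_empty_or_nonempty with he | ⟨⟨a₀, b₀⟩, h₀⟩
  · rw [he, Finset.card_empty, Nat.cast_zero]
    exact mul_nonneg (Nat.cast_nonneg _) (Finset.prod_nonneg fun p _ => hk0 p)
  have h₀' := (Finset.mem_filter.1 h₀).2
  simp only at h₀'
  obtain ⟨-, -, hc₀⟩ := h₀'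
  have hgL : ((g : ℕ) : ℤ) ∣ ((u * v * g : ℕ) : ℤ) := Int.natCast_dvd_natCast.2 (dvd_mul_left g _)
  set G : ℕ → ℕ → Prop := fun p t => ¬ (p : ℤ) ∣ (a₀ : ℤ) + u * t ∧ ¬ (p : ℤ) ∣ (b₀ : ℤ) + v * t
    with hGdef
  have hmod : ∀ (p t : ℕ) (x w : ℤ), (p : ℤ) ∣ x + w * (t % p : ℕ) ↔ (p : ℤ) ∣ x + w * t := by
    intro p t x w
    have e : x + w * (t : ℤ) = x + w * (t % p : ℕ) + p * (w * (t / p : ℕ)) := by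
      have h : ((t % p + p * (t / p) : ℕ) : ℤ) = t := by rw [Nat.mod_add_div]
      rw [← h]
      push_cast
      ring
    rw [e]
    exact (dvd_add_left (dvd_mul_right _ _)).symm
  have hcount := card_filter_primeFactors_le G (fun p t => by
      simp only [hGdef, hmod]) _ hk0 g hg fun p hp =>
    by
      convert card_local_le (Nat.prime_of_mem_primeFactors hp) huv a₀ b₀ c
        ((Int.natCast_dvd_natCast.2 (Nat.dvd_of_mem_primeFactors hp)).trans (hgL.trans hc₀))
  refine le_trans ?_ hcount
  -- parametrize the solutions
  have hu' : (u : ℤ) ≠ 0 := by exact_mod_cast hu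
  have hv' : (v : ℤ) ≠ 0 := by exact_mod_cast hv
  have hcop : IsCoprime (u : ℤ) (v : ℤ) := Nat.isCoprime_iff_coprime.2 huv
  have hparam : ∀ x ∈ reducedPairs u v g c, ∃ t ∈ Finset.range g,
      ((u * g : ℕ) : ℤ) ∣ a₀ + u * t - x.1 ∧ ((v * g : ℕ) : ℤ) ∣ b₀ + v * t - x.2 := by
    intro x hx
    obtain ⟨-, -, -, hcx⟩ := Finset.mem_filter.1 hx
    have hd : ((u * v * g : ℕ) : ℤ) ∣ (x.1 - a₀ : ℤ) * v - (x.2 - b₀) * u := by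
      have e : (x.1 - a₀ : ℤ) * v - (x.2 - b₀) * u =
          ((x.1 : ℤ) * v - x.2 * u - c) - ((a₀ : ℤ) * v - b₀ * u - c) := by ring
      rw [e]
      exact dvd_sub hcx hc₀
    have hdu : (u : ℤ) ∣ (x.1 - a₀ : ℤ) := by
      refine hcop.dvd_of_dvd_mul_right ?_
      have h1 : (u : ℤ) ∣ (x.1 - a₀ : ℤ) * v - (x.2 - b₀) * u :=
        (Int.natCast_dvd_natCast.2 ((dvd_mul_right u v).mul_right g)).trans hd
      exact (dvd_sub_left (dvd_mul_left _ _)).1 h1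
    have hdv : (v : ℤ) ∣ (x.2 - b₀ : ℤ) := by
      refine hcop.symm.dvd_of_dvd_mul_right ?_
      have h1 : (v : ℤ) ∣ (x.1 - a₀ : ℤ) * v - (x.2 - b₀) * u :=
        (Int.natCast_dvd_natCast.2 ((dvd_mul_left v u).mul_right g)).trans hd
      exact (dvd_sub_right (dvd_mul_left _ _)).1 h1
    obtain ⟨s, hs⟩ := hdu
    obtain ⟨s', hs'⟩ := hdv
    have hss : (g : ℤ) ∣ s - s' := by
      rw [hs, hs'] at hd
      have e : (u * s * v - v * s' * u : ℤ) = (u * v) * (s - s') := by ring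
      rw [e] at hd
      push_cast at hd
      exact (mul_dvd_mul_iff_left (mul_ne_zero hu' hv')).1 hd
    have hg' : (0 : ℤ) < g := by exact_mod_cast Nat.pos_of_ne_zero hg
    obtain ⟨t, ht⟩ := Int.eq_ofNat_of_zero_le (Int.emod_nonneg s hg'.ne')
    have hts : (g : ℤ) ∣ t - s := by
      rw [← ht]
      exact (Int.mod_modEq s g).symm.dvd
    refine ⟨t, Finset.mem_range.2 ?_, ?_, ?_⟩
    · have := Int.emod_lt_of_pos s hg'
      rw [ht] at this
      exact_mod_cast this
    · have e : (a₀ + u * t - x.1 : ℤ) = u * (t - s) := by linear_combination -hs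
      rw [e]
      push_cast
      exact mul_dvd_mul_left _ hts
    · have e : (b₀ + v * t - x.2 : ℤ) = v * ((t - s) + (s - s')) := by linear_combination -hs'
      rw [e]
      push_cast
      exact mul_dvd_mul_left _ (dvd_add hts hss)
  choose! τ hτ1 hτ2 hτ3 using hparam
  have hcard := Finset.card_le_card_of_injOn (s := reducedPairs u v g c)
    (t := (Finset.range g).filter fun t => ∀ p ∈ g.primeFactors, G p t) τ
    (fun x hx => by
      obtain ⟨-, hx1, hx2, -⟩ := Finset.mem_filter.1 hx
      refine Finset.mem_coe.2 (Finset.mem_filter.2 ⟨hτ1 x hx, fun p hp => ?_⟩)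
      have hpp := Nat.prime_of_mem_primeFactors hp
      have hpg := Nat.dvd_of_mem_primeFactors hp
      refine ⟨fun h => ?_, fun h => ?_⟩
      · have h1 : (p : ℤ) ∣ x.1 := (dvd_sub_right h).1
          ((Int.natCast_dvd_natCast.2 (hpg.mul_left u)).trans (hτ2 x hx))
        exact hpp.one_lt.ne' (Nat.eq_one_of_dvd_coprimes hx1 (Int.natCast_dvd_natCast.1 h1)
          (hpg.mul_left u))
      · have h1 : (p : ℤ) ∣ x.2 := (dvd_sub_right h).1
          ((Int.natCast_dvd_natCast.2 (hpg.mul_left v)).trans (hτ3 x hx))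
        exact hpp.one_lt.ne' (Nat.eq_one_of_dvd_coprimes hx2 (Int.natCast_dvd_natCast.1 h1)
          (hpg.mul_left v)))
    (fun x hx y hy hxy => by
      have h1 := hτ2 x hx
      have h2 := hτ3 x hx
      have h3 := hτ2 y hy
      have h4 := hτ3 y hy
      rw [hxy] at h1 h2
      have hrange := fun z (hz : z ∈ reducedPairs u v g c) =>
        Finset.mem_product.1 (Finset.mem_filter.1 hz).1
      refine Prod.ext ?_ ?_
      · refine Nat.ModEq.eq_of_lt_of_lt ?_ (Finset.mem_range.1 (hrange x hx).1)
          (Finset.mem_range.1 (hrange y hy).1)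
        rw [← Int.natCast_modEq_iff, Int.modEq_iff_dvd]
        have := dvd_sub h1 h3
        rwa [sub_sub_sub_cancel_left] at this
      · refine Nat.ModEq.eq_of_lt_of_lt ?_ (Finset.mem_range.1 (hrange x hx).2)
          (Finset.mem_range.1 (hrange y hy).2)
        rw [← Int.natCast_modEq_iff, Int.modEq_iff_dvd]
        have := dvd_sub h2 h4
        rwa [sub_sub_sub_cancel_left] at this)
  refine (Nat.cast_le.2 hcard).trans (le_of_eq ?_)
  congr

lemma fac_gcd_mul_fac_mul {q r : ℕ} (hq : q ≠ 0) (hr : r ≠ 0) :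
    fac (q.gcd r) * fac (q * r) = fac q * fac r := by
  have h := congrArg (Nat.cast (R := ℝ)) (Nat.totient_gcd_mul_totient_mul q r)
  push_cast at h
  simp only [totient_eq_mul_fac] at h
  have h1 : (q : ℝ) ≠ 0 := by exact_mod_cast hq
  have h2 : (r : ℝ) ≠ 0 := by exact_mod_cast hr
  have h3 : ((q.gcd r : ℕ) : ℝ) ≠ 0 := by exact_mod_cast Nat.gcd_ne_zero_left hq
  have h4 : ((q.gcd r : ℕ) : ℝ) * q * r ≠ 0 := mul_ne_zero (mul_ne_zero h3 h1) h2
  refine mul_left_cancel₀ h4 ?_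
  push_cast at h
  linear_combination h

lemma coprime_of_mem_reducedPairs {u v g : ℕ} (huv : u.Coprime v) {c : ℤ} {x : ℕ × ℕ}
    (hx : x ∈ reducedPairs u v g c) : c.natAbs.Coprime (u * v) := by
  obtain ⟨-, ha, hb, hc⟩ := Finset.mem_filter.1 hx
  refine Nat.Coprime.mul_right ?_ ?_
  · refine Nat.coprime_of_dvd fun p hp hpc hpu => ?_
    have h1 : (p : ℤ) ∣ (x.1 : ℤ) * v - x.2 * u - c :=
      (Int.natCast_dvd_natCast.2 ((hpu.mul_right v).mul_right g)).trans hc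
    have h2 := (dvd_sub_left (Int.natCast_dvd.2 hpc)).1 h1
    have h3 := (dvd_sub_left ((Int.natCast_dvd_natCast.2 hpu).mul_left (x.2 : ℤ))).1 h2
    have h4 : p ∣ x.1 * v := by exact_mod_cast h3
    rcases hp.dvd_mul.1 h4 with h | h
    · exact hp.one_lt.ne' (Nat.eq_one_of_dvd_coprimes ha h (hpu.mul_right g))
    · exact hp.one_lt.ne' (Nat.eq_one_of_dvd_coprimes huv hpu h)
  · refine Nat.coprime_of_dvd fun p hp hpc hpv => ?_
    have h1 : (p : ℤ) ∣ (x.1 : ℤ) * v - x.2 * u - c :=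
      (Int.natCast_dvd_natCast.2 ((hpv.mul_left u).mul_right g)).trans hc
    have h2 := (dvd_sub_left (Int.natCast_dvd.2 hpc)).1 h1
    have h3 := (dvd_sub_right ((Int.natCast_dvd_natCast.2 hpv).mul_left (x.1 : ℤ))).1 h2
    have h4 : p ∣ x.2 * u := by exact_mod_cast h3
    rcases hp.dvd_mul.1 h4 with h | h
    · exact hp.one_lt.ne' (Nat.eq_one_of_dvd_coprimes hb h (hpv.mul_right g))
    · exact hp.one_lt.ne' (Nat.eq_one_of_dvd_coprimes huv h hpv)

lemma prod_local_mul_fac_le {g m c : ℕ} (hg : g ≠ 0) (hm : m ≠ 0) (hc : c ≠ 0) :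
    (∏ p ∈ g.primeFactors, if p ∣ m * c then (1 : ℝ) else 1 - (p : ℝ)⁻¹) * (fac m * fac c) ≤
      fac (g * m) := by
  have h01 : ∀ n : ℕ, ∀ p ∈ n.primeFactors, 0 ≤ 1 - (p : ℝ)⁻¹ ∧ 1 - (p : ℝ)⁻¹ ≤ 1 :=
    fun n p hp => ⟨(one_sub_inv_prime_mem (Nat.prime_of_mem_primeFactors hp)).1.le,
      (one_sub_inv_prime_mem (Nat.prime_of_mem_primeFactors hp)).2⟩
  have h1 : fac m * fac c ≤ fac (m * c) := by
    rw [← fac_gcd_mul_fac_mul hm hc]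
    exact mul_le_of_le_one_left (fac_pos _).le (fac_le_one _)
  have h2 : (∏ p ∈ g.primeFactors, if p ∣ m * c then (1 : ℝ) else 1 - (p : ℝ)⁻¹) * fac (m * c) =
      fac (g * (m * c)) := by
    have e : (g * (m * c)).primeFactors =
        (g.primeFactors.filter fun p => ¬ p ∣ m * c) ∪ (m * c).primeFactors := by
      rw [Nat.primeFactors_mul hg (mul_ne_zero hm hc)]
      ext p
      simp only [Finset.mem_union, Finset.mem_filter, Nat.mem_primeFactors]
      have := mul_ne_zero hm hc
      tauto
    unfold fac
    rw [e, Finset.prod_union, Finset.prod_filter]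
    · congr 1
      refine Finset.prod_congr rfl fun p _ => ?_
      split_ifs <;> simp_all
    · rw [Finset.disjoint_left]
      intro p hp hp'
      exact (Finset.mem_filter.1 hp).2 (Nat.dvd_of_mem_primeFactors hp')
  calc _ ≤ (∏ p ∈ g.primeFactors, if p ∣ m * c then (1 : ℝ) else 1 - (p : ℝ)⁻¹) *
        fac (m * c) := by
        refine mul_le_mul_of_nonneg_left h1 (Finset.prod_nonneg fun p hp => ?_)
        split_ifs
        · exact zero_le_one
        · exact (h01 g p hp).1
    _ = fac (g * (m * c)) := h2
    _ ≤ fac (g * m) := fac_le_of_dvd (mul_dvd_mul_left _ (dvd_mul_right _ _))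
        (mul_ne_zero hg (mul_ne_zero hm hc))

lemma card_reducedPairs_le_sieveWeight {u v g : ℕ} (huv : u.Coprime v) (hu : u ≠ 0) (hv : v ≠ 0)
    (hg : g ≠ 0) {c : ℤ} (hc : c ≠ 0) : ((reducedPairs u v g c).card : ℝ) ≤
      g * (fac (u * g) * fac (v * g)) / fac (u * v) * sieveWeight (u * v) c.natAbs := by
  rcases (reducedPairs u v g c).eq_empty_or_nonempty with he | ⟨x, hx⟩
  · rw [he, Finset.card_empty, Nat.cast_zero]
    have := fac_pos (u * g)
    have := fac_pos (v * g)
    have := fac_pos (u * v)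
    have := sieveWeight_nonneg (u * v) c.natAbs
    positivity
  have hc' : c.natAbs ≠ 0 := Int.natAbs_ne_zero.2 hc
  refine (card_reducedPairs_le huv hu hv hg c).trans ?_
  rw [sieveWeight, if_pos (coprime_of_mem_reducedPairs huv hx), Finset.prod_mul_distrib, mul_div_assoc,
    mul_assoc (g : ℝ)]
  refine mul_le_mul_of_nonneg_left ?_ (Nat.cast_nonneg _)
  have h1 := prod_local_mul_fac_le hg (mul_ne_zero hu hv) hc'
  have h2 : fac (u * g) * fac (v * g) = fac g * fac (g * (u * v)) := by
    rw [← fac_gcd_mul_fac_mul (mul_ne_zero hu hg) (mul_ne_zero hv hg), Nat.gcd_mul_right,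
      huv.gcd_eq_one, one_mul]
    congr 1
    unfold fac
    congr 1
    rw [show u * g * (v * g) = g * (u * v) * g by ring,
      Nat.primeFactors_mul (mul_ne_zero hg (mul_ne_zero hu hv)) hg]
    refine Finset.union_eq_left.2 (Nat.primeFactors_mono (dvd_mul_right _ _)
      (mul_ne_zero hg (mul_ne_zero hu hv)))
  have h3 := fac_pos (u * v)
  have h4 := fac_pos c.natAbs
  rw [h2, mul_div_assoc, mul_assoc (fac g)]
  refine mul_le_mul_of_nonneg_left ?_ (fac_pos g).le
  rwa [← div_eq_mul_inv, div_div, le_div_iff₀ (mul_pos h3 h4)]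

/-- The reduced fractions with denominator `q`. -/
def reducedResidues (q : ℕ) : Finset ℕ := (Finset.range q).filter (Nat.Coprime · q)

lemma card_reducedResidues (q : ℕ) : ((reducedResidues q).card : ℝ) = q * fac q := by
  rw [← totient_eq_mul_fac, Nat.totient_eq_card_coprime, reducedResidues]
  simp only [Nat.coprime_comm]

open Classical in
lemma exists_card_close_pairs_le : ∃ C : ℝ, 0 < C ∧ ∀ u v g : ℕ, u.Coprime v → u ≠ 0 → v ≠ 0 → g ≠ 0 →
    u ≠ v → ∀ T : ℕ,
    (((reducedResidues (u * g) ×ˢ reducedResidues (v * g)).filter fun x =>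
      ∃ c : ℤ, c.natAbs ≤ T ∧ ((u * v * g : ℕ) : ℤ) ∣ (x.1 : ℤ) * v - x.2 * u - c).card : ℝ) ≤
    C * (g * T * (fac (u * g) * fac (v * g))) *
      ∏ p ∈ (u * v).primeFactors with T < p, (1 - (p : ℝ)⁻¹)⁻¹ := by
  obtain ⟨C, hC, hsieve⟩ := exists_sum_sieveWeight_le
  refine ⟨2 * C, by positivity, fun u v g huv hu hv hg hne T => ?_⟩
  set A := (reducedResidues (u * g) ×ˢ reducedResidues (v * g)).filter fun x =>
      ∃ c : ℤ, c.natAbs ≤ T ∧ ((u * v * g : ℕ) : ℤ) ∣ (x.1 : ℤ) * v - x.2 * u - c with hA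
  have hnz : ∀ x ∈ A, ¬ ((u * v * g : ℕ) : ℤ) ∣ (x.1 : ℤ) * v - x.2 * u - (0 : ℤ) := by
    intro x hx h
    obtain ⟨hx, -⟩ := Finset.mem_filter.1 hx
    obtain ⟨h1, h2⟩ := Finset.mem_product.1 hx
    obtain ⟨h1a, h1b⟩ := Finset.mem_filter.1 h1
    obtain ⟨h2a, h2b⟩ := Finset.mem_filter.1 h2
    have := coprime_of_mem_reducedPairs huv (x := x) (g := g) (c := 0)
      (Finset.mem_filter.2 ⟨Finset.mem_product.2 ⟨h1a, h2a⟩, h1b, h2b, h⟩)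
    rw [Int.natAbs_zero, Nat.coprime_zero_left] at this
    have h3 := Nat.eq_one_of_mul_eq_one_right this
    have h4 := Nat.eq_one_of_mul_eq_one_left this
    exact hne (h3.trans h4.symm)
  have hsub : A ⊆ (Finset.Ioc 0 T).biUnion fun c : ℕ =>
      reducedPairs u v g c ∪ reducedPairs u v g (-c) := by
    intro x hx
    have hx' := hx
    obtain ⟨hx1, c, hcT, hc⟩ := Finset.mem_filter.1 hx
    obtain ⟨h1, h2⟩ := Finset.mem_product.1 hx1
    obtain ⟨h1a, h1b⟩ := Finset.mem_filter.1 h1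
    obtain ⟨h2a, h2b⟩ := Finset.mem_filter.1 h2
    have hc0 : c ≠ 0 := by
      rintro rfl
      exact hnz x hx' hc
    refine Finset.mem_biUnion.2 ⟨c.natAbs, Finset.mem_Ioc.2
      ⟨Nat.pos_of_ne_zero (Int.natAbs_ne_zero.2 hc0), hcT⟩, Finset.mem_union.2 ?_⟩
    have hmem : x ∈ reducedPairs u v g c :=
      Finset.mem_filter.2 ⟨Finset.mem_product.2 ⟨h1a, h2a⟩, h1b, h2b, hc⟩
    rcases Int.natAbs_eq c with h | h
    · left
      rwa [← h]
    · right
      rwa [← h]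
  set K : ℝ := g * (fac (u * g) * fac (v * g)) / fac (u * v) with hK
  have hfuv := fac_pos (u * v)
  have hfu := fac_pos (u * g)
  have hfv := fac_pos (v * g)
  have hK0 : 0 ≤ K := by positivity
  have hcard : (A.card : ℝ) ≤ ∑ c ∈ Finset.Ioc 0 T, 2 * (K * sieveWeight (u * v) c) := by
    calc (A.card : ℝ) ≤ ((∑ c ∈ Finset.Ioc 0 T,
          (reducedPairs u v g c ∪ reducedPairs u v g (-c)).card : ℕ) : ℝ) :=
          Nat.cast_le.2 ((Finset.card_le_card hsub).trans Finset.card_biUnion_le)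
      _ ≤ _ := by
          push_cast
          refine Finset.sum_le_sum fun c hc => ?_
          have hc0 : (c : ℤ) ≠ 0 := by exact_mod_cast (Finset.mem_Ioc.1 hc).1.ne'
          have h1 := card_reducedPairs_le_sieveWeight huv hu hv hg hc0
          have h2 := card_reducedPairs_le_sieveWeight huv hu hv hg (neg_ne_zero.2 hc0)
          have h3 : ((reducedPairs u v g c ∪ reducedPairs u v g (-c)).card : ℝ) ≤
              (reducedPairs u v g c).card + (reducedPairs u v g (-c)).card := by
            exact_mod_cast Finset.card_union_le _ _
          simp only [Int.natAbs_neg, Int.natAbs_natCast] at h1 h2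
          linarith
  rcases Nat.eq_zero_or_pos T with rfl | hT
  · refine hcard.trans ?_
    simp
  rw [← Finset.mul_sum, ← Finset.mul_sum] at hcard
  refine hcard.trans ?_
  have h := hsieve (u * v) T hT
  have hfac : fac (u * v) = (∏ p ∈ primesUpTo T with p ∣ u * v, (1 - (p : ℝ)⁻¹)) *
      ∏ p ∈ (u * v).primeFactors with T < p, (1 - (p : ℝ)⁻¹) := by
    unfold fac
    rw [← Finset.prod_filter_mul_prod_filter_not (u * v).primeFactors (fun p => p ≤ T)]
    congr 1
    · refine Finset.prod_congr ?_ fun _ _ => rfl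
      ext p
      simp only [Finset.mem_filter, mem_primesUpTo, Nat.mem_primeFactors]
      have := mul_ne_zero hu hv
      tauto
    · simp only [not_le]
  set P₁ := ∏ p ∈ primesUpTo T with p ∣ u * v, (1 - (p : ℝ)⁻¹) with hP₁
  rw [Finset.prod_inv_distrib]
  set P₂ := ∏ p ∈ (u * v).primeFactors with T < p, (1 - (p : ℝ)⁻¹) with hP₂
  have hP₂0 : 0 < P₂ := Finset.prod_pos fun p hp =>
    (one_sub_inv_prime_mem (Nat.prime_of_mem_primeFactors (Finset.mem_filter.1 hp).1)).1
  have hP₁0 : 0 < P₁ := Finset.prod_pos fun p hp =>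
    (one_sub_inv_prime_mem (mem_primesUpTo.1 (Finset.mem_filter.1 hp).1).2).1
  calc 2 * (K * ∑ c ∈ Finset.Ioc 0 T, sieveWeight (u * v) c) ≤ 2 * (K * (C * T * P₁)) := by gcongr
    _ = _ := by
      rw [hK, hfac]
      field_simp

/-- The points of the circle within `δ` of a reduced fraction with denominator `q`. -/
def nearFractions (q : ℕ) (δ : ℝ) : Set UnitAddCircle :=
  ⋃ a ∈ reducedResidues q, Metric.closedBall (((a : ℝ) / q : ℝ) : UnitAddCircle) δ

lemma measurableSet_nearFractions (q : ℕ) (δ : ℝ) : MeasurableSet (nearFractions q δ) :=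
  Finset.measurableSet_biUnion _ fun _ _ => Metric.isClosed_closedBall.measurableSet

lemma volumeReal_closedBall_le (x : UnitAddCircle) {δ : ℝ} (hδ : 0 ≤ δ) :
    volume.real (Metric.closedBall x δ) ≤ 2 * δ := by
  rw [measureReal_def, AddCircle.volume_closedBall]
  exact (ENNReal.toReal_ofReal (le_min zero_le_one (by positivity))).trans_le (min_le_right _ _)

lemma volumeReal_closedBall_eq (x : UnitAddCircle) {δ : ℝ} (hδ : 0 ≤ δ) (hδ' : 2 * δ ≤ 1) :
    volume.real (Metric.closedBall x δ) = 2 * δ := by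
  rw [measureReal_def, AddCircle.volume_closedBall, min_eq_right hδ',
    ENNReal.toReal_ofReal (by positivity)]

lemma exists_int_of_closedBall_inter {x y δ ε : ℝ}
    (h : (Metric.closedBall (x : UnitAddCircle) δ ∩ Metric.closedBall (y : UnitAddCircle) ε).Nonempty) :
    ∃ k : ℤ, |x - y - k| ≤ δ + ε := by
  obtain ⟨z, hz1, hz2⟩ := h
  refine ⟨round (x - y), ?_⟩
  rw [← UnitAddCircle.norm_eq, AddCircle.coe_sub, ← dist_eq_norm]
  rw [Metric.mem_closedBall, dist_comm] at hz1
  exact (dist_triangle _ z _).trans (add_le_add hz1 (Metric.mem_closedBall.1 hz2))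

lemma volumeReal_nearFractions {q : ℕ} (hq : q ≠ 0) {δ : ℝ} (hδ : 0 ≤ δ) (hδ' : 2 * δ * q < 1) :
    volume.real (nearFractions q δ) = 2 * (fac q * (δ * q)) := by
  have hq0 : (0 : ℝ) < q := by exact_mod_cast Nat.pos_of_ne_zero hq
  have hq1 : (1 : ℝ) ≤ q := by exact_mod_cast Nat.pos_of_ne_zero hq
  unfold nearFractions
  rw [measureReal_biUnion_finset]
  · rw [Finset.sum_congr rfl fun a _ => volumeReal_closedBall_eq _ hδ (by nlinarith),
      Finset.sum_const, nsmul_eq_mul, card_reducedResidues]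
    ring
  · intro a ha b hb hab
    by_contra h
    obtain ⟨k, hk⟩ := exists_int_of_closedBall_inter (Set.not_disjoint_iff_nonempty_inter.1 h)
    have h1 : |((a : ℤ) - b - k * q : ℤ)| < 1 := by
      have e : (((a : ℤ) - b - k * q : ℤ) : ℝ) = ((a : ℝ) / q - b / q - k) * q := by
        push_cast
        field_simp
      have : |(((a : ℤ) - b - k * q : ℤ) : ℝ)| < 1 := by
        rw [e, abs_mul, abs_of_pos hq0]
        nlinarith
      exact_mod_cast this
    have h2 : (a : ℤ) - b - k * q = 0 := Int.abs_lt_one_iff.1 h1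
    refine hab (Nat.ModEq.eq_of_lt_of_lt (m := q) ?_
      (Finset.mem_range.1 (Finset.mem_filter.1 ha).1)
      (Finset.mem_range.1 (Finset.mem_filter.1 hb).1))
    rw [← Int.natCast_modEq_iff, Int.modEq_iff_dvd]
    exact ⟨-k, by linarith⟩
  · exact fun _ _ => Metric.isClosed_closedBall.measurableSet

open Classical in
lemma volumeReal_nearFractions_inter_le {u v g : ℕ} (hu : u ≠ 0) (hv : v ≠ 0) (hg : g ≠ 0)
    {δ ε : ℝ} (hδ : 0 ≤ δ) (hε : 0 ≤ ε) {T : ℕ} (hT : ⌊(u * v * g : ℕ) * (δ + ε)⌋₊ ≤ T) :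
    volume.real (nearFractions (u * g) δ ∩ nearFractions (v * g) ε) ≤
      ((reducedResidues (u * g) ×ˢ reducedResidues (v * g)).filter fun x =>
      ∃ c : ℤ, c.natAbs ≤ T ∧ ((u * v * g : ℕ) : ℤ) ∣ (x.1 : ℤ) * v - x.2 * u - c).card *
      (2 * min δ ε) := by
  have hu0 : (u : ℝ) ≠ 0 := by exact_mod_cast hu
  have hv0 : (v : ℝ) ≠ 0 := by exact_mod_cast hv
  have hg0 : (g : ℝ) ≠ 0 := by exact_mod_cast hg
  set A := (reducedResidues (u * g) ×ˢ reducedResidues (v * g)).filter fun x =>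
      ∃ c : ℤ, c.natAbs ≤ T ∧ ((u * v * g : ℕ) : ℤ) ∣ (x.1 : ℤ) * v - x.2 * u - c with hA
  have hsub : nearFractions (u * g) δ ∩ nearFractions (v * g) ε ⊆ ⋃ x ∈ A,
      Metric.closedBall (((x.1 : ℝ) / (u * g : ℕ) : ℝ) : UnitAddCircle) δ ∩
        Metric.closedBall (((x.2 : ℝ) / (v * g : ℕ) : ℝ) : UnitAddCircle) ε := by
    rintro z ⟨hz1, hz2⟩
    obtain ⟨a, ha, hza⟩ := Set.mem_iUnion₂.1 hz1
    obtain ⟨b, hb, hzb⟩ := Set.mem_iUnion₂.1 hz2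
    refine Set.mem_iUnion₂.2 ⟨(a, b), Finset.mem_filter.2 ⟨Finset.mem_product.2 ⟨ha, hb⟩, ?_⟩,
      hza, hzb⟩
    obtain ⟨k, hk⟩ := exists_int_of_closedBall_inter ⟨z, hza, hzb⟩
    refine ⟨(a : ℤ) * v - b * u - k * (u * v * g : ℕ), ?_, ⟨k, by ring⟩⟩
    refine le_trans (Nat.le_floor ?_) hT
    rw [Nat.cast_natAbs, Int.cast_abs]
    have e : (((a : ℤ) * v - b * u - k * (u * v * g : ℕ) : ℤ) : ℝ) =
        (u * v * g : ℕ) * ((a : ℝ) / (u * g : ℕ) - b / (v * g : ℕ) - k) := by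
      push_cast
      field_simp
    rw [e, abs_mul, Nat.abs_cast]
    exact mul_le_mul_of_nonneg_left hk (Nat.cast_nonneg _)
  refine (measureReal_mono hsub (measure_ne_top _ _)).trans ((measureReal_biUnion_finset_le _ _).trans ?_)
  rw [← nsmul_eq_mul]
  refine Finset.sum_le_card_nsmul _ _ _ fun x _ => ?_
  rw [mul_min_of_nonneg _ _ zero_le_two]
  exact le_min ((measureReal_mono Set.inter_subset_left).trans (volumeReal_closedBall_le _ hδ))
    ((measureReal_mono Set.inter_subset_right).trans (volumeReal_closedBall_le _ hε))

lemma exists_volumeReal_inter_le : ∃ C : ℝ, 0 < C ∧ ∀ u v g : ℕ, u.Coprime v → u ≠ 0 → v ≠ 0 →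
    g ≠ 0 → u ≠ v → ∀ x y : ℝ, 0 ≤ x → 0 ≤ y → ∀ T : ℕ, T = ⌊2 * max (u * y) (v * x)⌋₊ →
    volume.real (nearFractions (u * g) (x / (u * g : ℕ)) ∩ nearFractions (v * g) (y / (v * g : ℕ))) ≤
      if T = 0 then 0 else C * ((fac (u * g) * x) * (fac (v * g) * y)) *
        ∏ p ∈ (u * v).primeFactors with T < p, (1 - (p : ℝ)⁻¹)⁻¹ := by
  classical
  obtain ⟨C, hC, hcount⟩ := exists_card_close_pairs_le
  refine ⟨4 * C, by positivity, fun u v g huv hu hv hg hne x y hx hy T hT => ?_⟩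
  have hu0 : (0 : ℝ) < u := by exact_mod_cast Nat.pos_of_ne_zero hu
  have hv0 : (0 : ℝ) < v := by exact_mod_cast Nat.pos_of_ne_zero hv
  have hg0 : (0 : ℝ) < g := by exact_mod_cast Nat.pos_of_ne_zero hg
  have hδ : 0 ≤ x / (u * g : ℕ) := by positivity
  have hε : 0 ≤ y / (v * g : ℕ) := by positivity
  have hfl : ⌊((u * v * g : ℕ) : ℝ) * (x / (u * g : ℕ) + y / (v * g : ℕ))⌋₊ ≤ T := by
    rw [hT]
    refine Nat.floor_le_floor ?_
    have e : ((u * v * g : ℕ) : ℝ) * (x / (u * g : ℕ) + y / (v * g : ℕ)) = v * x + u * y := by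
      push_cast
      field_simp
    rw [e]
    linarith [le_max_left (u * y) (v * x), le_max_right (u * y) (v * x)]
  refine (volumeReal_nearFractions_inter_le hu hv hg hδ hε hfl).trans ?_
  have hmin0 : 0 ≤ 2 * min (x / (u * g : ℕ)) (y / (v * g : ℕ)) := by positivity
  refine (mul_le_mul_of_nonneg_right (hcount u v g huv hu hv hg hne T) hmin0).trans ?_
  split_ifs with h0
  · simp [h0]
  have hTle : (T : ℝ) ≤ 2 * max (u * y) (v * x) := by
    rw [hT]
    exact Nat.floor_le (by positivity)
  have key : (g * T : ℝ) * (2 * min (x / (u * g : ℕ)) (y / (v * g : ℕ))) ≤ 4 * (x * y) := by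
    calc _ ≤ (g * (2 * max (u * y) (v * x)) : ℝ) * (2 * min (x / (u * g : ℕ)) (y / (v * g : ℕ))) := by
          gcongr
      _ ≤ 4 * (x * y) := by
          rcases max_choice (u * y) (v * x) with h | h <;> rw [h]
          · calc _ ≤ (g * (2 * (u * y)) : ℝ) * (2 * (x / (u * g : ℕ))) := by
                  gcongr
                  exact min_le_left _ _
              _ = _ := by
                  push_cast
                  field_simp
                  ring
          · calc _ ≤ (g * (2 * (v * x)) : ℝ) * (2 * (y / (v * g : ℕ))) := by
                  gcongr
                  exact min_le_right _ _
              _ = _ := by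
                  push_cast
                  field_simp
                  ring
  set P := ∏ p ∈ (u * v).primeFactors with T < p, (1 - (p : ℝ)⁻¹)⁻¹ with hP
  have hP0 : 0 ≤ P := Finset.prod_nonneg fun p hp => inv_nonneg.2
    (one_sub_inv_prime_mem (Nat.prime_of_mem_primeFactors (Finset.mem_filter.1 hp).1)).1.le
  have h1 := fac_pos (u * g)
  have h2 := fac_pos (v * g)
  have := mul_le_mul_of_nonneg_left key (by positivity : 0 ≤ C * (fac (u * g) * fac (v * g)) * P)
  linarith

lemma prime_dvd_cofactors_iff {u v g : ℕ} (huv : u.Coprime v) (hu : u ≠ 0) (hv : v ≠ 0) (hg : g ≠ 0)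
    {p : ℕ} (hp : p.Prime) :
    p ∣ u * v ↔ (u * g).factorization p ≠ (v * g).factorization p := by
  rw [Nat.factorization_mul hu hg, Nat.factorization_mul hv hg, Finsupp.add_apply,
    Finsupp.add_apply, Ne, add_left_inj, hp.dvd_mul]
  have h1 := hp.dvd_iff_one_le_factorization hu
  have h2 := hp.dvd_iff_one_le_factorization hv
  have h3 : ¬ (p ∣ u ∧ p ∣ v) := fun h => hp.one_lt.ne' (Nat.eq_one_of_dvd_coprimes huv h.1 h.2)
  omega

lemma exp_le_add_exp_mul {x T : ℝ} (hT : 1 ≤ T) :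
    Real.exp x ≤ Real.exp 1 + Real.exp (-(T - 1)) * Real.exp (T * x) := by
  rcases le_total x 1 with h | h
  · exact (Real.exp_le_exp.2 h).trans (le_add_of_nonneg_right (by positivity))
  · rw [← Real.exp_add]
    refine le_trans (Real.exp_le_exp.2 ?_) (le_add_of_nonneg_left (by positivity))
    nlinarith

open Classical in
lemma prod_inv_one_sub_le {u v g : ℕ} (huv : u.Coprime v) (hu : u ≠ 0) (hv : v ≠ 0) (hg : g ≠ 0)
    {U : Finset ℕ} (hU : ∀ p ∈ U, p.Prime) (huU : (u * g).primeFactors ⊆ U)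
    (hvU : (v * g).primeFactors ⊆ U) {T : ℕ} (hT : 1 ≤ T) :
    ∏ p ∈ (u * v).primeFactors with T < p, (1 - (p : ℝ)⁻¹)⁻¹ ≤
      Real.exp 1 + Real.exp (-((T : ℝ) - 1)) *
        ∏ p ∈ U, if (u * g).factorization p = (v * g).factorization p then 1
          else primeWeight T p := by
  set S := (u * v).primeFactors.filter fun p => T < p with hS
  have h1 : ∏ p ∈ S, (1 - (p : ℝ)⁻¹)⁻¹ ≤ Real.exp (∑ p ∈ S, 2 / (p : ℝ)) := by
    rw [Real.exp_sum]
    refine Finset.prod_le_prod (fun p hp => inv_nonneg.2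
      (one_sub_inv_prime_mem (Nat.prime_of_mem_primeFactors (Finset.mem_filter.1 hp).1)).1.le)
      fun p hp => ?_
    have hpp := Nat.prime_of_mem_primeFactors (Finset.mem_filter.1 hp).1
    have hp2 : (2 : ℝ) ≤ p := by exact_mod_cast hpp.two_le
    refine (inv_one_sub_inv_le_exp hpp.two_le).trans (Real.exp_le_exp.2 ?_)
    rw [← sub_nonneg]
    have e : 2 / (p : ℝ) - ((p : ℝ)⁻¹ + 2 * ((p : ℝ) ^ 2)⁻¹) = (p - 2) / p ^ 2 := by
      field_simp
      ring
    rw [e]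
    exact div_nonneg (by linarith) (by positivity)
  have hT' : (1 : ℝ) ≤ T := by exact_mod_cast hT
  refine h1.trans ((exp_le_add_exp_mul hT').trans ?_)
  gcongr
  rw [Finset.mul_sum, Real.exp_sum]
  refine le_of_eq ?_
  have hsub : S ⊆ U := by
    intro p hp
    have hp := (Finset.mem_filter.1 hp).1
    rw [Nat.primeFactors_mul hu hv, Finset.mem_union] at hp
    rcases hp with h | h
    · exact huU (Nat.primeFactors_mono (dvd_mul_right u g) (mul_ne_zero hu hg) h)
    · exact hvU (Nat.primeFactors_mono (dvd_mul_right v g) (mul_ne_zero hv hg) h)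
  rw [← Finset.prod_subset hsub]
  · refine Finset.prod_congr rfl fun p hp => ?_
    obtain ⟨hp1, hp2⟩ := Finset.mem_filter.1 hp
    rw [if_neg ((prime_dvd_cofactors_iff huv hu hv hg (Nat.prime_of_mem_primeFactors hp1)).1
      (Nat.dvd_of_mem_primeFactors hp1)), primeWeight, if_pos hp2]
    congr 1
    ring
  · intro p hp hpS
    split_ifs with h
    · rfl
    · have := (prime_dvd_cofactors_iff huv hu hv hg (hU p hp)).2 h
      rw [primeWeight, if_neg]
      exact fun hlt => hpS (Finset.mem_filter.2
        ⟨Nat.mem_primeFactors.2 ⟨hU p hp, this, mul_ne_zero hu hv⟩, hlt⟩)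

lemma exists_sum_exp_mul_sqrt_le : ∃ K : ℝ, 0 < K ∧ ∀ M : ℕ,
    ∑ t ∈ Finset.Icc 1 M, Real.exp (-((t : ℝ) - 1)) * √t ≤ K := by
  have hs := (Real.summable_pow_mul_exp_neg_nat_mul 1 one_pos).mul_left (Real.exp 1)
  refine ⟨(∑' n : ℕ, Real.exp 1 * ((n : ℝ) ^ 1 * Real.exp (-1 * n))) + 1, ?_, fun M => ?_⟩
  · have : 0 ≤ ∑' n : ℕ, Real.exp 1 * ((n : ℝ) ^ 1 * Real.exp (-1 * n)) :=
      tsum_nonneg fun n => by positivity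
    linarith
  · refine le_trans (Finset.sum_le_sum fun t ht => ?_)
      ((hs.sum_le_tsum (Finset.Icc 1 M) fun n _ => by positivity).trans
        (le_add_of_nonneg_right zero_le_one))
    have ht : (1 : ℝ) ≤ t := by exact_mod_cast (Finset.mem_Icc.1 ht).1
    have h1 : √(t : ℝ) ≤ t := by
      rw [Real.sqrt_le_left (by linarith)]
      nlinarith
    rw [show -((t : ℝ) - 1) = 1 + -1 * t by ring, Real.exp_add, pow_one, mul_assoc,
      mul_comm (t : ℝ)]
    gcongr

theorem exists_sum_volumeReal_inter_le : ∃ C : ℝ, 0 < C ∧ ∀ ψ : ℕ → ℝ, (∀ q, 0 ≤ ψ q) →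
    ∀ Z : Finset ℕ, (∀ q ∈ Z, q ≠ 0) →
    ∑ q ∈ Z, ∑ r ∈ Z, (if q = r then 0 else
      volume.real (nearFractions q (ψ q / q) ∩ nearFractions r (ψ r / r))) ≤
      C * ((∑ q ∈ Z, fac q * ψ q) ^ 2 + (∑ q ∈ Z, fac q * ψ q) ^ (3 / 2 : ℝ)) := by
  classical
  obtain ⟨C₁, hC₁, hinter⟩ := exists_volumeReal_inter_le
  obtain ⟨C₂, hC₂, hlevel⟩ := exists_level_bound
  obtain ⟨K, hK, hKs⟩ := exists_sum_exp_mul_sqrt_le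
  refine ⟨C₁ * (Real.exp 1 + C₂ * K), by positivity, fun ψ hψ Z hZ => ?_⟩
  set f : ℕ → ℝ := fun q => fac q * ψ q with hf
  have hf0 : ∀ q, 0 ≤ f q := fun q => mul_nonneg (fac_pos q).le (hψ q)
  set F := ∑ q ∈ Z, f q with hF
  have hF0 : 0 ≤ F := Finset.sum_nonneg fun q _ => hf0 q
  set U := Z.biUnion Nat.primeFactors with hUdef
  have hU : ∀ p ∈ U, p.Prime := fun p hp => by
    obtain ⟨q, -, h⟩ := Finset.mem_biUnion.1 hp
    exact Nat.prime_of_mem_primeFactors h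
  have hZU : ∀ q ∈ Z, q.primeFactors ⊆ U := fun q hq => Finset.subset_biUnion_of_mem _ hq
  let X : ℕ → ℕ → ℕ := fun q r =>
    ⌊2 * max (((q / q.gcd r : ℕ) : ℝ) * ψ r) (((r / q.gcd r : ℕ) : ℝ) * ψ q)⌋₊
  let M := Z.sup fun q => Z.sup fun r => X q r
  let W : ℕ → ℕ → ℕ → ℝ := fun T q r =>
    if q * ψ r ≤ T * (q.gcd r : ℕ) ∧ r * ψ q ≤ T * (q.gcd r : ℕ) then f q * f r *
      ∏ p ∈ U, (if q.factorization p = r.factorization p then 1 else primeWeight T p) else 0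
  have hW0 : ∀ T q r, 0 ≤ W T q r := by
    intro T q r
    have : 0 ≤ f q * f r *
        ∏ p ∈ U, (if q.factorization p = r.factorization p then 1 else primeWeight T p) := by
      refine mul_nonneg (mul_nonneg (hf0 q) (hf0 r)) (Finset.prod_nonneg fun p _ => ?_)
      split_ifs
      · exact zero_le_one
      · exact zero_le_one.trans (one_le_primeWeight T p)
    simp only [W]
    split_ifs <;> first | exact this | exact le_rfl
  have hpair : ∀ q ∈ Z, ∀ r ∈ Z, (if q = r then 0 else
      volume.real (nearFractions q (ψ q / q) ∩ nearFractions r (ψ r / r))) ≤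
      C₁ * (Real.exp 1 * (f q * f r) +
        ∑ t ∈ Finset.Icc 1 M, Real.exp (-((t : ℝ) - 1)) * W t q r) := by
    intro q hq r hr
    have hsum0 : ∀ t ∈ Finset.Icc 1 M, 0 ≤ Real.exp (-((t : ℝ) - 1)) * W t q r :=
      fun t _ => mul_nonneg (Real.exp_pos _).le (hW0 t q r)
    have hrhs : 0 ≤ C₁ * (Real.exp 1 * (f q * f r) +
        ∑ t ∈ Finset.Icc 1 M, Real.exp (-((t : ℝ) - 1)) * W t q r) :=
      mul_nonneg hC₁.le (add_nonneg (mul_nonneg (Real.exp_pos _).le (mul_nonneg (hf0 q) (hf0 r)))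
        (Finset.sum_nonneg hsum0))
    split_ifs with hqr
    · exact hrhs
    set T := X q r with hTdef
    have hTM : T ≤ M := (Finset.le_sup (f := fun r => X q r) hr).trans
      (Finset.le_sup (f := fun q => Z.sup fun r => X q r) hq)
    have hgpos : 0 < q.gcd r := Nat.gcd_pos_of_pos_left _ (Nat.pos_of_ne_zero (hZ q hq))
    have hqe : q / q.gcd r * q.gcd r = q := Nat.div_mul_cancel (Nat.gcd_dvd_left q r)
    have hre : r / q.gcd r * q.gcd r = r := Nat.div_mul_cancel (Nat.gcd_dvd_right q r)
    have huv : (q / q.gcd r).Coprime (r / q.gcd r) := Nat.coprime_div_gcd_div_gcd hgpos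
    set g := q.gcd r with hg
    set u := q / g with hu
    set v := r / g with hv
    have hu0 : u ≠ 0 := fun h => hZ q hq (by rw [← hqe, h, zero_mul])
    have hv0 : v ≠ 0 := fun h => hZ r hr (by rw [← hre, h, zero_mul])
    have hne : u ≠ v := fun h => hqr (by rw [← hqe, ← hre, h])
    have h := hinter u v g huv hu0 hv0 hgpos.ne' hne (ψ q) (ψ r) (hψ q) (hψ r) T rfl
    rw [hqe, hre] at h
    refine h.trans ?_
    split_ifs with hT0
    · exact hrhs
    have hT1 : 1 ≤ T := Nat.one_le_iff_ne_zero.2 hT0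
    have hprod := prod_inv_one_sub_le huv hu0 hv0 hgpos.ne' hU (by rw [hqe]; exact hZU q hq)
      (by rw [hre]; exact hZU r hr) hT1
    rw [hqe, hre] at hprod
    have hmax : max ((u : ℝ) * ψ r) (v * ψ q) ≤ T := by
      have h1 : 2 * max ((u : ℝ) * ψ r) (v * ψ q) < T + 1 := Nat.lt_floor_add_one _
      have h2 : (1 : ℝ) ≤ T := by exact_mod_cast hT1
      linarith
    have hg0 : (0 : ℝ) ≤ g := Nat.cast_nonneg g
    have hcond : q * ψ r ≤ T * (g : ℝ) ∧ r * ψ q ≤ T * (g : ℝ) := by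
      have hqe' : (q : ℝ) = u * g := by exact_mod_cast hqe.symm
      have hre' : (r : ℝ) = v * g := by exact_mod_cast hre.symm
      have h1 := mul_le_mul_of_nonneg_right ((le_max_left _ _).trans hmax) hg0
      have h2 := mul_le_mul_of_nonneg_right ((le_max_right _ _).trans hmax) hg0
      rw [hqe', hre']
      constructor <;> linarith
    have hWT : W T q r = f q * f r *
        ∏ p ∈ U, (if q.factorization p = r.factorization p then 1 else primeWeight T p) :=
      if_pos hcond
    calc C₁ * (f q * f r) * ∏ p ∈ (u * v).primeFactors with T < p, (1 - (p : ℝ)⁻¹)⁻¹ ≤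
          C₁ * (f q * f r) * (Real.exp 1 + Real.exp (-((T : ℝ) - 1)) *
            ∏ p ∈ U, if q.factorization p = r.factorization p then 1 else primeWeight T p) :=
          mul_le_mul_of_nonneg_left hprod (mul_nonneg hC₁.le (mul_nonneg (hf0 q) (hf0 r)))
      _ = C₁ * (Real.exp 1 * (f q * f r) + Real.exp (-((T : ℝ) - 1)) * W T q r) := by
          rw [hWT]
          ring
      _ ≤ _ := by
          gcongr
          exact Finset.single_le_sum (f := fun t : ℕ => Real.exp (-((t : ℝ) - 1)) * W t q r) hsum0
            (Finset.mem_Icc.2 ⟨hT1, hTM⟩)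
  refine (Finset.sum_le_sum fun q hq => Finset.sum_le_sum fun r hr => hpair q hq r hr).trans ?_
  have hlev : ∀ t ∈ Finset.Icc 1 M, ∑ q ∈ Z, ∑ r ∈ Z, W t q r ≤ C₂ * (√t * F ^ (3 / 2 : ℝ)) :=
    fun t ht => hlevel ψ hψ t (Finset.mem_Icc.1 ht).1 Z U hU fun q hq => ⟨hZ q hq, hZU q hq⟩
  calc ∑ q ∈ Z, ∑ r ∈ Z, C₁ * (Real.exp 1 * (f q * f r) +
        ∑ t ∈ Finset.Icc 1 M, Real.exp (-((t : ℝ) - 1)) * W t q r) =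
      C₁ * (Real.exp 1 * F ^ 2 +
        ∑ t ∈ Finset.Icc 1 M, Real.exp (-((t : ℝ) - 1)) * ∑ q ∈ Z, ∑ r ∈ Z, W t q r) := by
        have hswap : ∑ q ∈ Z, ∑ r ∈ Z, ∑ t ∈ Finset.Icc 1 M, Real.exp (-((t : ℝ) - 1)) * W t q r =
            ∑ t ∈ Finset.Icc 1 M, Real.exp (-((t : ℝ) - 1)) * ∑ q ∈ Z, ∑ r ∈ Z, W t q r := by
          simp only [Finset.mul_sum]
          rw [Finset.sum_congr rfl fun q _ => Finset.sum_comm, Finset.sum_comm]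
        rw [← hswap, pow_two, hF, Finset.sum_mul_sum]
        simp only [mul_add, Finset.mul_sum, Finset.sum_add_distrib]
    _ ≤ C₁ * (Real.exp 1 * F ^ 2 +
        ∑ t ∈ Finset.Icc 1 M, Real.exp (-((t : ℝ) - 1)) * (C₂ * (√t * F ^ (3 / 2 : ℝ)))) := by
        gcongr with t ht
        exact hlev t ht
    _ = C₁ * (Real.exp 1 * F ^ 2 + C₂ * F ^ (3 / 2 : ℝ) *
        ∑ t ∈ Finset.Icc 1 M, Real.exp (-((t : ℝ) - 1)) * √t) := by
        rw [Finset.mul_sum]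
        congr 2
        exact Finset.sum_congr rfl fun t _ => by ring
    _ ≤ C₁ * (Real.exp 1 * F ^ 2 + C₂ * F ^ (3 / 2 : ℝ) * K) := by
        have := hKs M
        gcongr
    _ ≤ _ := by
        have h1 : 0 ≤ F ^ (3 / 2 : ℝ) := by positivity
        have h2 : 0 ≤ Real.exp 1 := by positivity
        have h3 : 0 ≤ C₁ * (Real.exp 1 * F ^ (3 / 2 : ℝ)) := by positivity
        have h4 : 0 ≤ C₁ * (C₂ * K * F ^ 2) := by positivity
        linarith

/-- The Chung--Erdős inequality. -/
lemma sq_sum_measureReal_le {Ω ι : Type*} [MeasurableSpace Ω] (μ : Measure Ω) [IsFiniteMeasure μ]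
    (Z : Finset ι) (E : ι → Set Ω) (hE : ∀ i, MeasurableSet (E i)) :
    (∑ i ∈ Z, μ.real (E i)) ^ 2 ≤
      μ.real (⋃ i ∈ Z, E i) * ∑ i ∈ Z, ∑ j ∈ Z, μ.real (E i ∩ E j) := by
  set U := ⋃ i ∈ Z, E i with hU
  have hUm : MeasurableSet U := Finset.measurableSet_biUnion _ fun i _ => hE i
  have hint : ∀ A : Set Ω, MeasurableSet A → Integrable (A.indicator (1 : Ω → ℝ)) μ := fun A hA =>
    (integrable_const (1 : ℝ)).indicator hA
  have key : ∀ t : ℝ, 0 ≤ (∑ i ∈ Z, ∑ j ∈ Z, μ.real (E i ∩ E j)) * (t * t) +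
      (-2 * ∑ i ∈ Z, μ.real (E i)) * t + μ.real U := by
    intro t
    have h1 : ∀ i ∈ Z, Integrable ((E i).indicator (1 : Ω → ℝ)) μ := fun i _ => hint _ (hE i)
    have h2 : ∀ i ∈ Z, ∀ j ∈ Z, Integrable ((E i ∩ E j).indicator (1 : Ω → ℝ)) μ := fun i _ j _ =>
      hint _ ((hE i).inter (hE j))
    have h3 : Integrable (fun x => ∑ i ∈ Z, (E i).indicator (1 : Ω → ℝ) x) μ :=
      integrable_finsetSum _ h1
    have h4 : Integrable (fun x => ∑ i ∈ Z, ∑ j ∈ Z, (E i ∩ E j).indicator (1 : Ω → ℝ) x) μ :=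
      integrable_finsetSum _ fun i hi => integrable_finsetSum _ (h2 i hi)
    have h5 : ∫ x, ((∑ i ∈ Z, ∑ j ∈ Z, (E i ∩ E j).indicator (1 : Ω → ℝ) x) * (t * t) +
        (-2 * ∑ i ∈ Z, (E i).indicator (1 : Ω → ℝ) x) * t + U.indicator 1 x) ∂μ =
        (∑ i ∈ Z, ∑ j ∈ Z, μ.real (E i ∩ E j)) * (t * t) +
        (-2 * ∑ i ∈ Z, μ.real (E i)) * t + μ.real U := by
      rw [integral_add, integral_add, integral_mul_const, integral_mul_const, integral_const_mul,
        integral_finsetSum _ h1, integral_finsetSum _ fun i hi => integrable_finsetSum _ (h2 i hi),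
        integral_indicator_one hUm]
      · congr 2
        · congr 1
          refine Finset.sum_congr rfl fun i hi => ?_
          rw [integral_finsetSum _ (h2 i hi)]
          exact Finset.sum_congr rfl fun j _ => integral_indicator_one ((hE i).inter (hE j))
        · congr 2
          exact Finset.sum_congr rfl fun i _ => integral_indicator_one (hE i)
      · exact h4.mul_const _
      · exact (h3.const_mul _).mul_const _
      · exact (h4.mul_const _).add ((h3.const_mul _).mul_const _)
      · exact hint _ hUm
    rw [← h5]
    refine integral_nonneg fun x => ?_
    have h6 : ∑ i ∈ Z, ∑ j ∈ Z, (E i ∩ E j).indicator (1 : Ω → ℝ) x =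
        (∑ i ∈ Z, (E i).indicator (1 : Ω → ℝ) x) ^ 2 := by
      rw [pow_two, Finset.sum_mul_sum]
      refine Finset.sum_congr rfl fun i _ => Finset.sum_congr rfl fun j _ => ?_
      rw [Set.inter_indicator_one, Pi.mul_apply]
    simp only [h6]
    by_cases hx : x ∈ U
    · rw [Set.indicator_of_mem hx, Pi.one_apply]
      have := sq_nonneg (1 - t * ∑ i ∈ Z, (E i).indicator (1 : Ω → ℝ) x)
      simp only [Pi.zero_apply]
      linarith
    · have : ∑ i ∈ Z, (E i).indicator (1 : Ω → ℝ) x = 0 := Finset.sum_eq_zero fun i hi =>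
        Set.indicator_of_notMem (fun h => hx (Set.mem_biUnion hi h)) _
      simp [this, hx]
  have := discrim_le_zero key
  rw [discrim] at this
  linarith

lemma exists_sum_mem_Icc {f : ℕ → ℝ} (hf0 : ∀ q, 0 ≤ f q) (hf1 : ∀ q, f q ≤ 1)
    (hf : ¬ Summable f) (m : ℕ) :
    ∃ n, 1 ≤ ∑ q ∈ Finset.Ico m n, f q ∧ ∑ q ∈ Finset.Ico m n, f q ≤ 2 := by
  classical
  have hns : ¬ Summable fun i => f (i + m) := fun h => hf ((summable_nat_add_iff m).1 h)
  have htend := (not_summable_iff_tendsto_nat_atTop_of_nonneg fun i => hf0 _).1 hns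
  have hex : ∃ k, 1 ≤ ∑ i ∈ Finset.range k, f (i + m) := (htend.eventually_ge_atTop 1).exists
  have h1 := Nat.find_spec hex
  have h2 : ∀ k < Nat.find hex, _ := fun k hk => Nat.find_min hex hk
  set k := Nat.find hex
  refine ⟨m + k, ?_⟩
  rw [Finset.sum_Ico_eq_sum_range, Nat.add_sub_cancel_left]
  simp only [add_comm m]
  refine ⟨h1, ?_⟩
  rcases Nat.eq_zero_or_pos k with hk | hk
  · rw [hk]
    simp
  · obtain ⟨j, hj⟩ : ∃ j, k = j + 1 := ⟨k - 1, by omega⟩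
    rw [hj, Finset.sum_range_succ]
    have := not_le.1 (h2 j (by omega))
    linarith [hf1 (j + m)]

lemma exists_volumeReal_biUnion_ge : ∃ η : ℝ, 0 < η ∧ ∀ ψ : ℕ → ℝ, (∀ q, 0 ≤ ψ q) →
    (∀ q, ψ q < 1 / 2) → ¬ Summable (fun q => fac q * ψ q) → ∀ m : ℕ,
    η ≤ volume.real (⋃ q ∈ {q : ℕ | m ≤ q ∧ 0 < q ∧ 0 < ψ q}, nearFractions q (ψ q / q)) := by
  obtain ⟨C, hC, hoverlap⟩ := exists_sum_volumeReal_inter_le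
  refine ⟨4 / (4 + 8 * C), by positivity, fun ψ hψ0 hψ1 hns m => ?_⟩
  have hf0 : ∀ q, 0 ≤ fac q * ψ q := fun q => mul_nonneg (fac_pos q).le (hψ0 q)
  have hf1 : ∀ q, fac q * ψ q ≤ 1 := fun q =>
    mul_le_one₀ (fac_le_one q) (hψ0 q) ((hψ1 q).le.trans (by norm_num))
  obtain ⟨n, hn1, hn2⟩ := exists_sum_mem_Icc hf0 hf1 hns (m + 1)
  set Z := (Finset.Ico (m + 1) n).filter fun q => 0 < ψ q with hZ
  have hZs : ∑ q ∈ Z, fac q * ψ q = ∑ q ∈ Finset.Ico (m + 1) n, fac q * ψ q :=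
    Finset.sum_filter_of_ne fun q _ h => (hψ0 q).lt_of_ne fun h0 => h (by rw [← h0, mul_zero])
  rw [← hZs] at hn1 hn2
  set F := ∑ q ∈ Z, fac q * ψ q with hF
  have hZ0 : ∀ q ∈ Z, q ≠ 0 := fun q hq => by
    have := (Finset.mem_Ico.1 (Finset.mem_filter.1 hq).1).1
    omega
  have hmeas : ∀ q ∈ Z, volume.real (nearFractions q (ψ q / q)) = 2 * (fac q * ψ q) := by
    intro q hq
    have hq0 : (q : ℝ) ≠ 0 := by exact_mod_cast hZ0 q hq
    have e : ψ q / q * q = ψ q := div_mul_cancel₀ _ hq0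
    rw [volumeReal_nearFractions (hZ0 q hq) (div_nonneg (hψ0 q) (Nat.cast_nonneg q)), e]
    rw [mul_assoc, e]
    linarith [hψ1 q]
  have hCE := sq_sum_measureReal_le volume Z (fun q => nearFractions q (ψ q / q))
    fun q => measurableSet_nearFractions _ _
  rw [Finset.sum_congr rfl hmeas, ← Finset.mul_sum] at hCE
  have hdiag : ∑ q ∈ Z, ∑ r ∈ Z,
      volume.real (nearFractions q (ψ q / q) ∩ nearFractions r (ψ r / r)) ≤
      2 * F + C * (F ^ 2 + F ^ (3 / 2 : ℝ)) := by
    have h := hoverlap ψ hψ0 Z hZ0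
    have hsplit : ∑ q ∈ Z, ∑ r ∈ Z,
        volume.real (nearFractions q (ψ q / q) ∩ nearFractions r (ψ r / r)) =
        ∑ q ∈ Z, (volume.real (nearFractions q (ψ q / q)) + ∑ r ∈ Z, if q = r then 0 else
          volume.real (nearFractions q (ψ q / q) ∩ nearFractions r (ψ r / r))) := by
      refine Finset.sum_congr rfl fun q hq => ?_
      rw [← Finset.add_sum_erase Z _ hq, Set.inter_self, ← Finset.add_sum_erase Z
        (fun r => if q = r then 0 else
          volume.real (nearFractions q (ψ q / q) ∩ nearFractions r (ψ r / r))) hq, if_pos rfl,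
        zero_add]
      congr 1
      exact Finset.sum_congr rfl fun r hr => (if_neg (Finset.ne_of_mem_erase hr).symm).symm
    rw [hsplit, Finset.sum_add_distrib, Finset.sum_congr rfl hmeas, ← Finset.mul_sum]
    exact add_le_add le_rfl h
  have hpow : F ^ (3 / 2 : ℝ) ≤ 4 := by
    calc F ^ (3 / 2 : ℝ) ≤ F ^ (2 : ℝ) :=
          Real.rpow_le_rpow_of_exponent_le hn1 (by norm_num)
      _ = F ^ 2 := by norm_cast
      _ ≤ 4 := by nlinarith
  have hsub : (⋃ q ∈ Z, nearFractions q (ψ q / q)) ⊆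
      ⋃ q ∈ {q : ℕ | m ≤ q ∧ 0 < q ∧ 0 < ψ q}, nearFractions q (ψ q / q) := by
    refine Set.biUnion_subset_biUnion_left fun q hq => ?_
    obtain ⟨h1, h2⟩ := Finset.mem_filter.1 hq
    have := (Finset.mem_Ico.1 h1).1
    exact ⟨by omega, by omega, h2⟩
  refine le_trans ?_ (measureReal_mono hsub (measure_ne_top _ _))
  rw [div_le_iff₀ (by positivity)]
  have h0 : 0 ≤ volume.real (⋃ q ∈ Z, nearFractions q (ψ q / q)) := measureReal_nonneg
  have h4 : (4 : ℝ) ≤ (2 * F) ^ 2 := by nlinarith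
  refine h4.trans (hCE.trans (mul_le_mul_of_nonneg_left (hdiag.trans ?_) h0))
  have : F ^ 2 ≤ 4 := by nlinarith
  nlinarith

lemma ae_mem_addWellApproximable {ψ : ℕ → ℝ} (hψ0 : ∀ q, 0 ≤ ψ q) (hψ1 : ∀ q, ψ q < 1 / 2)
    (hns : ¬ Summable fun q => fac q * ψ q) :
    ∀ᵐ x : UnitAddCircle, x ∈ addWellApproximable UnitAddCircle fun q => 2 * ψ q / q := by
  obtain ⟨η, hη, hlarge⟩ := exists_volumeReal_biUnion_ge
  have hlim : Tendsto (fun q : ℕ => 2 * ψ q / q) atTop (nhds 0) := by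
    refine squeeze_zero (fun q => by have := hψ0 q; positivity) (fun q => ?_)
      tendsto_one_div_atTop_nhds_zero_nat
    exact div_le_div_of_nonneg_right (by linarith [hψ1 q]) (Nat.cast_nonneg q)
  refine (AddCircle.addWellApproximable_ae_empty_or_univ _ hlim).resolve_left fun hnot => ?_
  set S : ℕ → Set UnitAddCircle := fun m =>
    ⋃ q ∈ {q : ℕ | m ≤ q ∧ 0 < q ∧ 0 < ψ q}, nearFractions q (ψ q / q) with hS
  have hSm : ∀ m, MeasurableSet (S m) := fun m =>
    MeasurableSet.biUnion (Set.to_countable _) fun q _ => measurableSet_nearFractions _ _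
  have hSa : Antitone S := fun m n hmn => Set.biUnion_subset_biUnion_left fun q hq =>
    ⟨hmn.trans hq.1, hq.2⟩
  have hsub : ⋂ m, S m ⊆ addWellApproximable UnitAddCircle fun q => 2 * ψ q / q := by
    intro x hx
    rw [UnitAddCircle.mem_addWellApproximable_iff]
    refine Set.infinite_of_not_bddAbove fun ⟨B, hB⟩ => ?_
    obtain ⟨q, ⟨hq, hq0, hψq⟩, hxq⟩ := Set.mem_iUnion₂.1 (Set.mem_iInter.1 hx (B + 1))
    obtain ⟨a, ha, hxa⟩ := Set.mem_iUnion₂.1 hxq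
    obtain ⟨ha1, ha2⟩ := Finset.mem_filter.1 ha
    have hq' : (0 : ℝ) < q := by exact_mod_cast hq0
    have hmem : q ∈ {n : ℕ | ∃ m < n, gcd m n = 1 ∧
        ‖x - (((m : ℝ) / n : ℝ) : UnitAddCircle)‖ < 2 * ψ n / n} := by
      refine ⟨a, Finset.mem_range.1 ha1, ha2, ?_⟩
      rw [Metric.mem_closedBall, dist_eq_norm] at hxa
      refine hxa.trans_lt ?_
      gcongr
      linarith
    have := hB hmem
    omega
  have hle : ENNReal.ofReal η ≤ volume (⋂ m, S m) := by
    rw [hSa.measure_iInter (fun m => (hSm m).nullMeasurableSet) ⟨0, measure_ne_top _ _⟩]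
    refine le_iInf fun m => ?_
    rw [ENNReal.ofReal_le_iff_le_toReal (measure_ne_top _ _)]
    exact hlarge ψ hψ0 hψ1 hns m
  have hzero : volume (⋂ m, S m) = 0 := by
    refine measure_mono_null hsub ?_
    rw [ae_iff] at hnot
    simpa using hnot
  rw [hzero, nonpos_iff_eq_zero, ENNReal.ofReal_eq_zero] at hle
  exact absurd hη (not_lt.2 hle)

/-- The Duffin--Schaeffer theorem, in the form in which it is applied here. -/
theorem ae_infinite_nint_lt {ψ : ℕ → ℝ} (hψ0 : ∀ q, 0 ≤ ψ q) (hψ1 : ∀ q, ψ q < 1 / 2)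
    (hns : ¬ Summable fun q => fac q * ψ q) :
    ∀ᵐ α ∂(volume.restrict (Set.Icc (0 : ℝ) 1)), {q : ℕ | nint (α * q) < 2 * ψ q}.Infinite := by
  have h := (UnitAddCircle.measurePreserving_mk 0).quasiMeasurePreserving.ae
    (ae_mem_addWellApproximable hψ0 hψ1 hns)
  rw [zero_add, Measure.restrict_congr_set Ioc_ae_eq_Icc] at h
  filter_upwards [h] with α hα
  rw [UnitAddCircle.mem_addWellApproximable_iff] at hα
  refine hα.mono ?_
  rintro q ⟨m, hmq, -, hlt⟩
  have hq0 : (0 : ℝ) < q := by exact_mod_cast (by omega : 0 < q)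
  have hlt' : ‖((α - m / q : ℝ) : UnitAddCircle)‖ < 2 * ψ q / q := hlt
  rw [UnitAddCircle.norm_eq, lt_div_iff₀ hq0] at hlt'
  refine lt_of_le_of_lt ?_ hlt'
  refine (round_le (α * q) ((m : ℤ) + round (α - m / q) * q)).trans (le_of_eq ?_)
  have e : α * q - (((m : ℤ) + round (α - m / q) * q : ℤ) : ℝ) =
      (α - m / q - round (α - m / q : ℝ)) * q := by
    push_cast
    field_simp
    ring
  rw [e, abs_mul, abs_of_pos hq0]

lemma one_le_Log (x : ℝ) : 1 ≤ Log x := le_max_left _ _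

lemma Log_le_Log {x y : ℝ} (hx : 0 < x) (hxy : x ≤ y) : Log x ≤ Log y :=
  max_le_max le_rfl (Real.log_le_log hx hxy)

lemma Log2_le_Log2 {x y : ℝ} (hx : 0 < x) (hxy : x ≤ y) : Log2 x ≤ Log2 y :=
  Log_le_Log (zero_lt_one.trans_le (one_le_Log x)) (Log_le_Log hx hxy)

lemma Log_two_pow_le (k : ℕ) : Log (2 ^ k) ≤ max 1 (k : ℝ) := by
  refine max_le_max (le_refl (1 : ℝ)) ?_
  rw [Real.log_pow]
  exact mul_le_of_le_one_right (Nat.cast_nonneg k)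
    ((Real.log_le_sub_one_of_pos two_pos).trans (by norm_num))

lemma not_summable_inv_mul_Log : ¬ Summable fun n : ℕ => ((n : ℝ) * Log n)⁻¹ := by
  have hpos : ∀ x : ℝ, 0 < Log x := fun x => zero_lt_one.trans_le (one_le_Log x)
  rw [← summable_condensed_iff_of_nonneg
    (fun n => inv_nonneg.2 (mul_nonneg (Nat.cast_nonneg n) (hpos _).le))]
  · intro h
    refine Real.not_summable_one_div_natCast ((summable_nat_add_iff 1).1
      (Summable.of_nonneg_of_le (fun k => by positivity) (fun k => ?_)
      ((summable_nat_add_iff 1).2 h)))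
    have h1 := Log_two_pow_le (k + 1)
    rw [max_eq_right (by simp)] at h1
    have h2 := hpos (2 ^ (k + 1))
    push_cast at h1 ⊢
    rw [mul_inv, mul_inv_cancel_left₀ (by positivity), one_div]
    exact inv_anti₀ h2 h1
  · intro m n hm hmn
    have hm' : (0 : ℝ) < m := by exact_mod_cast hm
    have hmn' : (m : ℝ) ≤ n := by exact_mod_cast hmn
    exact inv_anti₀ (mul_pos hm' (hpos _))
      (mul_le_mul hmn' (Log_le_Log hm' hmn') (hpos _).le (hm'.le.trans hmn'))

lemma mul_Log_mul_Log2_le {x y : ℝ} (hx : 0 < x) (hxy : x ≤ y) :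
    x * Log x * Log2 x ≤ y * Log y * Log2 y := by
  have h1 := Log_le_Log hx hxy
  have h2 := Log2_le_Log2 hx hxy
  have h3 := one_le_Log x
  have h4 : 1 ≤ Log2 x := one_le_Log _
  have h5 := hx.trans_le hxy
  have h6 := h3.trans h1
  gcongr

lemma not_summable_inv_mul_Log_mul_Log2 :
    ¬ Summable fun n : ℕ => ((2 * n : ℝ) * Log (2 * n) * Log2 (2 * n))⁻¹ := by
  have hpos : ∀ x : ℝ, 0 < Log x := fun x => zero_lt_one.trans_le (one_le_Log x)
  have hpos2 : ∀ x : ℝ, 0 < Log2 x := fun x => hpos _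
  rw [← summable_condensed_iff_of_nonneg]
  · intro h
    refine not_summable_inv_mul_Log ((summable_nat_add_iff 1).1
      (Summable.of_nonneg_of_le (fun k => ?_) (fun k => ?_) (h.mul_left 2)))
    · have := hpos ((k + 1 : ℕ) : ℝ)
      positivity
    have h1 := Log_two_pow_le (k + 1)
    rw [max_eq_right (by simp)] at h1
    have h2 : Log2 (2 ^ (k + 1)) ≤ Log ((k + 1 : ℕ) : ℝ) := Log_le_Log (hpos _) h1
    have h3 := hpos (2 ^ (k + 1))
    have h4 := hpos2 (2 ^ (k + 1))
    have e : (2 : ℝ) * (2 ^ k * ((2 * (2 ^ k : ℕ) : ℝ) * Log (2 * (2 ^ k : ℕ)) *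
        Log2 (2 * (2 ^ k : ℕ)))⁻¹) = (Log (2 ^ (k + 1)) * Log2 (2 ^ (k + 1)))⁻¹ := by
      have : (2 : ℝ) * (2 ^ k : ℕ) = 2 ^ (k + 1) := by
        push_cast
        ring
      rw [this]
      field_simp
      ring
    rw [e]
    exact inv_anti₀ (mul_pos h3 h4) (mul_le_mul h1 h2 h4.le (Nat.cast_nonneg _))
  · intro n
    have := hpos (2 * n)
    have := hpos2 (2 * n)
    positivity
  · intro m n hm hmn
    have hm' : (0 : ℝ) < 2 * m := by exact_mod_cast (by omega : 0 < 2 * m)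
    have hmn' : (2 * m : ℝ) ≤ 2 * n := by exact_mod_cast (by omega : 2 * m ≤ 2 * n)
    exact inv_anti₀ (mul_pos (mul_pos hm' (hpos _)) (hpos2 _)) (mul_Log_mul_Log2_le hm' hmn')

lemma natCast_floor_of_nonneg {x : ℝ} (hx : 0 ≤ x) : ((⌊x⌋₊ : ℕ) : ℤ) = ⌊x⌋ := by
  rw [← Int.floor_toNat, Int.toNat_of_nonneg (Int.floor_nonneg.2 hx)]

/-- The distinct values of `⌊|a m - a n|⌋`, `1 ≤ m ≠ n ≤ N`. -/
noncomputable def flooredDiffs (a : ℕ → ℝ) (N : ℕ) : Finset ℕ :=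
  (Finset.Icc 1 N).offDiag.image fun x => ⌊|a x.1 - a x.2|⌋₊

lemma mem_flooredDiffs {a : ℕ → ℝ} {N z : ℕ} : z ∈ flooredDiffs a N ↔
    ∃ m n, 1 ≤ m ∧ m ≤ N ∧ 1 ≤ n ∧ n ≤ N ∧ m ≠ n ∧ z = ⌊|a m - a n|⌋₊ := by
  simp only [flooredDiffs, Finset.mem_image, Finset.mem_offDiag, Finset.mem_Icc, Prod.exists]
  constructor
  · rintro ⟨m, n, ⟨⟨h1, h2⟩, ⟨h3, h4⟩, h5⟩, h6⟩
    exact ⟨m, n, h1, h2, h3, h4, h5, h6.symm⟩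
  · rintro ⟨m, n, h1, h2, h3, h4, h5, h6⟩
    exact ⟨m, n, ⟨⟨h1, h2⟩, ⟨h3, h4⟩, h5⟩, h6.symm⟩

lemma flooredDiffs_mono (a : ℕ → ℝ) : Monotone (flooredDiffs a) := fun M N h z hz => by
  obtain ⟨m, n, h1, h2, h3, h4, h5⟩ := mem_flooredDiffs.1 hz
  exact mem_flooredDiffs.2 ⟨m, n, h1, h2.trans h, h3, h4.trans h, h5⟩

lemma Hcard_eq_card_flooredDiffs (a : ℕ → ℝ) (N : ℕ) : Hcard a N = (flooredDiffs a N).card := by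
  have e : {k : ℤ | ∃ m n : ℕ, 1 ≤ m ∧ m ≤ N ∧ 1 ≤ n ∧ n ≤ N ∧ m ≠ n ∧ k = ⌊|a m - a n|⌋} =
      (Nat.cast : ℕ → ℤ) '' (flooredDiffs a N : Set ℕ) := by
    ext k
    simp only [Set.mem_ofPred_eq, Set.mem_image, Finset.mem_coe, mem_flooredDiffs]
    constructor
    · rintro ⟨m, n, h1, h2, h3, h4, h5, rfl⟩
      exact ⟨_, ⟨m, n, h1, h2, h3, h4, h5, rfl⟩, natCast_floor_of_nonneg (abs_nonneg _)⟩
    · rintro ⟨_, ⟨m, n, h1, h2, h3, h4, h5, rfl⟩, rfl⟩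
      exact ⟨m, n, h1, h2, h3, h4, h5, natCast_floor_of_nonneg (abs_nonneg _)⟩
  rw [Hcard, e, Set.ncard_image_of_injective _ Nat.cast_injective, Set.ncard_coe_finset]

lemma pos_of_mem_flooredDiffs {a : ℕ → ℝ}
    (hsep : ∀ m n : ℕ, 1 ≤ m → 1 ≤ n → m ≠ n → 1 ≤ |a m - a n|) {N z : ℕ}
    (hz : z ∈ flooredDiffs a N) : 0 < z := by
  obtain ⟨m, n, h1, -, h3, -, h5, rfl⟩ := mem_flooredDiffs.1 hz
  exact Nat.floor_pos.2 (hsep m n h1 h3 h5)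

lemma card_flooredDiffs_succ_le (a : ℕ → ℝ) (N : ℕ) :
    (flooredDiffs a (N + 1)).card ≤ (flooredDiffs a N).card + N := by
  have hsub : flooredDiffs a (N + 1) ⊆ flooredDiffs a N ∪
      (Finset.Icc 1 N).image fun n => ⌊|a (N + 1) - a n|⌋₊ := by
    intro z hz
    obtain ⟨m, n, h1, h2, h3, h4, h5, rfl⟩ := mem_flooredDiffs.1 hz
    rw [Finset.mem_union, Finset.mem_image]
    rcases Nat.lt_or_eq_of_le h2 with hm | rfl
    · rcases Nat.lt_or_eq_of_le h4 with hn | rfl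
      · exact Or.inl (mem_flooredDiffs.2 ⟨m, n, h1, by omega, h3, by omega, h5, rfl⟩)
      · exact Or.inr ⟨m, Finset.mem_Icc.2 ⟨h1, by omega⟩, by rw [abs_sub_comm]⟩
    · exact Or.inr ⟨n, Finset.mem_Icc.2 ⟨h3, by omega⟩, rfl⟩
  refine (Finset.card_le_card hsub).trans ((Finset.card_union_le _ _).trans
    (Nat.add_le_add_left (Finset.card_image_le.trans ?_) _))
  simp

lemma le_card_flooredDiffs_succ {a : ℕ → ℝ}
    (hsep : ∀ m n : ℕ, 1 ≤ m → 1 ≤ n → m ≠ n → 1 ≤ |a m - a n|) (N : ℕ) :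
    N ≤ (flooredDiffs a (N + 1)).card := by
  obtain ⟨i, hi, hmin⟩ := Finset.exists_min_image (Finset.Icc 1 (N + 1)) a
    ⟨1, Finset.mem_Icc.2 ⟨le_rfl, by omega⟩⟩
  have hi' := Finset.mem_Icc.1 hi
  have hcard : ((Finset.Icc 1 (N + 1)).erase i).card = N := by
    rw [Finset.card_erase_of_mem hi, Nat.card_Icc]
    omega
  refine hcard.ge.trans ?_
  refine Finset.card_le_card_of_injOn (fun n => ⌊|a n - a i|⌋₊) (fun n hn => ?_)
    fun m hm n hn hmn => ?_
  · obtain ⟨h1, h2⟩ := Finset.mem_erase.1 hn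
    have h3 := Finset.mem_Icc.1 h2
    exact mem_flooredDiffs.2 ⟨n, i, h3.1, h3.2, hi'.1, hi'.2, h1, rfl⟩
  · by_contra hne
    have hm' := (Finset.mem_erase.1 hm).2
    have hn' := (Finset.mem_erase.1 hn).2
    have h1 := hsep m n (Finset.mem_Icc.1 hm').1 (Finset.mem_Icc.1 hn').1 hne
    have h2 : 0 ≤ a m - a i := sub_nonneg.2 (hmin m hm')
    have h3 : 0 ≤ a n - a i := sub_nonneg.2 (hmin n hn')
    simp only [abs_of_nonneg h2, abs_of_nonneg h3] at hmn
    have h4 := Nat.floor_le h2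
    have h5 := Nat.floor_le h3
    have h6 := Nat.lt_floor_add_one (a m - a i)
    have h7 := Nat.lt_floor_add_one (a n - a i)
    rw [hmn] at h4 h6
    rcases le_abs.1 h1 with h | h <;> linarith

/-- The first `N` for which `z` is a floored difference of the first `N` terms. -/
noncomputable def firstLevel (a : ℕ → ℝ) (z : ℕ) : ℕ := sInf {N | z ∈ flooredDiffs a N}

lemma mem_flooredDiffs_firstLevel {a : ℕ → ℝ} {N z : ℕ} (h : z ∈ flooredDiffs a N) :
    z ∈ flooredDiffs a (firstLevel a z) := Nat.sInf_mem (s := {N | z ∈ flooredDiffs a N}) ⟨N, h⟩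

lemma firstLevel_eq_succ {a : ℕ → ℝ} {N z : ℕ} (h : z ∈ flooredDiffs a (N + 1))
    (h' : z ∉ flooredDiffs a N) : firstLevel a z = N + 1 := by
  refine le_antisymm (Nat.sInf_le h) ?_
  by_contra hlt
  exact h' (flooredDiffs_mono a (by omega) (mem_flooredDiffs_firstLevel h))

/-- The denominator `H_N log (N / 9) log₂ (N / 9)`. -/
noncomputable def levelWeight (a : ℕ → ℝ) (N : ℕ) : ℝ :=
  (Hcard a N : ℝ) * Log ((N : ℝ) / 9) * Log2 ((N : ℝ) / 9)

lemma levelWeight_nonneg (a : ℕ → ℝ) (N : ℕ) : 0 ≤ levelWeight a N :=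
  mul_nonneg (mul_nonneg (Nat.cast_nonneg _) (zero_le_one.trans (one_le_Log _)))
    (zero_le_one.trans (one_le_Log _))

lemma sum_le_sum_inv_levelWeight {a : ℕ → ℝ}
    (hsep : ∀ m n : ℕ, 1 ≤ m → 1 ≤ n → m ≠ n → 1 ≤ |a m - a n|) (N : ℕ) :
    ∑ i ∈ Finset.Ioc 0 (flooredDiffs a N).card, ((2 * i : ℝ) * Log (2 * i) * Log2 (2 * i))⁻¹ ≤
      ∑ z ∈ flooredDiffs a N, (levelWeight a (firstLevel a z))⁻¹ := by
  induction N with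
  | zero => simp [flooredDiffs]
  | succ N ih =>
    have hsub : flooredDiffs a N ⊆ flooredDiffs a (N + 1) := flooredDiffs_mono a (Nat.le_succ N)
    have hcard := Finset.card_le_card hsub
    rw [← Finset.sum_Ioc_consecutive _ (Nat.zero_le _) hcard, ← Finset.sum_sdiff hsub,
      add_comm (∑ z ∈ flooredDiffs a (N + 1) \ flooredDiffs a N, _)]
    refine add_le_add ih ?_
    have h1 : ∀ z ∈ flooredDiffs a (N + 1) \ flooredDiffs a N,
        (levelWeight a (firstLevel a z))⁻¹ = (levelWeight a (N + 1))⁻¹ := fun z hz => by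
      rw [firstLevel_eq_succ (Finset.mem_sdiff.1 hz).1 (Finset.mem_sdiff.1 hz).2]
    rw [Finset.sum_congr rfl h1, Finset.sum_const, Finset.card_sdiff_of_subset hsub,
      ← Nat.card_Ioc]
    refine Finset.sum_le_card_nsmul _ _ _ fun i hi => ?_
    obtain ⟨hi1, hi2⟩ := Finset.mem_Ioc.1 hi
    have hN : N ≤ (flooredDiffs a N).card + 1 := by
      rcases N with _ | M
      · exact Nat.zero_le _
      · exact Nat.succ_le_succ (le_card_flooredDiffs_succ hsep M)
    have hH := card_flooredDiffs_succ_le a N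
    have hL := one_le_Log (((N + 1 : ℕ) : ℝ) / 9)
    have hL2 : 1 ≤ Log2 (((N + 1 : ℕ) : ℝ) / 9) := one_le_Log _
    have hpos : (0 : ℝ) < ((flooredDiffs a (N + 1)).card : ℝ) := by
      exact_mod_cast (by omega : 0 < (flooredDiffs a (N + 1)).card)
    unfold levelWeight
    rw [Hcard_eq_card_flooredDiffs]
    have hle1 : ((flooredDiffs a (N + 1)).card : ℝ) ≤ 2 * i := by
      exact_mod_cast (by omega : (flooredDiffs a (N + 1)).card ≤ 2 * i)
    have hle2 : (((N + 1 : ℕ) : ℝ) / 9) ≤ 2 * i := by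
      have : ((N + 1 : ℕ) : ℝ) ≤ 2 * i := by
        exact_mod_cast (by omega : N + 1 ≤ 2 * i)
      have h0 : (0 : ℝ) ≤ ((N + 1 : ℕ) : ℝ) := Nat.cast_nonneg _
      linarith
    have hN9 : (0 : ℝ) < ((N + 1 : ℕ) : ℝ) / 9 := by positivity
    have hLL := Log_le_Log hN9 hle2
    have hLL2 := Log2_le_Log2 hN9 hle2
    have hL' := hL.trans hLL
    exact inv_anti₀ (by positivity) (by gcongr)

lemma not_summable_inv_levelWeight {a : ℕ → ℝ}
    (hsep : ∀ m n : ℕ, 1 ≤ m → 1 ≤ n → m ≠ n → 1 ≤ |a m - a n|) :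
    ¬ Summable (Set.indicator (⋃ N, (flooredDiffs a N : Set ℕ)) fun z =>
      (levelWeight a (firstLevel a z))⁻¹) := by
  intro h
  set S := ⋃ N, (flooredDiffs a N : Set ℕ) with hS
  have hnn : ∀ z, 0 ≤ (levelWeight a (firstLevel a z))⁻¹ := fun z =>
    inv_nonneg.2 (levelWeight_nonneg a _)
  refine not_summable_inv_mul_Log_mul_Log2 ((summable_nat_add_iff 1).1 ?_)
  refine summable_of_sum_range_le (c := ∑' z, S.indicator (fun z =>
    (levelWeight a (firstLevel a z))⁻¹) z) (fun n => ?_) fun n => ?_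
  · have := one_le_Log (2 * ((n + 1 : ℕ) : ℝ))
    have : 1 ≤ Log2 (2 * ((n + 1 : ℕ) : ℝ)) := one_le_Log _
    positivity
  · have e : ∑ i ∈ Finset.range n, ((2 * ((i + 1 : ℕ) : ℝ)) * Log (2 * ((i + 1 : ℕ) : ℝ)) *
        Log2 (2 * ((i + 1 : ℕ) : ℝ)))⁻¹ =
        ∑ i ∈ Finset.Ioc 0 n, ((2 * i : ℝ) * Log (2 * i) * Log2 (2 * i))⁻¹ := by
      rw [Finset.range_eq_Ico, Finset.sum_Ico_add' (fun i : ℕ =>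
        ((2 * i : ℝ) * Log (2 * i) * Log2 (2 * i))⁻¹) 0 n 1]
      rfl
    rw [e]
    calc _ ≤ ∑ i ∈ Finset.Ioc 0 (flooredDiffs a (n + 1)).card,
          ((2 * i : ℝ) * Log (2 * i) * Log2 (2 * i))⁻¹ := by
          refine Finset.sum_le_sum_of_subset_of_nonneg
            (Finset.Ioc_subset_Ioc_right (le_card_flooredDiffs_succ hsep n)) fun i _ _ => ?_
          have := one_le_Log (2 * (i : ℝ))
          have : 1 ≤ Log2 (2 * (i : ℝ)) := one_le_Log _
          positivity
      _ ≤ ∑ z ∈ flooredDiffs a (n + 1), (levelWeight a (firstLevel a z))⁻¹ :=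
          sum_le_sum_inv_levelWeight hsep _
      _ = ∑ z ∈ flooredDiffs a (n + 1), S.indicator (fun z =>
          (levelWeight a (firstLevel a z))⁻¹) z := by
          refine Finset.sum_congr rfl fun z hz => ?_
          have hzS : z ∈ S := Set.mem_iUnion.2 ⟨_, hz⟩
          rw [Set.indicator_of_mem hzS]
      _ ≤ _ := h.sum_le_tsum _ fun z _ => Set.indicator_nonneg (fun z _ => hnn z) z

/-- The largest absolute floored signed difference. -/
noncomputable def maxFloorDiff (a : ℕ → ℝ) (N : ℕ) : ℤ :=
  sSup {k : ℤ | ∃ m n : ℕ, 1 ≤ m ∧ m ≤ N ∧ 1 ≤ n ∧ n ≤ N ∧ m ≠ n ∧ k = |⌊a m - a n⌋|}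

lemma le_maxFloorDiff {a : ℕ → ℝ} {N m n : ℕ} (h1 : 1 ≤ m) (h2 : m ≤ N) (h3 : 1 ≤ n) (h4 : n ≤ N)
    (h5 : m ≠ n) : |⌊a m - a n⌋| ≤ maxFloorDiff a N := by
  refine le_csSup ?_ ⟨m, n, h1, h2, h3, h4, h5, rfl⟩
  refine Set.Finite.bddAbove (Set.Finite.subset (Finset.finite_toSet
    ((Finset.Icc 1 N ×ˢ Finset.Icc 1 N).image fun x : ℕ × ℕ => |⌊a x.1 - a x.2⌋|)) ?_)
  rintro k ⟨m, n, h1, h2, h3, h4, -, rfl⟩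
  exact Finset.mem_coe.2 (Finset.mem_image.2 ⟨(m, n), Finset.mem_product.2
    ⟨Finset.mem_Icc.2 ⟨h1, h2⟩, Finset.mem_Icc.2 ⟨h3, h4⟩⟩, rfl⟩)

lemma signedFloorDeltaMin_le {a : ℕ → ℝ} {α : ℝ} {N m n : ℕ} (h1 : 1 ≤ m) (h2 : m ≤ N) (h3 : 1 ≤ n)
    (h4 : n ≤ N) (h5 : m ≠ n) : signedFloorDeltaMin a α N ≤ nint (α * (⌊a m - a n⌋ : ℝ)) := by
  refine csInf_le ⟨0, ?_⟩ ⟨m, n, h1, h2, h3, h4, h5, rfl⟩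
  rintro d ⟨m, n, -, -, -, -, -, rfl⟩
  exact abs_nonneg _

lemma exists_floor_eq_of_mem_flooredDiffs {a : ℕ → ℝ} {N z : ℕ} (hz : z ∈ flooredDiffs a N) :
    ∃ m n, 1 ≤ m ∧ m ≤ N ∧ 1 ≤ n ∧ n ≤ N ∧ m ≠ n ∧ ⌊a m - a n⌋ = (z : ℤ) := by
  obtain ⟨m, n, h1, h2, h3, h4, h5, rfl⟩ := mem_flooredDiffs.1 hz
  rcases le_total 0 (a m - a n) with h | h
  · exact ⟨m, n, h1, h2, h3, h4, h5, by rw [abs_of_nonneg h, natCast_floor_of_nonneg h]⟩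
  · refine ⟨n, m, h3, h4, h1, h2, h5.symm, ?_⟩
    rw [natCast_floor_of_nonneg (abs_nonneg _), abs_of_nonpos h, neg_sub]

lemma signedFloorDeltaMin_le_half (a : ℕ → ℝ) (α : ℝ) {N : ℕ} (hN : 2 ≤ N) :
    signedFloorDeltaMin a α N ≤ 1 / 2 :=
  (signedFloorDeltaMin_le (m := 1) (n := 2) le_rfl (by omega) (by omega) hN (by omega)).trans
    (abs_sub_round _)

theorem ae_frequently_signedFloorDeltaMin_le {a : ℕ → ℝ}
    (hsep : ∀ m n : ℕ, 1 ≤ m → 1 ≤ n → m ≠ n → 1 ≤ |a m - a n|) :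
    ∀ᵐ α ∂(volume.restrict (Set.Icc (0 : ℝ) 1)), ∃ᶠ N in atTop,
      signedFloorDeltaMin a α N ≤ 4 * Log2 (maxFloorDiff a N : ℝ) / levelWeight a N := by
  classical
  by_cases hbig : ∃ᶠ N in atTop, 1 / 2 ≤ 4 * Log2 (maxFloorDiff a N : ℝ) / levelWeight a N
  · refine Eventually.of_forall fun α => ?_
    exact (hbig.and_eventually (eventually_ge_atTop 2)).mono fun N hN =>
      (signedFloorDeltaMin_le_half a α hN.2).trans hN.1
  obtain ⟨N₁, hN₁⟩ := eventually_atTop.1 (not_frequently.1 hbig)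
  obtain ⟨c, hc, hfac⟩ := exists_fac_lower
  set S : Set ℕ := ⋃ N, (flooredDiffs a N : Set ℕ) with hS
  set w : ℕ → ℝ := fun z => (levelWeight a (firstLevel a z))⁻¹ with hw
  have hw0 : ∀ z, 0 ≤ w z := fun z => inv_nonneg.2 (levelWeight_nonneg a _)
  set R : Set ℕ := {z | z ∈ S ∧ N₁ ≤ firstLevel a z} with hR
  set ψ : ℕ → ℝ := R.indicator fun z => 2 * c * w z / fac z with hψ
  have hψ0 : ∀ z, 0 ≤ ψ z := fun z =>
    Set.indicator_nonneg (fun z _ => div_nonneg (mul_nonneg (by positivity) (hw0 z)) (fac_pos z).le) z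
  have hlevel : ∀ z ∈ S, z ∈ flooredDiffs a (firstLevel a z) := fun z hz => by
    obtain ⟨N, hN⟩ := Set.mem_iUnion.1 hz
    exact mem_flooredDiffs_firstLevel hN
  have hψle : ∀ z ∈ R, 2 * ψ z ≤
      4 * Log2 (maxFloorDiff a (firstLevel a z) : ℝ) / levelWeight a (firstLevel a z) := by
    intro z hz
    have hz1 := hlevel z hz.1
    have hzpos := pos_of_mem_flooredDiffs hsep hz1
    obtain ⟨m, n, h1, h2, h3, h4, h5, h6⟩ := exists_floor_eq_of_mem_flooredDiffs hz1
    have hB : (z : ℝ) ≤ (maxFloorDiff a (firstLevel a z) : ℝ) := by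
      have := le_maxFloorDiff (a := a) h1 h2 h3 h4 h5
      rw [h6, Nat.abs_cast] at this
      exact_mod_cast this
    have hz0 : (0 : ℝ) < z := by exact_mod_cast hzpos
    have hf := fac_pos z
    have hcz : c / fac z ≤ Log2 (maxFloorDiff a (firstLevel a z) : ℝ) := by
      rw [div_le_iff₀ hf, mul_comm]
      exact (hfac z hzpos).trans (mul_le_mul_of_nonneg_left (Log2_le_Log2 hz0 hB) hf.le)
    rw [hψ, Set.indicator_of_mem hz, div_eq_mul_inv (4 * _)]
    calc 2 * (2 * c * w z / fac z) = 4 * (c / fac z) * w z := by ring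
      _ ≤ _ := mul_le_mul_of_nonneg_right (by linarith) (hw0 z)
  have hψ1 : ∀ z, ψ z < 1 / 2 := by
    intro z
    by_cases hz : z ∈ R
    · have h1 := hψle z hz
      have h2 := not_le.1 (hN₁ _ hz.2)
      linarith
    · rw [hψ, Set.indicator_of_notMem hz]
      norm_num
  have hns : ¬ Summable fun z => fac z * ψ z := by
    intro h
    refine not_summable_inv_levelWeight hsep ?_
    have h1 := h.mul_left (2 * c)⁻¹
    refine (summable_congr_cofinite ?_).1 h1
    rw [Filter.EventuallyEq, Filter.eventually_cofinite]
    refine Set.Finite.subset (Finset.finite_toSet (flooredDiffs a N₁)) fun z hz => ?_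
    by_contra hzN
    refine hz ?_
    have hf := (fac_pos z).ne'
    by_cases hzS : z ∈ S
    · have hzR : z ∈ R := by
        refine ⟨hzS, ?_⟩
        by_contra hlt
        exact hzN (flooredDiffs_mono a (not_le.1 hlt).le (hlevel z hzS))
      rw [hψ, Set.indicator_of_mem hzR, Set.indicator_of_mem hzS]
      field_simp
      simp [hw]
    · rw [hψ, Set.indicator_of_notMem (fun h => hzS h.1), Set.indicator_of_notMem hzS]
      simp
  filter_upwards [ae_infinite_nint_lt hψ0 hψ1 hns] with α hα
  rw [frequently_atTop]
  intro M
  obtain ⟨z, hz, hzM⟩ := hα.exists_notMem_finset (flooredDiffs a M)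
  have hz' : nint (α * z) < 2 * ψ z := hz
  have hzR : z ∈ R := by
    by_contra h
    rw [hψ, Set.indicator_of_notMem h, mul_zero] at hz'
    exact absurd hz' (not_lt.2 (abs_nonneg _))
  have hz1 := hlevel z hzR.1
  refine ⟨firstLevel a z, ?_, ?_⟩
  · by_contra hlt
    exact hzM (flooredDiffs_mono a (not_le.1 hlt).le hz1)
  · obtain ⟨m, n, h1, h2, h3, h4, h5, h6⟩ := exists_floor_eq_of_mem_flooredDiffs hz1
    refine (signedFloorDeltaMin_le h1 h2 h3 h4 h5).trans ?_
    rw [h6, Int.cast_natCast]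
    exact hz'.le.trans (hψle z hzR)

theorem stmt15 (a : ℕ → ℝ)
    (hpos : ∀ n, 1 ≤ n → 0 < a n)
    (hdist : ∀ m n, 1 ≤ m → 1 ≤ n → m ≠ n → a m ≠ a n)
    (hsep : ∀ m n, 1 ≤ m → 1 ≤ n → m ≠ n → 1 ≤ |a m - a n|) :
    ∀ᵐ α ∂(volume.restrict (Set.Icc (0:ℝ) 1)),
      ∃ᶠ N in atTop,
        signedFloorDeltaMin a α N ≤
          4 * Log2 ((sSup {k : ℤ | ∃ m n : ℕ, 1 ≤ m ∧ m ≤ N ∧ 1 ≤ n ∧ n ≤ N ∧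
                m ≠ n ∧ k = |⌊a m - a n⌋|} : ℤ) : ℝ) /
            ((Hcard a N : ℝ) * Log ((N : ℝ) / 9) * Log2 ((N : ℝ) / 9)) := by
  exact ae_frequently_signedFloorDeltaMin_le hsep
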